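/- arXiv:1807.08780 — 2 statements merged into one kernel-verified Lean document; each statement's English description precedes it below -/
import Mathlib

section
/- In the setting of the context, R is homogeneously Khovanskii-finite if and only if there exists an integer λ ≥ 1 such that the Veronese subalgebra R(λ·ℤᵐ) — the K-subalgebra of R generated by ⋃_{u ∈ ℤᵐ} 𝒜 (λ·u) — is a normal domain, i.e. integrally closed in its field of fractions. (Theorem 6.6 / Theorem 1.2 of the paper: an affine almost toric variety X = Spec R with R₀ = K is homogeneously Khovanskii-finite if and only if some Veronese subring is normal.) -/
namespace AlmostToric

section Monoids

/-- A submonoid of `ℕᵏ` containing all `l`-th multiples is finitely generated. -/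
theorem fg_of_nsmul_mem_pi {k : ℕ} {l : ℕ} (hl : 1 ≤ l) (T : AddSubmonoid (Fin k → ℕ))
    (hT : ∀ x, l • x ∈ T) : T.FG := by
  classical
  let Q : (Fin k → Fin l) → Set (Fin k → ℕ) := fun r => {q | l • q + (fun i => (r i : ℕ)) ∈ T}
  let A : Set (Fin k → ℕ) :=
    ⋃ r, (fun q => l • q + (fun i => (r i : ℕ))) '' {q | Minimal (· ∈ Q r) q}
  let B : Set (Fin k → ℕ) := Set.range fun i => l • (Pi.single i 1 : Fin k → ℕ)
  have hA : A.Finite := by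
    refine Set.finite_iUnion fun r => Set.Finite.image _ ?_
    exact (setOfPred_minimal_antichain _).finite_of_partiallyWellOrderedOn
      (Set.isPWO_of_wellQuasiOrderedLE _)
  have hsub : A ∪ B ⊆ T := by
    rintro x (hx | ⟨i, rfl⟩)
    · obtain ⟨r, q, hq, rfl⟩ := Set.mem_iUnion.1 hx
      exact hq.prop
    · exact hT _
  have hmul : ∀ x : Fin k → ℕ, l • x ∈ AddSubmonoid.closure (A ∪ B) := by
    intro x
    have : l • x = ∑ i, x i • (l • (Pi.single i 1 : Fin k → ℕ)) := by
      ext j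
      simp [Finset.sum_apply, Pi.single_apply, mul_comm]
    rw [this]
    exact sum_mem fun i _ => nsmul_mem
      (AddSubmonoid.subset_closure (Set.mem_union_right A (Set.mem_range_self i))) _
  refine (AddSubmonoid.fg_iff _).2 ⟨A ∪ B, ?_, hA.union (Set.finite_range _)⟩
  refine le_antisymm (AddSubmonoid.closure_le.2 hsub) fun t ht => ?_
  let r : Fin k → Fin l := fun i => ⟨t i % l, Nat.mod_lt _ hl⟩
  have hdecomp : ∀ q : Fin k → ℕ, q = (fun i => t i / l) → l • q + (fun i => (r i : ℕ)) = t := by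
    rintro q rfl
    ext i
    simp [r, Nat.div_add_mod]
  have hq : (fun i => t i / l) ∈ Q r := by
    change _ ∈ T
    rwa [hdecomp _ rfl]
  obtain ⟨q₀, hle, hmin⟩ := exists_minimal_le_of_wellFoundedLT (· ∈ Q r) _ hq
  obtain ⟨d, hd⟩ := exists_add_of_le hle
  have : t = (l • q₀ + (fun i => (r i : ℕ))) + l • d := by
    rw [← hdecomp _ hd.symm, smul_add]
    abel
  rw [this]
  exact add_mem (AddSubmonoid.subset_closure
    (Or.inl (Set.mem_iUnion.2 ⟨r, q₀, hmin, rfl⟩))) (hmul d)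

/-- Every finitely generated submonoid is the range of a homomorphism from some `ℕᵏ`. -/
theorem exists_range_eq_of_fg {G : Type*} [AddCommMonoid G] {M : AddSubmonoid G} (hM : M.FG) :
    ∃ (k : ℕ) (g : Fin k → G), (∀ i, g i ∈ M) ∧
      ∀ x, x ∈ M ↔ ∃ n : Fin k → ℕ, ∑ i, n i • g i = x := by
  classical
  obtain ⟨s, rfl⟩ := hM
  let e := s.equivFin.symm
  refine ⟨s.card, fun i => (e i : G), fun i => AddSubmonoid.subset_closure (e i).2, fun x => ?_⟩
  rw [AddSubmonoid.mem_closure_finset']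
  constructor
  · rintro ⟨f, rfl⟩
    exact ⟨fun i => f (e i), Equiv.sum_comp e fun a => f a • (a : G)⟩
  · rintro ⟨n, rfl⟩
    refine ⟨fun a => n (e.symm a), ?_⟩
    rw [← Equiv.sum_comp e]
    simp

/-- If `l • M ≤ S ≤ M` with `M` finitely generated, then `S` is finitely generated. -/
theorem fg_of_nsmul_mem {G : Type*} [AddCommMonoid G] {M S : AddSubmonoid G} (hM : M.FG)
    (hSM : S ≤ M) {l : ℕ} (hl : 1 ≤ l) (hS : ∀ x ∈ M, l • x ∈ S) : S.FG := by
  obtain ⟨k, g, hg, hmem⟩ := exists_range_eq_of_fg hM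
  let φ : (Fin k → ℕ) →+ G :=
    { toFun := fun n => ∑ i, n i • g i
      map_zero' := by simp
      map_add' := fun x y => by simp [add_smul, Finset.sum_add_distrib] }
  have hT : (S.comap φ).FG := fg_of_nsmul_mem_pi hl _ fun x => by
    rw [AddSubmonoid.mem_comap, map_nsmul]
    exact hS _ ((hmem _).2 ⟨x, rfl⟩)
  have : (S.comap φ).map φ = S := by
    refine le_antisymm (AddSubmonoid.map_le_iff_le_comap.2 le_rfl) fun x hx => ?_
    obtain ⟨n, rfl⟩ := (hmem x).1 (hSM hx)
    exact ⟨n, hx, rfl⟩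
  rw [← this]
  exact hT.map φ

/-- If a translate of the ray through `x` lies in a finitely generated monoid, then so does a
positive multiple of `x`. -/
theorem exists_pos_nsmul_mem {G : Type*} [AddCommGroup G] {S : AddSubmonoid G} (hS : S.FG)
    {x y : G} (h : ∀ k : ℕ, y + k • x ∈ S) : ∃ n : ℕ, 0 < n ∧ n • x ∈ S := by
  obtain ⟨k, g, hg, hmem⟩ := exists_range_eq_of_fg hS
  choose n hn using fun k => (hmem _).1 (h k)
  obtain ⟨i, j, hij, hle⟩ := wellQuasiOrdered_le n
  refine ⟨j - i, Nat.sub_pos_of_lt hij, ?_⟩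
  obtain ⟨d, hd⟩ := exists_add_of_le hle
  refine (hmem _).2 ⟨d, ?_⟩
  have hj := hn j
  rw [hd] at hj
  simp only [Pi.add_apply, add_smul, Finset.sum_add_distrib, hn i] at hj
  have h2 : j • x = i • x + (j - i) • x := by rw [← add_smul, Nat.add_sub_cancel' hij.le]
  rw [h2, ← add_assoc] at hj
  exact add_left_cancel hj

end Monoids

end AlmostToric

namespace AlmostToric

section LinearProgramming

/-- One pivoting step: a relation with a negative coefficient allows us to shrink the support of a
nonnegative combination without decreasing the objective. -/
theorem exists_pivot {ι : Type*} [Fintype ι] {q r : ι → ℚ} (hq : ∀ i, 0 ≤ q i)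
    (hsupp : ∀ i, q i = 0 → r i = 0) (hneg : ∃ i, r i < 0) :
    ∃ t : ℚ, 0 ≤ t ∧ (∀ i, 0 ≤ q i + t * r i) ∧ (∀ i, q i = 0 → q i + t * r i = 0) ∧
      ∃ i, q i ≠ 0 ∧ q i + t * r i = 0 := by
  classical
  obtain ⟨i₁, hi₁⟩ := hneg
  obtain ⟨i₀, hi₀, hmin⟩ := Finset.exists_min_image (Finset.univ.filter fun i => r i < 0)
    (fun i => q i / (-r i)) ⟨i₁, by simpa using hi₁⟩
  have hr₀ : r i₀ < 0 := by simpa using hi₀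
  refine ⟨q i₀ / (-r i₀), div_nonneg (hq _) (by linarith), fun i => ?_, fun i hi => ?_, i₀, ?_, ?_⟩
  · rcases lt_or_ge (r i) 0 with hi | hi
    · have h1 := hmin i (by simpa using hi)
      rw [le_div_iff₀ (by linarith)] at h1
      linarith
    · exact add_nonneg (hq i) (mul_nonneg (div_nonneg (hq _) (by linarith)) hi)
  · rw [hi, hsupp i hi]; ring
  · intro h
    have := hsupp i₀ h
    linarith
  · have : r i₀ ≠ 0 := hr₀.ne
    field_simp
    ring

/-- A Carathéodory-type statement: a nonnegative combination may be replaced by one with linearly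
independent support, without decreasing a linear objective that is bounded above. -/
theorem exists_linearIndepOn_support {ι E : Type*} [Fintype ι] [AddCommGroup E] [Module ℚ E]
    (a : ι → ℚ) (u : ι → E)
    (h : ∀ r : ι → ℚ, (∀ i, 0 ≤ r i) → ∑ i, r i • u i = 0 → ∑ i, r i * a i ≤ 0)
    (q : ι → ℚ) (hq : ∀ i, 0 ≤ q i) :
    ∃ q' : ι → ℚ, (∀ i, 0 ≤ q' i) ∧ ∑ i, q' i • u i = ∑ i, q i • u i ∧
      ∑ i, q i * a i ≤ ∑ i, q' i * a i ∧ LinearIndepOn ℚ u {i | q' i ≠ 0} := by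
  classical
  induction hn : (Finset.univ.filter fun i => q i ≠ 0).card using Nat.strong_induction_on
    generalizing q with
  | _ n ih =>
  by_cases hind : LinearIndepOn ℚ u {i | q i ≠ 0}
  · exact ⟨q, hq, rfl, le_rfl, hind⟩
  obtain ⟨r₀, hr₀s, hr₀z, hr₀⟩ : ∃ r : ι → ℚ, (∀ i, q i = 0 → r i = 0) ∧
      ∑ i, r i • u i = 0 ∧ ∃ i, r i ≠ 0 := by
    rw [linearIndepOn_iff] at hind
    push Not at hind
    obtain ⟨l, hl, hl0, hne⟩ := hind
    refine ⟨l, fun i hi => ?_, ?_, ?_⟩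
    · by_contra hc
      exact (Finsupp.mem_supported _ _).1 hl (Finsupp.mem_support_iff.2 hc) hi
    · rw [← hl0, Finsupp.linearCombination_apply, Finsupp.sum_fintype _ _ (by simp)]
    · by_contra! hc
      exact hne (Finsupp.ext hc)
  obtain ⟨r, hrs, hrz, hra, hneg⟩ : ∃ r : ι → ℚ, (∀ i, q i = 0 → r i = 0) ∧
      ∑ i, r i • u i = 0 ∧ 0 ≤ ∑ i, r i * a i ∧ ∃ i, r i < 0 := by
    have key : ∀ r : ι → ℚ, (∀ i, q i = 0 → r i = 0) → ∑ i, r i • u i = 0 →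
        0 < ∑ i, r i * a i → ∃ r : ι → ℚ, (∀ i, q i = 0 → r i = 0) ∧
          ∑ i, r i • u i = 0 ∧ 0 ≤ ∑ i, r i * a i ∧ ∃ i, r i < 0 := by
      intro r h1 h2 h3
      refine ⟨r, h1, h2, h3.le, ?_⟩
      by_contra! hc
      linarith [h r hc h2]
    rcases lt_trichotomy (∑ i, r₀ i * a i) 0 with hlt | heq | hgt
    · exact key (fun i => -r₀ i) (fun i hi => by simp [hr₀s i hi]) (by simp [hr₀z])
        (by simpa using hlt)
    · obtain ⟨i, hi⟩ := hr₀
      rcases lt_or_gt_of_ne hi with hi | hi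
      · exact ⟨r₀, hr₀s, hr₀z, heq.ge, i, hi⟩
      · exact ⟨fun i => -r₀ i, fun i hi => by simp [hr₀s i hi], by simp [hr₀z],
          by simp [heq], i, by simpa using hi⟩
    · exact key r₀ hr₀s hr₀z hgt
  obtain ⟨t, ht, hpos, hz, i₀, hi₀, hi₀'⟩ := exists_pivot hq hrs hneg
  obtain ⟨q', h1, h2, h3, h4⟩ := ih _ (by
    rw [← hn]
    refine Finset.card_lt_card ⟨fun i hi => ?_, fun hsub => ?_⟩
    · simp only [Finset.mem_filter, Finset.mem_univ, true_and] at hi ⊢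
      exact fun hc => hi (hz i hc)
    · have := hsub (x := i₀) (by simpa using hi₀)
      simp [hi₀'] at this) (fun i => q i + t * r i) hpos rfl
  refine ⟨q', h1, ?_, ?_, h4⟩
  · rw [h2]
    simp [add_smul, Finset.sum_add_distrib, mul_smul, ← Finset.smul_sum, hrz]
  · refine le_trans ?_ h3
    simp only [add_mul, Finset.sum_add_distrib, mul_assoc, ← Finset.mul_sum]
    linarith [mul_nonneg ht hra]

/-- Integral points have coordinates of bounded denominator with respect to a linearly independent
family. -/
theorem exists_denominator_of_linearIndepOn {ι : Type*} [Fintype ι] {m : ℕ}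
    (u : ι → Fin m → ℚ) (I : Set ι) (hI : LinearIndepOn ℚ u I) :
    ∃ N : ℕ, 1 ≤ N ∧ ∀ (q : ι → ℚ) (v : Fin m → ℤ), (∀ i, q i ≠ 0 → i ∈ I) →
      ∑ i, q i • u i = (fun j => (v j : ℚ)) → ∀ i, ∃ z : ℤ, (N : ℚ) * q i = z := by
  classical
  have hker : LinearMap.ker (Finsupp.linearCombination ℚ fun i : I => u i) = ⊥ :=
    linearIndependent_iff_ker.1 hI
  obtain ⟨ρ, hρ⟩ := LinearMap.exists_leftInverse_of_injective _ hker
  refine ⟨∏ i : I, ∏ j : Fin m, (ρ (Pi.single j 1) i).den, ?_, fun q v hq hv i => ?_⟩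
  · exact Nat.one_le_iff_ne_zero.2
      (Finset.prod_ne_zero_iff.2 fun i _ => Finset.prod_ne_zero_iff.2 fun j _ => Rat.den_nz _)
  by_cases hi : i ∈ I
  swap
  · exact ⟨0, by simp [not_not.1 fun h => hi (hq i h)]⟩
  have hqi : q i = ∑ j, (v j : ℚ) * ρ (Pi.single j 1) ⟨i, hi⟩ := by
    let l : I →₀ ℚ := Finsupp.equivFunOnFinite.symm fun i => q i
    have h1 : Finsupp.linearCombination ℚ (fun i : I => u i) l = fun j => (v j : ℚ) := by
      rw [← hv, Finsupp.linearCombination_apply, Finsupp.sum_fintype _ _ (by simp)]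
      simp only [l, Finsupp.equivFunOnFinite_symm_apply_apply]
      have := Finset.sum_subtype_of_mem (s := Finset.univ.filter (· ∈ I)) (p := (· ∈ I))
        (fun i => q i • u i) (by simp)
      rw [← Finset.sum_subset (Finset.subset_univ (Finset.univ.filter (· ∈ I))), ← this]
      · refine Finset.sum_congr ?_ fun _ _ => rfl
        ext; simp
      · intro x _ hx
        have : q x = 0 := not_not.1 fun h => hx (by simpa using hq x h)
        simp [this]
    have h2 : l = ρ fun j => (v j : ℚ) := by
      rw [← h1]
      exact (LinearMap.congr_fun hρ l).symm
    have h3 : (fun j => (v j : ℚ)) = ∑ j, (v j : ℚ) • (Pi.single j 1 : Fin m → ℚ) := by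
      ext j
      simp [Finset.sum_apply, Pi.single_apply]
    have h4 : q i = l ⟨i, hi⟩ := rfl
    rw [h4, h2, h3, map_sum, Finsupp.finsetSum_apply]
    simp
  have hden : ∀ j, ∃ z : ℤ, ((∏ i : I, ∏ j : Fin m, (ρ (Pi.single j 1) i).den : ℕ) : ℚ) *
      ρ (Pi.single j 1) ⟨i, hi⟩ = z := by
    intro j
    have hd : (ρ (Pi.single j 1) ⟨i, hi⟩).den ∣
        ∏ i : I, ∏ j : Fin m, (ρ (Pi.single j 1) i).den :=
      (Finset.dvd_prod_of_mem (fun j => (ρ (Pi.single j 1) ⟨i, hi⟩).den) (Finset.mem_univ j)).trans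
        (Finset.dvd_prod_of_mem (fun i : I => ∏ j : Fin m, (ρ (Pi.single j 1) i).den)
          (Finset.mem_univ _))
    obtain ⟨c, hc⟩ := hd
    refine ⟨c * (ρ (Pi.single j 1) ⟨i, hi⟩).num, ?_⟩
    rw [hc]
    push_cast
    rw [mul_comm ((ρ (Pi.single j 1) ⟨i, hi⟩).den : ℚ), mul_assoc, Rat.den_mul_eq_num]
  choose z hz using hden
  refine ⟨∑ j, v j * z j, ?_⟩
  rw [hqi, Finset.mul_sum]
  push_cast
  exact Finset.sum_congr rfl fun j _ => by rw [← hz]; push_cast; ring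

/-- For an integral parametric linear program which is bounded above, there is a uniform `N` such
that over `N • v` the optimal value is attained at an integral point. -/
theorem exists_uniform_integral_optimum {ι : Type*} [Fintype ι] {m : ℕ}
    (a : ι → ℤ) (u : ι → Fin m → ℤ)
    (h : ∀ n : ι → ℕ, ∑ i, n i • u i = 0 → ∑ i, (n i : ℤ) * a i ≤ 0) :
    ∃ N : ℕ, 1 ≤ N ∧ ∀ (v : Fin m → ℤ) (k : ℕ) (n : ι → ℕ), 1 ≤ k →
      ∑ i, n i • u i = k • (N • v) →
      ∃ n' : ι → ℕ, ∑ i, n' i • u i = N • v ∧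
        ∑ i, (n i : ℤ) * a i ≤ k * ∑ i, (n' i : ℤ) * a i := by
  classical
  let uq : ι → Fin m → ℚ := fun i j => u i j
  have hbound : ∀ r : ι → ℚ, (∀ i, 0 ≤ r i) → ∑ i, r i • uq i = 0 →
      ∑ i, r i * (a i : ℚ) ≤ 0 := by
    intro r hr hz
    let D : ℕ := ∏ i, (r i).den
    have hD : (0 : ℚ) < D := by
      exact_mod_cast Nat.pos_of_ne_zero (Finset.prod_ne_zero_iff.2 fun i _ => (r i).den_nz)
    have hn : ∀ i, ∃ n : ℕ, (D : ℚ) * r i = n := by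
      intro i
      obtain ⟨c, hc⟩ := Finset.dvd_prod_of_mem (fun i => (r i).den) (Finset.mem_univ i)
      refine ⟨c * (r i).num.toNat, ?_⟩
      have : ((r i).num.toNat : ℚ) = (r i).num := by
        exact_mod_cast Int.toNat_of_nonneg (Rat.num_nonneg.2 (hr i))
      have hD' : D = (r i).den * c := hc
      rw [hD']
      push_cast
      rw [this, mul_comm ((r i).den : ℚ), mul_assoc, Rat.den_mul_eq_num]
    choose n hn using hn
    have h1 : ∑ i, n i • u i = 0 := by
      ext j
      have := congrFun hz j
      simp only [Finset.sum_apply, Pi.smul_apply, smul_eq_mul, Pi.zero_apply, uq] at this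
      simp only [Finset.sum_apply, Pi.zero_apply, nsmul_eq_mul]
      have h2 : (D : ℚ) * ∑ i, r i * (u i j : ℚ) = 0 := by rw [this, mul_zero]
      rw [Finset.mul_sum] at h2
      simp only [← mul_assoc, hn] at h2
      exact_mod_cast h2
    have h2 := h n h1
    have h3 : (D : ℚ) * ∑ i, r i * (a i : ℚ) ≤ 0 := by
      rw [Finset.mul_sum]
      simp only [← mul_assoc, hn]
      exact_mod_cast h2
    by_contra! hc
    linarith [mul_pos hD hc]
  have hN : ∀ I : Set ι, ∃ N : ℕ, 1 ≤ N ∧ (LinearIndepOn ℚ uq I →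
      ∀ (q : ι → ℚ) (v : Fin m → ℤ), (∀ i, q i ≠ 0 → i ∈ I) →
      ∑ i, q i • uq i = (fun j => (v j : ℚ)) → ∀ i, ∃ z : ℤ, (N : ℚ) * q i = z) := by
    intro I
    by_cases hI : LinearIndepOn ℚ uq I
    · obtain ⟨N, h1, h2⟩ := exists_denominator_of_linearIndepOn uq I hI
      exact ⟨N, h1, fun _ => h2⟩
    · exact ⟨1, le_rfl, fun h => absurd h hI⟩
  choose N hN1 hN using hN
  refine ⟨∏ I, N I, Finset.one_le_prod'' hN1, fun v k n hk hn => ?_⟩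
  set M : ℕ := ∏ I, N I with hM
  have hMpos : (0 : ℚ) < M := by
    exact_mod_cast (Finset.one_le_prod'' hN1 : 1 ≤ ∏ I, N I)
  have hkpos : (0 : ℚ) < k := by exact_mod_cast hk
  obtain ⟨q, hq0, hqu, hqa, hqI⟩ := exists_linearIndepOn_support (fun i => (a i : ℚ)) uq hbound
    (fun i => (n i : ℚ) / (k * M)) (fun i => by positivity)
  have hv : ∑ i, q i • uq i = fun j => (v j : ℚ) := by
    rw [hqu]
    ext j
    have := congrFun hn j
    simp only [Finset.sum_apply, Pi.smul_apply, nsmul_eq_mul] at this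
    have h' : ∑ i, (n i : ℚ) * (u i j : ℚ) = k * (M * v j) := by exact_mod_cast this
    simp only [Finset.sum_apply, Pi.smul_apply, smul_eq_mul, uq, div_mul_eq_mul_div]
    rw [← Finset.sum_div, h']
    field_simp
  have hintegral : ∀ i, ∃ z : ℕ, (M : ℚ) * q i = z := by
    intro i
    obtain ⟨z, hz⟩ := hN {i | q i ≠ 0} hqI q v (fun i hi => hi) hv i
    obtain ⟨c, hc⟩ := Finset.dvd_prod_of_mem N (Finset.mem_univ {i | q i ≠ 0})
    have hz0 : 0 ≤ z := by
      have : (0 : ℚ) ≤ z := by rw [← hz]; exact mul_nonneg (by positivity) (hq0 i)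
      exact_mod_cast this
    refine ⟨c * z.toNat, ?_⟩
    have hz' : ((z.toNat : ℕ) : ℚ) = z := by exact_mod_cast Int.toNat_of_nonneg hz0
    rw [hM, hc]
    push_cast
    rw [hz', ← hz]
    ring
  choose n' hn' using hintegral
  refine ⟨n', ?_, ?_⟩
  · ext j
    have := congrFun hv j
    simp only [Finset.sum_apply, Pi.smul_apply, smul_eq_mul, uq] at this
    simp only [Finset.sum_apply, Pi.smul_apply, nsmul_eq_mul]
    have h2 : (M : ℚ) * ∑ i, q i * (u i j : ℚ) = M * v j := by rw [this]
    rw [Finset.mul_sum] at h2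
    simp only [← mul_assoc, hn'] at h2
    exact_mod_cast h2
  · have h1 : (M : ℚ) * ∑ i, q i * (a i : ℚ) = ∑ i, (n' i : ℚ) * a i := by
      rw [Finset.mul_sum]
      simp only [← mul_assoc, hn']
    have h2 : ∑ i, (n i : ℚ) / (k * M) * a i = (∑ i, (n i : ℚ) * a i) / (k * M) := by
      rw [Finset.sum_div]
      exact Finset.sum_congr rfl fun i _ => by ring
    rw [h2, div_le_iff₀ (by positivity)] at hqa
    have h3 : ∑ i, (n i : ℚ) * a i ≤ k * ∑ i, (n' i : ℚ) * a i := by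
      rw [← h1]
      linarith
    exact_mod_cast h3

end LinearProgramming

end AlmostToric

namespace AlmostToric

open Polynomial

section Order

variable {K : Type*} [Field K]

/-- The order of vanishing of a rational function at a point of the projective line, where `none`
is the point at infinity. -/
noncomputable def ord : Option K → RatFunc K → ℤ
  | some a, f => (f.num.rootMultiplicity a : ℤ) - f.denom.rootMultiplicity a
  | none, f => -f.intDegree

theorem num_mul_eq {f : RatFunc K} {p q : K[X]} (hq : q ≠ 0)
    (h : f = algebraMap K[X] (RatFunc K) p / algebraMap K[X] (RatFunc K) q) :
    f.num * q = p * f.denom := by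
  apply RatFunc.algebraMap_injective K
  rw [map_mul, map_mul]
  exact (div_eq_div_iff (RatFunc.algebraMap_ne_zero f.denom_ne_zero)
    (RatFunc.algebraMap_ne_zero hq)).1 ((RatFunc.num_div_denom f).trans h)

theorem ord_some_eq {f : RatFunc K} {p q : K[X]} (hp : p ≠ 0) (hq : q ≠ 0)
    (h : f = algebraMap K[X] (RatFunc K) p / algebraMap K[X] (RatFunc K) q) (a : K) :
    ord (some a) f = (p.rootMultiplicity a : ℤ) - q.rootMultiplicity a := by
  have h1 := num_mul_eq hq h
  have hne : p * f.denom ≠ 0 := mul_ne_zero hp f.denom_ne_zero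
  have h2 := congrArg (rootMultiplicity a) h1
  rw [rootMultiplicity_mul hne, rootMultiplicity_mul (h1 ▸ hne)] at h2
  simp only [ord]
  omega

theorem ord_mul (P : Option K) {f g : RatFunc K} (hf : f ≠ 0) (hg : g ≠ 0) :
    ord P (f * g) = ord P f + ord P g := by
  cases P with
  | none => simp only [ord, RatFunc.intDegree_mul hf hg]; ring
  | some a =>
    have h : f * g = algebraMap K[X] (RatFunc K) (f.num * g.num) /
        algebraMap K[X] (RatFunc K) (f.denom * g.denom) := by
      rw [map_mul, map_mul, ← div_mul_div_comm, RatFunc.num_div_denom, RatFunc.num_div_denom]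
    have hn := mul_ne_zero (RatFunc.num_ne_zero hf) (RatFunc.num_ne_zero hg)
    have hd := mul_ne_zero f.denom_ne_zero g.denom_ne_zero
    rw [ord_some_eq hn hd h, rootMultiplicity_mul hn, rootMultiplicity_mul hd]
    simp only [ord]
    push_cast
    ring

theorem ord_algebraMap (P : Option K) (c : K) : ord P (algebraMap K (RatFunc K) c) = 0 := by
  rw [RatFunc.algebraMap_eq_C]
  cases P <;> simp [ord]

theorem ord_one (P : Option K) : ord P (1 : RatFunc K) = 0 := by
  simpa using ord_algebraMap P (1 : K)

theorem ord_inv (P : Option K) {f : RatFunc K} (hf : f ≠ 0) : ord P f⁻¹ = -ord P f := by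
  have := ord_mul P hf (inv_ne_zero hf)
  rw [mul_inv_cancel₀ hf, ord_one] at this
  omega

theorem ord_div (P : Option K) {f g : RatFunc K} (hf : f ≠ 0) (hg : g ≠ 0) :
    ord P (f / g) = ord P f - ord P g := by
  rw [div_eq_mul_inv, ord_mul P hf (inv_ne_zero hg), ord_inv P hg]
  ring

theorem ord_pow (P : Option K) {f : RatFunc K} (hf : f ≠ 0) (n : ℕ) :
    ord P (f ^ n) = n * ord P f := by
  induction n with
  | zero => simp [ord_one]
  | succ n ih => rw [pow_succ, ord_mul P (pow_ne_zero n hf) hf, ih]; push_cast; ring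

theorem ord_zpow (P : Option K) {f : RatFunc K} (hf : f ≠ 0) (n : ℤ) :
    ord P (f ^ n) = n * ord P f := by
  cases n with
  | ofNat n => simp [ord_pow P hf]
  | negSucc n =>
    rw [zpow_negSucc, ord_inv P (pow_ne_zero _ hf), ord_pow P hf, Int.negSucc_eq]
    push_cast
    ring

theorem ord_prod {ι : Type*} (P : Option K) (s : Finset ι) (f : ι → RatFunc K)
    (hf : ∀ i ∈ s, f i ≠ 0) : ord P (∏ i ∈ s, f i) = ∑ i ∈ s, ord P (f i) := by
  classical
  induction s using Finset.induction_on with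
  | empty => simp [ord_one]
  | insert i s hi ih =>
    rw [Finset.prod_insert hi, Finset.sum_insert hi,
      ord_mul P (hf i (Finset.mem_insert_self _ _))
        (Finset.prod_ne_zero_iff.2 fun j hj => hf j (Finset.mem_insert_of_mem hj)),
      ih fun j hj => hf j (Finset.mem_insert_of_mem hj)]

theorem min_ord_le_ord_add (P : Option K) {f g : RatFunc K} (hf : f ≠ 0) (hg : g ≠ 0)
    (hfg : f + g ≠ 0) : min (ord P f) (ord P g) ≤ ord P (f + g) := by
  cases P with
  | none =>
    have := RatFunc.intDegree_add_le hg hfg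
    simp only [ord]
    omega
  | some a =>
    have hfd := f.denom_ne_zero
    have hgd := g.denom_ne_zero
    have hfd' := RatFunc.algebraMap_ne_zero hfd
    have hgd' := RatFunc.algebraMap_ne_zero hgd
    have h : f + g = algebraMap K[X] (RatFunc K) (f.num * g.denom + f.denom * g.num) /
        algebraMap K[X] (RatFunc K) (f.denom * g.denom) := by
      rw [map_add, map_mul, map_mul, map_mul, ← div_add_div _ _ hfd' hgd',
        RatFunc.num_div_denom, RatFunc.num_div_denom]
    have hd := mul_ne_zero hfd hgd
    have hn : f.num * g.denom + f.denom * g.num ≠ 0 := by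
      intro h0
      rw [h0] at h
      simp [hfg] at h
    have h1 := rootMultiplicity_add (a := a) hn
    rw [rootMultiplicity_mul (mul_ne_zero (RatFunc.num_ne_zero hf) hgd),
      rootMultiplicity_mul (mul_ne_zero hfd (RatFunc.num_ne_zero hg))] at h1
    rw [ord_some_eq hn hd h, rootMultiplicity_mul hd]
    simp only [ord]
    omega

theorem X_sub_C_ne_zero' (a : K) : (RatFunc.X - RatFunc.C a : RatFunc K) ≠ 0 := by
  rw [← RatFunc.algebraMap_X, ← RatFunc.algebraMap_C, ← map_sub]
  exact RatFunc.algebraMap_ne_zero (X_sub_C_ne_zero a)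

theorem ord_some_X_sub_C [DecidableEq K] (a b : K) :
    ord (some b) (RatFunc.X - RatFunc.C a : RatFunc K) = if b = a then 1 else 0 := by
  have h : (RatFunc.X - RatFunc.C a : RatFunc K) = algebraMap K[X] (RatFunc K) (X - C a) /
      algebraMap K[X] (RatFunc K) 1 := by
    rw [map_sub, RatFunc.algebraMap_X, RatFunc.algebraMap_C, map_one, div_one]
  rw [ord_some_eq (X_sub_C_ne_zero a) one_ne_zero h, rootMultiplicity_X_sub_C]
  split_ifs <;> simp

theorem ord_none_X_sub_C (a : K) : ord none (RatFunc.X - RatFunc.C a : RatFunc K) = -1 := by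
  rw [← RatFunc.algebraMap_X, ← RatFunc.algebraMap_C, ← map_sub, ord, RatFunc.intDegree_polynomial,
    natDegree_X_sub_C]
  simp

/-- Divisors of degree zero on the projective line are principal. -/
theorem exists_ord_eq [DecidableEq K] (s : Finset (Option K)) (D : Option K → ℤ)
    (hD : ∑ Q ∈ s, D Q = 0) :
    ∃ f : RatFunc K, f ≠ 0 ∧ ∀ Q, ord Q f = if Q ∈ s then D Q else 0 := by
  have hne : ∀ a ∈ s.eraseNone, (RatFunc.X - RatFunc.C a : RatFunc K) ^ D (some a) ≠ 0 :=
    fun a _ => zpow_ne_zero _ (X_sub_C_ne_zero' a)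
  refine ⟨∏ a ∈ s.eraseNone, (RatFunc.X - RatFunc.C a : RatFunc K) ^ D (some a),
    Finset.prod_ne_zero_iff.2 hne, fun Q => ?_⟩
  rw [ord_prod Q _ _ hne]
  simp only [ord_zpow Q (X_sub_C_ne_zero' _)]
  cases Q with
  | some b => simp [ord_some_X_sub_C]
  | none =>
    simp only [ord_none_X_sub_C, mul_neg, mul_one, Finset.sum_neg_distrib]
    have h1 : ∑ a ∈ s.eraseNone, D (some a) = ∑ Q ∈ s.erase none, D Q := by
      rw [← Finset.map_some_eraseNone, Finset.sum_map]
      rfl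
    rw [h1]
    split_ifs with h
    · rw [← Finset.add_sum_erase s D h] at hD
      omega
    · rw [Finset.erase_eq_of_notMem h, hD, neg_zero]

theorem exists_finset_ord_eq_zero (f : RatFunc K) :
    ∃ s : Finset (Option K), ∀ Q ∉ s, ord Q f = 0 := by
  classical
  refine ⟨insert none ((f.num.roots.toFinset ∪ f.denom.roots.toFinset).map
    Function.Embedding.some), fun Q hQ => ?_⟩
  cases Q with
  | none => simp at hQ
  | some a =>
    simp only [Finset.mem_insert, reduceCtorEq, Finset.mem_map, Finset.mem_union,
      Function.Embedding.some_apply, Option.some.injEq, exists_eq_right, false_or, not_or,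
      Multiset.mem_toFinset] at hQ
    simp only [ord]
    rw [← count_roots, ← count_roots, Multiset.count_eq_zero_of_notMem hQ.1,
      Multiset.count_eq_zero_of_notMem hQ.2]
    simp

theorem sum_rootMultiplicity_eq [IsAlgClosed K] [DecidableEq K] (p : K[X]) (s : Finset K)
    (hs : ∀ a ∉ s, p.rootMultiplicity a = 0) :
    ∑ a ∈ s, p.rootMultiplicity a = p.natDegree := by
  rw [← (splits_iff_card_roots.1 (IsAlgClosed.splits p)), ← Multiset.toFinset_sum_count_eq]
  simp only [count_roots]
  refine (Finset.sum_subset (fun a ha => ?_) fun a _ ha => ?_).symm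
  · by_contra h
    have := hs a h
    rw [← count_roots, Multiset.count_eq_zero] at this
    exact this (by simpa using ha)
  · rw [← count_roots, Multiset.count_eq_zero]
    simpa using ha

/-- The product formula: principal divisors have degree zero. -/
theorem sum_ord_eq_zero [IsAlgClosed K] (f : RatFunc K) (s : Finset (Option K))
    (hs : ∀ Q ∉ s, ord Q f = 0) : ∑ Q ∈ s, ord Q f = 0 := by
  classical
  let t : Finset (Option K) := insert none (s ∪ (f.num.roots.toFinset ∪ f.denom.roots.toFinset).map
    Function.Embedding.some)
  have h1 : ∑ Q ∈ s, ord Q f = ∑ Q ∈ t, ord Q f :=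
    Finset.sum_subset (fun Q hQ => by simp [t, hQ]) fun Q _ hQ => hs Q hQ
  have h2 : ∑ Q ∈ t, ord Q f = ord none f + ∑ a ∈ t.eraseNone, ord (some a) f := by
    rw [← Finset.add_sum_erase t _ (show none ∈ t by simp [t]), ← Finset.map_some_eraseNone,
      Finset.sum_map]
    rfl
  rw [h1, h2]
  simp only [ord, Finset.sum_sub_distrib, ← Nat.cast_sum]
  rw [sum_rootMultiplicity_eq, sum_rootMultiplicity_eq, RatFunc.intDegree]
  · ring
  all_goals
    intro a ha
    rw [← count_roots, Multiset.count_eq_zero]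
    intro h
    apply ha
    simp only [Finset.mem_eraseNone, t, Finset.mem_insert, Finset.mem_union, Finset.mem_map]
    right; right
    exact ⟨a, by simp only [Multiset.mem_toFinset]; tauto, rfl⟩

/-- A valuation subring of `K(X)` containing `K` contains the local ring of a point of the
projective line. -/
theorem exists_point_of_valuationSubring [IsAlgClosed K] (O : ValuationSubring (RatFunc K))
    (hO : ∀ c : K, algebraMap K (RatFunc K) c ∈ O) :
    ∃ P : Option K, ∀ f : RatFunc K, f ≠ 0 → 0 ≤ ord P f → f ∈ O := by
  classical
  have hC : ∀ c : K, RatFunc.C c ∈ O := fun c => by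
    rw [← RatFunc.algebraMap_eq_C]; exact hO c
  by_cases hX : (RatFunc.X : RatFunc K) ∈ O
  · have hpoly : ∀ p : K[X], algebraMap K[X] (RatFunc K) p ∈ O := by
      intro p
      induction p using Polynomial.induction_on' with
      | add p q hp hq => rw [map_add]; exact add_mem hp hq
      | monomial n c =>
        rw [← C_mul_X_pow_eq_monomial, map_mul, map_pow, RatFunc.algebraMap_C, RatFunc.algebraMap_X]
        exact mul_mem (hC c) (pow_mem hX n)
    obtain ⟨a, ha⟩ : ∃ a : K, ∀ b, b ≠ a → (RatFunc.X - RatFunc.C b : RatFunc K)⁻¹ ∈ O := by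
      by_contra! hcon
      obtain ⟨b₀, -, h0⟩ := hcon 0
      obtain ⟨b₁, hne, h1⟩ := hcon b₀
      have hm : ∀ b, (RatFunc.X - RatFunc.C b : RatFunc K)⁻¹ ∉ O →
          O.valuation (RatFunc.X - RatFunc.C b) < 1 := by
        intro b hb
        rw [← O.valuation_le_one_iff, map_inv₀, not_le] at hb
        rwa [one_lt_inv₀ ((O.valuation).pos_iff.2 (X_sub_C_ne_zero' b))] at hb
      have h2 := (O.valuation).map_sub_lt (hm _ h0) (hm _ h1)
      have h3 : (RatFunc.X - RatFunc.C b₀ : RatFunc K) - (RatFunc.X - RatFunc.C b₁) =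
          RatFunc.C (b₁ - b₀) := by rw [map_sub]; ring
      rw [h3] at h2
      have h4 := (O.valuation_le_one_iff _).2 (hC (b₁ - b₀)⁻¹)
      rw [map_inv₀, map_inv₀] at h4
      have h5 : O.valuation (RatFunc.C (b₁ - b₀)) ≠ 0 := by
        rw [Valuation.ne_zero_iff]
        exact (_root_.map_ne_zero RatFunc.C).2 (sub_ne_zero.2 hne)
      rw [inv_le_one₀ (zero_lt_iff.2 h5)] at h4
      exact absurd h2 (not_lt.2 h4)
    refine ⟨some a, fun f hf hord => ?_⟩
    have hroot : f.denom.rootMultiplicity a = 0 := by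
      by_contra hne
      have h1 : f.denom.IsRoot a := (rootMultiplicity_pos f.denom_ne_zero).1 (Nat.pos_of_ne_zero hne)
      have h2 : f.num.IsRoot a := by
        refine (rootMultiplicity_pos (RatFunc.num_ne_zero hf)).1 ?_
        simp only [ord] at hord
        omega
      obtain ⟨x, y, hxy⟩ := RatFunc.isCoprime_num_denom f
      have := congrArg (eval a) hxy
      rw [eval_add, eval_mul, eval_mul, h1.eq_zero, h2.eq_zero] at this
      simp at this
    have hden : (algebraMap K[X] (RatFunc K) f.denom)⁻¹ ∈ O := by
      rw [(IsAlgClosed.splits f.denom).eq_prod_roots, map_mul, mul_inv, RatFunc.algebraMap_C,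
        ← map_inv₀, map_multiset_prod, ← Multiset.prod_map_inv']
      refine mul_mem (hC _) (multiset_prod_mem _ fun x hx => ?_)
      simp only [Multiset.map_map, Multiset.mem_map, Function.comp_apply] at hx
      obtain ⟨b, hb, rfl⟩ := hx
      rw [map_sub, RatFunc.algebraMap_X, RatFunc.algebraMap_C]
      refine ha b ?_
      rintro rfl
      rw [← count_roots, Multiset.count_eq_zero] at hroot
      exact hroot hb
    rw [← RatFunc.num_div_denom f, div_eq_mul_inv]
    exact mul_mem (hpoly _) hden
  · have hXinv : (RatFunc.X : RatFunc K)⁻¹ ∈ O := (O.mem_or_inv_mem _).resolve_left hX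
    have hX0 : (RatFunc.X : RatFunc K) ≠ 0 := RatFunc.X_ne_zero
    have hpoly : ∀ (p : K[X]) (n : ℕ), p.natDegree ≤ n →
        algebraMap K[X] (RatFunc K) p * (RatFunc.X : RatFunc K)⁻¹ ^ n ∈ O := by
      intro p n hp
      rw [p.as_sum_range' (n + 1) (Nat.lt_succ_of_le hp), map_sum, Finset.sum_mul]
      refine sum_mem fun i hi => ?_
      rw [Finset.mem_range_succ_iff] at hi
      obtain ⟨j, rfl⟩ := exists_add_of_le hi
      rw [← C_mul_X_pow_eq_monomial, map_mul, map_pow, RatFunc.algebraMap_C, RatFunc.algebraMap_X,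
        pow_add, mul_assoc, ← mul_assoc (RatFunc.X ^ i), ← mul_pow, mul_inv_cancel₀ hX0, one_pow,
        one_mul]
      exact mul_mem (hC _) (pow_mem hXinv _)
    have hv : O.valuation (RatFunc.X : RatFunc K)⁻¹ < 1 := by
      rw [← O.valuation_le_one_iff, not_le] at hX
      rw [map_inv₀]
      exact inv_lt_one_of_one_lt₀ hX
    have hlin : ∀ b : K, ((RatFunc.X - RatFunc.C b : RatFunc K) * RatFunc.X⁻¹)⁻¹ ∈ O := by
      intro b
      rw [← O.valuation_le_one_iff, map_inv₀]
      have : (RatFunc.X - RatFunc.C b : RatFunc K) * RatFunc.X⁻¹ = 1 - RatFunc.C b * RatFunc.X⁻¹ := by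
        rw [sub_mul, mul_inv_cancel₀ hX0]
      rw [this, (O.valuation).map_one_sub_of_lt, inv_one]
      rw [map_mul]
      exact mul_lt_one_of_nonneg_of_lt_one_right ((O.valuation_le_one_iff _).2 (hC b)) zero_le hv
    refine ⟨none, fun f hf hord => ?_⟩
    simp only [ord, RatFunc.intDegree] at hord
    have hden : (algebraMap K[X] (RatFunc K) f.denom * RatFunc.X⁻¹ ^ f.denom.natDegree)⁻¹ ∈ O := by
      have hs := IsAlgClosed.splits f.denom
      rw [← splits_iff_card_roots.1 hs]
      nth_rw 1 [hs.eq_prod_roots]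
      rw [map_mul, mul_assoc, mul_inv, RatFunc.algebraMap_C, ← map_inv₀, map_multiset_prod,
        Multiset.map_map, ← Multiset.prod_replicate, ← Multiset.map_const', ← Multiset.prod_map_mul,
        ← Multiset.prod_map_inv']
      refine mul_mem (hC _) (multiset_prod_mem _ fun x hx => ?_)
      simp only [Multiset.map_map, Multiset.mem_map, Function.comp_apply] at hx
      obtain ⟨b, hb, rfl⟩ := hx
      rw [map_sub, RatFunc.algebraMap_X, RatFunc.algebraMap_C]
      exact hlin b
    have : f = algebraMap K[X] (RatFunc K) f.num * RatFunc.X⁻¹ ^ f.denom.natDegree *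
        (algebraMap K[X] (RatFunc K) f.denom * RatFunc.X⁻¹ ^ f.denom.natDegree)⁻¹ := by
      have hd := RatFunc.algebraMap_ne_zero f.denom_ne_zero
      have hp : (RatFunc.X : RatFunc K)⁻¹ ^ f.denom.natDegree ≠ 0 :=
        pow_ne_zero _ (inv_ne_zero hX0)
      rw [← div_eq_mul_inv, mul_div_mul_right _ _ hp, RatFunc.num_div_denom]
    rw [this]
    exact mul_mem (hpoly _ _ (by omega)) hden

end Order

end AlmostToric

namespace AlmostToric

open Polynomial

section GenericVanishing

variable {K : Type*} [Field K]

/-- At all but finitely many points, a nonzero element of a space of polynomials of dimension at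
most `d` vanishes to order less than `d`. -/
theorem exists_finset_forall_pow_dvd_eq_zero [CharZero K] (d : ℕ) (V : Submodule K K[X])
    [FiniteDimensional K V] (hd : Module.finrank K V ≤ d) :
    ∃ B : Finset K, ∀ a ∉ B, ∀ f ∈ V, (X - C a) ^ d ∣ f → f = 0 := by
  classical
  induction d generalizing V with
  | zero =>
    refine ⟨∅, fun a _ f hf _ => ?_⟩
    rw [Nat.le_zero, Submodule.finrank_eq_zero] at hd
    rwa [hd, Submodule.mem_bot] at hf
  | succ d ih =>
    by_cases hV : V = ⊥
    · refine ⟨∅, fun a _ f hf _ => ?_⟩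
      rwa [hV, Submodule.mem_bot] at hf
    obtain ⟨f₀, hf₀V, hf₀⟩ := V.ne_bot_iff.1 hV
    let φ : K[X] →ₗ[K] K[X] := LinearMap.mulLeft K f₀ ∘ₗ derivative -
      LinearMap.mulLeft K (derivative f₀)
    have hφ : ∀ f, φ f = f₀ * derivative f - derivative f₀ * f := fun f => rfl
    have hW : Module.finrank K (V.map φ) ≤ d := by
      have h1 := LinearMap.finrank_range_add_finrank_ker (φ.domRestrict V)
      rw [LinearMap.range_domRestrict] at h1
      have h2 : 0 < Module.finrank K (LinearMap.ker (φ.domRestrict V)) := by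
        rw [Nat.pos_iff_ne_zero, Ne, Submodule.finrank_eq_zero, ← Ne, Submodule.ne_bot_iff]
        refine ⟨⟨f₀, hf₀V⟩, ?_, ?_⟩
        · rw [LinearMap.mem_ker, LinearMap.domRestrict_apply, hφ]
          ring
        · simpa [Subtype.ext_iff] using hf₀
      omega
    obtain ⟨B, hB⟩ := ih (V.map φ) hW
    refine ⟨B ∪ f₀.roots.toFinset, fun a ha f hf hdvd => ?_⟩
    simp only [Finset.mem_union, Multiset.mem_toFinset, mem_roots', not_and, not_or] at ha
    have hroot := ha.2 hf₀
    by_contra hf0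
    have hdvd' : (X - C a) ^ d ∣ φ f := by
      obtain ⟨g, rfl⟩ := hdvd
      rw [hφ, derivative_mul, derivative_pow_succ]
      refine dvd_sub (Dvd.dvd.mul_left (dvd_add ?_ ?_) _) (Dvd.dvd.mul_left ?_ _)
      · exact Dvd.dvd.mul_right (Dvd.dvd.mul_right (Dvd.intro_left _ rfl) _) _
      · exact Dvd.dvd.mul_right (pow_dvd_pow _ d.le_succ) _
      · exact Dvd.dvd.mul_right (pow_dvd_pow _ d.le_succ) _
    have hzero := hB a ha.1 (φ f) (Submodule.mem_map_of_mem hf) hdvd'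
    rw [hφ, sub_eq_zero] at hzero
    have hfa : f.IsRoot a :=
      dvd_iff_isRoot.1 ((dvd_pow_self _ (Nat.succ_ne_zero d)).trans hdvd)
    have hpos := (rootMultiplicity_pos hf0).2 hfa
    have hder := derivative_rootMultiplicity_of_root hfa
    have hf' : derivative f ≠ 0 := by
      intro h
      rw [eq_C_of_natDegree_eq_zero (derivative_eq_zero.1 h)] at hfa hf0
      simp_all
    have hL : f₀ * derivative f ≠ 0 := mul_ne_zero hf₀ hf'
    have h1 := congrArg (rootMultiplicity a) hzero
    rw [rootMultiplicity_mul hL, rootMultiplicity_mul (hzero ▸ hL), hder,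
      rootMultiplicity_eq_zero hroot] at h1
    omega

/-- A space of polynomials of dimension `d + 1` has a nonzero element vanishing to order `d` at a
given point. -/
theorem exists_mem_pow_dvd (d : ℕ) (a : K) (V : Submodule K K[X])
    [FiniteDimensional K V] (hd : d < Module.finrank K V) :
    ∃ f ∈ V, f ≠ 0 ∧ (X - C a) ^ d ∣ f := by
  have hq : ((X - C a) ^ d).Monic := (monic_X_sub_C a).pow d
  let φ : K[X] →ₗ[K] (Fin d → K) :=
    LinearMap.pi (fun i => lcoeff K (i : ℕ)) ∘ₗ modByMonicHom ((X - C a) ^ d)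
  have hker : LinearMap.ker (φ.domRestrict V) ≠ ⊥ :=
    LinearMap.ker_ne_bot_of_finrank_lt (by simpa using hd)
  obtain ⟨f, hf, hf0⟩ := (Submodule.ne_bot_iff _).1 hker
  refine ⟨f, f.2, by simpa using hf0, ?_⟩
  rw [← modByMonic_eq_zero_iff_dvd hq]
  ext i
  rw [coeff_zero]
  by_cases hi : i < d
  · exact congrFun (LinearMap.mem_ker.1 hf) ⟨i, hi⟩
  · refine coeff_eq_zero_of_degree_lt ((degree_modByMonic_lt _ hq).trans_le ?_)
    rw [degree_pow, degree_X_sub_C, nsmul_one]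
    exact_mod_cast not_lt.1 hi

theorem exists_common_denominator (V : Submodule K (RatFunc K)) [FiniteDimensional K V] :
    ∃ q : K[X], q ≠ 0 ∧ ∀ f ∈ V, ∃ p : K[X], algebraMap K[X] (RatFunc K) q * f =
      algebraMap K[X] (RatFunc K) p := by
  obtain ⟨s, hs⟩ := (Submodule.fg_iff_finiteDimensional V).2 inferInstance
  obtain ⟨b, hb⟩ := IsLocalization.exist_integer_multiples_of_finset (nonZeroDivisors K[X]) s
  refine ⟨b, nonZeroDivisors.coe_ne_zero b, fun f hf => ?_⟩
  rw [← hs] at hf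
  induction hf using Submodule.span_induction with
  | mem x hx =>
    obtain ⟨p, hp⟩ := hb x hx
    exact ⟨p, by rw [hp, Algebra.smul_def]⟩
  | zero => exact ⟨0, by simp⟩
  | add x y _ _ hx hy =>
    obtain ⟨p, hp⟩ := hx
    obtain ⟨p', hp'⟩ := hy
    exact ⟨p + p', by rw [mul_add, hp, hp', map_add]⟩
  | smul c x _ hx =>
    obtain ⟨p, hp⟩ := hx
    exact ⟨c • p, by
      rw [mul_smul_comm, hp]
      exact (map_smul (IsScalarTower.toAlgHom K K[X] (RatFunc K)) c p).symm⟩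

/-- At all but finitely many points `a`, the orders of vanishing at `a` of the nonzero elements of
a finite-dimensional space of rational functions are nonnegative and less than the dimension, and
the largest possible value is attained. -/
theorem exists_finset_forall_ord_lt [CharZero K] (V : Submodule K (RatFunc K))
    [FiniteDimensional K V] :
    ∃ B : Finset K, ∀ a ∉ B,
      (∀ f ∈ V, f ≠ 0 → ord (some a) f < Module.finrank K V) ∧
      ∀ d < Module.finrank K V, ∃ f ∈ V, f ≠ 0 ∧ (d : ℤ) ≤ ord (some a) f := by
  classical
  obtain ⟨q, hq, hV⟩ := exists_common_denominator V
  let ψ : K[X] →ₗ[K] RatFunc K := LinearMap.mulLeft K (algebraMap K[X] (RatFunc K) q)⁻¹ ∘ₗ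
    (IsScalarTower.toAlgHom K K[X] (RatFunc K)).toLinearMap
  have hψ : ∀ p, ψ p = algebraMap K[X] (RatFunc K) p / algebraMap K[X] (RatFunc K) q := fun p => by
    rw [div_eq_inv_mul]; rfl
  have hq' := RatFunc.algebraMap_ne_zero hq
  have hinj : Function.Injective ψ := by
    intro x y hxy
    rw [hψ, hψ, div_left_inj' hq'] at hxy
    exact RatFunc.algebraMap_injective K hxy
  let W := V.comap ψ
  have hWV : W.map ψ = V := by
    refine Submodule.map_comap_eq_of_le fun f hf => ?_
    obtain ⟨p, hp⟩ := hV f hf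
    exact ⟨p, by rw [hψ, ← hp, mul_div_cancel_left₀ _ hq']⟩
  let e : W ≃ₗ[K] V := (Submodule.equivMapOfInjective ψ hinj W).trans (LinearEquiv.ofEq _ _ hWV)
  have : FiniteDimensional K W := Module.Finite.equiv e.symm
  have hfin : Module.finrank K W = Module.finrank K V := e.finrank_eq
  obtain ⟨B, hB⟩ := exists_finset_forall_pow_dvd_eq_zero _ W le_rfl
  have hordψ : ∀ a, ¬ q.IsRoot a → ∀ p : K[X], p ≠ 0 →
      ord (some a) (ψ p) = p.rootMultiplicity a := fun a ha p hp => by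
    rw [ord_some_eq hp hq (hψ p), rootMultiplicity_eq_zero ha]
    simp
  refine ⟨B ∪ q.roots.toFinset, fun a ha => ?_⟩
  simp only [Finset.mem_union, Multiset.mem_toFinset, mem_roots', not_and, not_or] at ha
  have haq := ha.2 hq
  rw [← hfin]
  refine ⟨fun f hf hf0 => ?_, fun d hd => ?_⟩
  · rw [← hWV] at hf
    obtain ⟨p, hp, rfl⟩ := hf
    have hp0 : p ≠ 0 := by rintro rfl; simp at hf0
    rw [hordψ a haq p hp0, Nat.cast_lt]
    by_contra hlt
    exact hp0 (hB a ha.1 p hp ((le_rootMultiplicity_iff hp0).1 (not_lt.1 hlt)))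
  · obtain ⟨p, hp, hp0, hdvd⟩ := exists_mem_pow_dvd d a W hd
    refine ⟨ψ p, hp, ?_, ?_⟩
    · rw [Ne, ← map_zero ψ]
      exact fun h => hp0 (hinj h)
    · rw [hordψ a haq p hp0, Nat.cast_le]
      exact (le_rootMultiplicity_iff hp0).2 hdvd

end GenericVanishing

end AlmostToric

namespace AlmostToric

/-- The conductor of an affine domain in characteristic zero is nonzero. -/
theorem exists_conductor (K R : Type*) [Field K] [CharZero K] [CommRing R] [IsDomain R]
    [Algebra K R] [Algebra.FiniteType K R] :
    ∃ c : R, c ≠ 0 ∧ ∀ x : FractionRing R, IsIntegral R x →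
      ∃ r : R, algebraMap R (FractionRing R) c * x = algebraMap R (FractionRing R) r := by
  obtain ⟨s, g, hg, hintegral⟩ := exists_integral_inj_algHom_of_fg K R
  let A := MvPolynomial (Fin s) K
  let _ : Algebra A R := g.toRingHom.toAlgebra
  have : FaithfulSMul A (FractionRing R) := (faithfulSMul_iff_algebraMap_injective _ _).2
    ((IsFractionRing.injective R (FractionRing R)).comp hg)
  have : FaithfulSMul A R := (faithfulSMul_iff_algebraMap_injective _ _).2 hg
  let _ : Algebra (FractionRing A) (FractionRing R) := FractionRing.liftAlgebra A (FractionRing R)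
  have : IsScalarTower K A R := IsScalarTower.of_algebraMap_eq fun x => (g.commutes x).symm
  have : Algebra.FiniteType A R := Algebra.FiniteType.of_restrictScalars_finiteType K A R
  have hAR : Algebra.IsIntegral A R := ⟨hintegral⟩
  have : Module.Finite A R := Algebra.IsIntegral.finite
  have : IsLocalization (Algebra.algebraMapSubmonoid R (nonZeroDivisors A)) (FractionRing R) :=
    inferInstance
  have : Module.Finite (FractionRing A) (FractionRing R) :=
    Module.Finite.of_isLocalization A R (nonZeroDivisors A)
  have : Module.Finite A (integralClosure A (FractionRing R)) :=
    IsIntegralClosure.finite A (FractionRing A) (FractionRing R) _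
  obtain ⟨t, ht⟩ := Module.Finite.fg_top (R := A) (M := integralClosure A (FractionRing R))
  classical
  obtain ⟨b, hb⟩ := IsLocalization.exist_integer_multiples_of_finset (nonZeroDivisors R)
    (t.image Subtype.val)
  refine ⟨b, nonZeroDivisors.coe_ne_zero b, fun x hx => ?_⟩
  have hxA : IsIntegral A x := isIntegral_trans x hx
  have hmem : (⟨x, hxA⟩ : integralClosure A (FractionRing R)) ∈ Submodule.span A (t : Set _) := by
    rw [ht]; trivial
  have key : ∀ y ∈ Submodule.span A (t : Set (integralClosure A (FractionRing R))),
      ∃ r : R, algebraMap R (FractionRing R) b * y = algebraMap R (FractionRing R) r := by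
    intro y hy
    induction hy using Submodule.span_induction with
    | mem y hy =>
      obtain ⟨r, hr⟩ := hb y (Finset.mem_image_of_mem _ hy)
      exact ⟨r, by rw [hr, Algebra.smul_def]⟩
    | zero => exact ⟨0, by simp⟩
    | add y z _ _ hy hz =>
      obtain ⟨r, hr⟩ := hy
      obtain ⟨r', hr'⟩ := hz
      exact ⟨r + r', by rw [map_add, ← hr, ← hr', ← mul_add]; rfl⟩
    | smul a y _ hy =>
      obtain ⟨r, hr⟩ := hy
      refine ⟨algebraMap A R a * r, ?_⟩
      rw [map_mul, ← hr, ← IsScalarTower.algebraMap_apply]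
      change _ * (a • (y : FractionRing R)) = _
      rw [Algebra.smul_def]
      ring
  exact key _ hmem

end AlmostToric

namespace AlmostToric

/-- A stable subspace contains the eigencomponents of its elements. -/
theorem mem_of_sum_mem_of_eigen {K M ι : Type*} [Field K] [AddCommGroup M] [Module K M]
    (σ : Module.End K M) (N : Submodule K M) (hN : ∀ x ∈ N, σ x ∈ N) (s : Finset ι) (x : ι → M)
    (μ : ι → K) (hμ : Set.InjOn μ s) (hx : ∀ i ∈ s, σ (x i) = μ i • x i)
    (hsum : ∑ i ∈ s, x i ∈ N) : ∀ i ∈ s, x i ∈ N := by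
  classical
  intro i hi
  have hstable : ∀ (p : Polynomial K), ∀ y ∈ N, Polynomial.aeval σ p y ∈ N := by
    intro p
    induction p using Polynomial.induction_on' with
    | add p q hp hq =>
      intro y hy
      rw [map_add, LinearMap.add_apply]
      exact N.add_mem (hp y hy) (hq y hy)
    | monomial n c =>
      intro y hy
      rw [Polynomial.aeval_monomial, Module.End.mul_apply, Module.algebraMap_end_apply]
      refine N.smul_mem c ?_
      induction n with
      | zero => simpa using hy
      | succ n ih => rw [pow_succ', Module.End.mul_apply]; exact hN _ ih
  have heval : ∀ (p : Polynomial K), ∀ j ∈ s,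
      Polynomial.aeval σ p (x j) = p.eval (μ j) • x j := by
    intro p j hj
    induction p using Polynomial.induction_on' with
    | add p q hp hq => rw [map_add, LinearMap.add_apply, hp, hq, Polynomial.eval_add, add_smul]
    | monomial n c =>
      rw [Polynomial.aeval_monomial, Module.End.mul_apply, Module.algebraMap_end_apply,
        Polynomial.eval_monomial, mul_smul]
      congr 1
      induction n with
      | zero => simp
      | succ n ih => rw [pow_succ', Module.End.mul_apply, ih, map_smul, hx j hj, smul_smul, pow_succ]
  have h := hstable (Lagrange.basis s μ i) _ hsum
  rw [map_sum, Finset.sum_eq_single_of_mem i hi, heval _ i hi, Lagrange.eval_basis_self hμ hi,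
    one_smul] at h
  · exact h
  · intro j hj hne
    rw [heval _ j hj, Lagrange.eval_basis_of_ne hne.symm hj, zero_smul]

/-- The character of `ℤᵐ` with values `t i` on the standard basis. -/
def character {K : Type*} [Field K] {m : ℕ} (t : Fin m → Kˣ) (u : Fin m → ℤ) : Kˣ :=
  ∏ i, t i ^ u i

section Character

variable {K : Type*} [Field K] {m : ℕ} (t : Fin m → Kˣ)

theorem character_zero : character t 0 = 1 := by simp [character]

theorem character_add (u v : Fin m → ℤ) :
    character t (u + v) = character t u * character t v := by
  simp [character, zpow_add, Finset.prod_mul_distrib]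

theorem character_inv (u : Fin m → ℤ) : character t⁻¹ u = (character t u)⁻¹ := by
  simp [character]

/-- In characteristic zero there is an injective character of `ℤᵐ`. -/
theorem exists_character_injective (K : Type*) [Field K] [CharZero K] (m : ℕ) :
    ∃ t : Fin m → Kˣ, Function.Injective (character t) := by
  let p : Fin m → ℕ := fun i => Nat.nth Nat.Prime i
  have hp : ∀ i, (p i).Prime := fun i => Nat.prime_nth_prime i
  have hpinj : Function.Injective p := fun i j hij =>
    Fin.ext (Nat.nth_injective Nat.infinite_setOfPred_prime hij)
  have hp0 : ∀ i, ((p i : ℕ) : K) ≠ 0 := fun i => Nat.cast_ne_zero.2 (hp i).ne_zero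
  have hq0 : ∀ i, ((p i : ℕ) : ℚ) ≠ 0 := fun i => Nat.cast_ne_zero.2 (hp i).ne_zero
  refine ⟨fun i => Units.mk0 _ (hp0 i), fun u v huv => ?_⟩
  have h1 : ∏ i, ((p i : ℕ) : ℚ) ^ u i = ∏ i, ((p i : ℕ) : ℚ) ^ v i := by
    have := congrArg Units.val huv
    simp only [character, Units.coe_prod, Units.val_zpow_eq_zpow_val, Units.val_mk0] at this
    apply Rat.cast_injective (α := K)
    push_cast
    exact this
  funext j
  have hj : Fact (p j).Prime := ⟨hp j⟩
  have h2 : ∀ w : Fin m → ℤ, padicValRat (p j) (∏ i, ((p i : ℕ) : ℚ) ^ w i) = w j := by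
    intro w
    have h3 : ∀ s : Finset (Fin m), padicValRat (p j) (∏ i ∈ s, ((p i : ℕ) : ℚ) ^ w i) =
        ∑ i ∈ s, if i = j then w i else 0 := by
      intro s
      induction s using Finset.induction_on with
      | empty => simp
      | insert i s hi ih =>
        rw [Finset.prod_insert hi, Finset.sum_insert hi,
          padicValRat.mul (zpow_ne_zero _ (hq0 i))
            (Finset.prod_ne_zero_iff.2 fun k _ => zpow_ne_zero _ (hq0 k)), ih,
          padicValRat.zpow]
        congr 1
        rw [padicValRat.of_nat]
        split_ifs with h
        · rw [h, padicValNat_self]; simp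
        · have : padicValNat (p j) (p i) = 0 := by
            refine padicValNat.eq_zero_of_not_dvd fun hdvd => h (hpinj ?_)
            exact ((Nat.prime_dvd_prime_iff_eq (hp j) (hp i)).1 hdvd).symm
          rw [this]; simp
    rw [h3]
    simp
  rw [← h2 u, ← h2 v, h1]

end Character

section GradedFractions

variable {K R : Type*} [Field K] [CommRing R] [IsDomain R] [Algebra K R] {m : ℕ}
variable (𝒜 : (Fin m → ℤ) → Submodule K R) [GradedAlgebra 𝒜]

/-- The homogeneous fractions of degree `u`. -/
def homFrac (u : Fin m → ℤ) : Submodule K (FractionRing R) where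
  carrier := {x | ∃ w, ∃ a ∈ 𝒜 (u + w), ∃ b ∈ 𝒜 w, b ≠ 0 ∧
    x * algebraMap R (FractionRing R) b = algebraMap R (FractionRing R) a}
  zero_mem' := ⟨0, 0, Submodule.zero_mem _, 1, SetLike.GradedOne.one_mem, one_ne_zero, by simp⟩
  add_mem' := by
    rintro x y ⟨w, a, ha, b, hb, hb0, hab⟩ ⟨w', a', ha', b', hb', hb0', hab'⟩
    refine ⟨w + w', a * b' + a' * b, Submodule.add_mem _ ?_ ?_, b * b',
      SetLike.GradedMul.mul_mem hb hb', mul_ne_zero hb0 hb0', ?_⟩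
    · rw [← add_assoc]; exact SetLike.GradedMul.mul_mem ha hb'
    · rw [add_comm w, ← add_assoc]; exact SetLike.GradedMul.mul_mem ha' hb
    · rw [map_add, map_mul, map_mul, map_mul, ← hab, ← hab']; ring
  smul_mem' := by
    rintro c x ⟨w, a, ha, b, hb, hb0, hab⟩
    refine ⟨w, c • a, Submodule.smul_mem _ _ ha, b, hb, hb0, ?_⟩
    rw [smul_mul_assoc, hab, Algebra.smul_def, Algebra.smul_def, map_mul,
      ← IsScalarTower.algebraMap_apply]

variable {𝒜}

theorem homFrac_mul {u v : Fin m → ℤ} {x y : FractionRing R} (hx : x ∈ homFrac 𝒜 u)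
    (hy : y ∈ homFrac 𝒜 v) : x * y ∈ homFrac 𝒜 (u + v) := by
  obtain ⟨w, a, ha, b, hb, hb0, hab⟩ := hx
  obtain ⟨w', a', ha', b', hb', hb0', hab'⟩ := hy
  refine ⟨w + w', a * a', ?_, b * b', SetLike.GradedMul.mul_mem hb hb', mul_ne_zero hb0 hb0', ?_⟩
  · rw [add_add_add_comm]; exact SetLike.GradedMul.mul_mem ha ha'
  · rw [map_mul, map_mul, ← hab, ← hab']; ring

theorem homFrac_inv {u : Fin m → ℤ} {x : FractionRing R} (hx : x ∈ homFrac 𝒜 u) :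
    x⁻¹ ∈ homFrac 𝒜 (-u) := by
  by_cases hx0 : x = 0
  · rw [hx0, inv_zero]; exact Submodule.zero_mem _
  obtain ⟨w, a, ha, b, hb, hb0, hab⟩ := hx
  refine ⟨u + w, b, by rwa [neg_add_cancel_left], a, ha, ?_, ?_⟩
  · rintro rfl
    rw [map_zero, mul_eq_zero] at hab
    exact hab.elim hx0 ((map_ne_zero_iff _ (IsFractionRing.injective R _)).2 hb0)
  · rw [← hab, inv_mul_cancel_left₀ hx0]

theorem algebraMap_mem_homFrac {u : Fin m → ℤ} {a : R} (ha : a ∈ 𝒜 u) :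
    algebraMap R (FractionRing R) a ∈ homFrac 𝒜 u :=
  ⟨0, a, by rwa [add_zero], 1, SetLike.GradedOne.one_mem, one_ne_zero, by simp⟩

theorem algebraMap_field_mem_homFrac (c : K) :
    algebraMap K (FractionRing R) c ∈ homFrac 𝒜 0 := by
  rw [IsScalarTower.algebraMap_apply K R]
  exact algebraMap_mem_homFrac (SetLike.algebraMap_mem_graded 𝒜 c)

theorem one_mem_homFrac : (1 : FractionRing R) ∈ homFrac 𝒜 0 := by
  simpa using algebraMap_field_mem_homFrac (𝒜 := 𝒜) 1

theorem homFrac_div {u v : Fin m → ℤ} {x y : FractionRing R} (hx : x ∈ homFrac 𝒜 u)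
    (hy : y ∈ homFrac 𝒜 v) : x / y ∈ homFrac 𝒜 (u - v) := by
  rw [div_eq_mul_inv, sub_eq_add_neg]
  exact homFrac_mul hx (homFrac_inv hy)

theorem homFrac_pow {u : Fin m → ℤ} {x : FractionRing R} (hx : x ∈ homFrac 𝒜 u) (n : ℕ) :
    x ^ n ∈ homFrac 𝒜 (n • u) := by
  induction n with
  | zero => rw [pow_zero, zero_smul]; exact one_mem_homFrac
  | succ n ih => rw [pow_succ, succ_nsmul]; exact homFrac_mul ih hx

theorem homFrac_zpow {u : Fin m → ℤ} {x : FractionRing R} (hx : x ∈ homFrac 𝒜 u) (n : ℤ) :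
    x ^ n ∈ homFrac 𝒜 (n • u) := by
  cases n with
  | ofNat n => simpa using homFrac_pow hx n
  | negSucc n =>
    rw [zpow_negSucc, negSucc_zsmul]
    exact homFrac_inv (homFrac_pow hx _)

theorem homFrac_prod {ι : Type*} (s : Finset ι) (u : ι → Fin m → ℤ) (x : ι → FractionRing R)
    (hx : ∀ i ∈ s, x i ∈ homFrac 𝒜 (u i)) : ∏ i ∈ s, x i ∈ homFrac 𝒜 (∑ i ∈ s, u i) := by
  classical
  induction s using Finset.induction_on with
  | empty => simpa using one_mem_homFrac
  | insert i s hi ih =>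
    rw [Finset.prod_insert hi, Finset.sum_insert hi]
    exact homFrac_mul (hx i (Finset.mem_insert_self _ _))
      (ih fun j hj => hx j (Finset.mem_insert_of_mem hj))

theorem mem_of_algebraMap_mem_homFrac {u : Fin m → ℤ} {r : R}
    (hr : algebraMap R (FractionRing R) r ∈ homFrac 𝒜 u) : r ∈ 𝒜 u := by
  classical
  obtain ⟨w, a, ha, b, hb, hb0, hab⟩ := hr
  rw [← map_mul] at hab
  replace hab := IsFractionRing.injective R (FractionRing R) hab
  rw [← DirectSum.sum_support_decompose 𝒜 r]
  refine Submodule.sum_mem _ fun v hv => ?_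
  by_cases hvu : v = u
  · rw [hvu]; exact SetLike.coe_mem _
  · have h1 := DirectSum.coe_decompose_mul_add_of_right_mem 𝒜 (i := v) (a := r) hb
    rw [hab, DirectSum.decompose_of_mem_ne 𝒜 ha (fun h => hvu (add_right_cancel h).symm)] at h1
    rw [(mul_eq_zero.1 h1.symm).resolve_right hb0]
    exact Submodule.zero_mem _

variable (𝒜)

/-- The action of a character on a graded algebra. -/
noncomputable def torusHom (t : Fin m → Kˣ) : R →ₐ[K] R :=
  (DirectSum.toAlgebra K (fun u => 𝒜 u) (fun u => (character t u : K) • (𝒜 u).subtype)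
    (by simp [character_zero])
    (fun {i j} a b => by
      simp only [character_add, Units.val_mul, SetLike.coe_gMul, LinearMap.smul_apply,
        Submodule.subtype_apply, smul_mul_smul_comm])).comp
    (DirectSum.decomposeAlgEquiv 𝒜).toAlgHom

theorem torusHom_apply (t : Fin m → Kˣ) {u : Fin m → ℤ} {a : R} (ha : a ∈ 𝒜 u) :
    torusHom 𝒜 t a = (character t u : K) • a := by
  lift a to 𝒜 u using ha
  have h : DirectSum.decomposeAlgEquiv 𝒜 (a : R) = DirectSum.of (fun u => 𝒜 u) u a :=
    DirectSum.decompose_coe 𝒜 a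
  exact (congrArg _ h).trans (DirectSum.toAddMonoid_of _ _ _)

theorem torusHom_inv_torusHom (t : Fin m → Kˣ) (r : R) :
    torusHom 𝒜 t⁻¹ (torusHom 𝒜 t r) = r := by
  induction r using DirectSum.Decomposition.inductionOn 𝒜 with
  | zero => simp
  | @homogeneous u a =>
    rw [torusHom_apply 𝒜 t a.2, map_smul, torusHom_apply 𝒜 t⁻¹ a.2, smul_smul, character_inv]
    simp
  | add a b ha hb => rw [map_add, map_add, ha, hb]

theorem torusHom_injective (t : Fin m → Kˣ) : Function.Injective (torusHom 𝒜 t) :=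
  Function.LeftInverse.injective (torusHom_inv_torusHom 𝒜 t)

/-- The action of a character on the field of fractions of a graded algebra. -/
noncomputable def torusFrac (t : Fin m → Kˣ) : FractionRing R →ₐ[K] FractionRing R :=
  IsFractionRing.liftAlgHom (g := (IsScalarTower.toAlgHom K R (FractionRing R)).comp
    (torusHom 𝒜 t)) (by
      rw [AlgHom.coe_comp]
      exact (IsFractionRing.injective R (FractionRing R)).comp (torusHom_injective 𝒜 t))

theorem torusFrac_algebraMap (t : Fin m → Kˣ) (r : R) :
    torusFrac 𝒜 t (algebraMap R (FractionRing R) r) =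
      algebraMap R (FractionRing R) (torusHom 𝒜 t r) := by
  rw [torusFrac, IsFractionRing.liftAlgHom_apply]
  exact IsFractionRing.lift_algebraMap _ r

theorem torusFrac_apply (t : Fin m → Kˣ) {u : Fin m → ℤ} {x : FractionRing R}
    (hx : x ∈ homFrac 𝒜 u) : torusFrac 𝒜 t x = (character t u : K) • x := by
  obtain ⟨w, a, ha, b, hb, hb0, hab⟩ := hx
  have h := congrArg (torusFrac 𝒜 t) hab
  have hb' : algebraMap R (FractionRing R) b ≠ 0 :=
    (map_ne_zero_iff _ (IsFractionRing.injective R _)).2 hb0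
  have hsm : ∀ (c : K) (r : R), algebraMap R (FractionRing R) (c • r) =
      c • algebraMap R (FractionRing R) r :=
    fun c r => map_smul (IsScalarTower.toAlgHom K R (FractionRing R)) c r
  rw [map_mul, torusFrac_algebraMap, torusFrac_algebraMap, torusHom_apply 𝒜 t ha,
    torusHom_apply 𝒜 t hb, hsm, hsm, ← hab, character_add, mul_smul_comm, Units.val_mul,
    mul_comm (character t u : K), mul_smul] at h
  have h' := smul_right_injective (FractionRing R) (character t w).ne_zero h
  rw [← smul_mul_assoc] at h'
  exact mul_right_cancel₀ hb' h'

variable {𝒜} in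
/-- A subspace stable under all characters contains the homogeneous components of its elements. -/
theorem mem_of_sum_mem_of_stable [CharZero K] (N : Submodule K (FractionRing R))
    (hN : ∀ t, ∀ x ∈ N, torusFrac 𝒜 t x ∈ N) {ι : Type*} (s : Finset ι) (d : ι → Fin m → ℤ)
    (hd : Set.InjOn d s) (x : ι → FractionRing R) (hx : ∀ i ∈ s, x i ∈ homFrac 𝒜 (d i))
    (hsum : ∑ i ∈ s, x i ∈ N) : ∀ i ∈ s, x i ∈ N := by
  obtain ⟨t, ht⟩ := exists_character_injective K m
  exact mem_of_sum_mem_of_eigen (torusFrac 𝒜 t).toLinearMap N (hN t) s x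
    (fun i => (character t (d i) : K)) (fun i hi j hj h => hd hi hj (ht (Units.ext h)))
    (fun i hi => torusFrac_apply 𝒜 t (hx i hi)) hsum

theorem isIntegral_torusFrac (t : Fin m → Kˣ) {x : FractionRing R} (hx : IsIntegral R x) :
    IsIntegral R (torusFrac 𝒜 t x) :=
  hx.map_of_comp_eq (torusHom 𝒜 t).toRingHom (torusFrac 𝒜 t).toRingHom
    (RingHom.ext fun r => (torusFrac_algebraMap 𝒜 t r).symm)

theorem torusFrac_torusFrac_inv (t : Fin m → Kˣ) (x : FractionRing R) :
    torusFrac 𝒜 t (torusFrac 𝒜 t⁻¹ x) = x := by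
  obtain ⟨a, b, hb, rfl⟩ := IsFractionRing.div_surjective (A := R) x
  have h : ∀ r, torusHom 𝒜 t (torusHom 𝒜 t⁻¹ r) = r := by
    simpa using torusHom_inv_torusHom 𝒜 t⁻¹
  simp [torusFrac_algebraMap, h]

/-- A graded affine domain has a nonzero homogeneous element in its conductor. -/
theorem exists_homogeneous_conductor [CharZero K] [Algebra.FiniteType K R] :
    ∃ w, ∃ c ∈ 𝒜 w, c ≠ 0 ∧ ∀ x : FractionRing R, IsIntegral R x →
      ∃ r : R, algebraMap R (FractionRing R) c * x = algebraMap R (FractionRing R) r := by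
  classical
  obtain ⟨c, hc0, hc⟩ := exists_conductor K R
  let N : Submodule K (FractionRing R) :=
    { carrier := {y | ∀ x : FractionRing R, IsIntegral R x →
        ∃ r : R, y * x = algebraMap R (FractionRing R) r}
      zero_mem' := fun x _ => ⟨0, by simp⟩
      add_mem' := fun {y z} hy hz x hx => by
        obtain ⟨r, hr⟩ := hy x hx
        obtain ⟨r', hr'⟩ := hz x hx
        exact ⟨r + r', by rw [add_mul, hr, hr', map_add]⟩
      smul_mem' := fun k y hy x hx => by
        obtain ⟨r, hr⟩ := hy x hx
        refine ⟨k • r, ?_⟩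
        rw [smul_mul_assoc, hr]
        exact (map_smul (IsScalarTower.toAlgHom K R (FractionRing R)) k r).symm }
  have hN : ∀ t, ∀ y ∈ N, torusFrac 𝒜 t y ∈ N := by
    intro t y hy x hx
    obtain ⟨r, hr⟩ := hy _ (isIntegral_torusFrac 𝒜 t⁻¹ hx)
    refine ⟨torusHom 𝒜 t r, ?_⟩
    rw [← torusFrac_algebraMap, ← hr, map_mul, torusFrac_torusFrac_inv]
  have hsum : ∑ u ∈ DFinsupp.support (DirectSum.decompose 𝒜 c),
      algebraMap R (FractionRing R) (DirectSum.decompose 𝒜 c u) ∈ N := by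
    rw [← map_sum, DirectSum.sum_support_decompose]
    exact hc
  have hall := mem_of_sum_mem_of_stable N hN _ id Function.injective_id.injOn _
    (fun u _ => algebraMap_mem_homFrac (SetLike.coe_mem _)) hsum
  obtain ⟨w, hw⟩ : ∃ w, DirectSum.decompose 𝒜 c w ≠ 0 := by
    by_contra! h
    exact hc0 ((DirectSum.decompose 𝒜).injective (by
      rw [DirectSum.decompose_zero]; ext u; simp [h u]))
  exact ⟨w, _, SetLike.coe_mem _, by simpa using hw, hall w (by simpa using hw)⟩

/-- The elements integral over a graded affine domain are sums of homogeneous integral fractions. -/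
theorem exists_homogeneous_decomposition_of_isIntegral [CharZero K] [Algebra.FiniteType K R]
    {x : FractionRing R} (hx : IsIntegral R x) :
    ∃ (s : Finset (Fin m → ℤ)) (y : (Fin m → ℤ) → FractionRing R),
      (∀ u ∈ s, y u ∈ homFrac 𝒜 u) ∧ (∀ u ∈ s, IsIntegral R (y u)) ∧ ∑ u ∈ s, y u = x := by
  classical
  obtain ⟨w, c, hcw, hc0, hc⟩ := exists_homogeneous_conductor 𝒜
  obtain ⟨r, hr⟩ := hc x hx
  have hc' : algebraMap R (FractionRing R) c ≠ 0 :=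
    (map_ne_zero_iff _ (IsFractionRing.injective R _)).2 hc0
  let y : (Fin m → ℤ) → FractionRing R := fun u =>
    algebraMap R (FractionRing R) (DirectSum.decompose 𝒜 r (u + w)) /
      algebraMap R (FractionRing R) c
  let s := (DFinsupp.support (DirectSum.decompose 𝒜 r)).image fun v => v - w
  have hy : ∀ u ∈ s, y u ∈ homFrac 𝒜 u := fun u _ => by
    have := homFrac_div (algebraMap_mem_homFrac (SetLike.coe_mem (DirectSum.decompose 𝒜 r (u + w))))
      (algebraMap_mem_homFrac hcw)
    rwa [add_sub_cancel_right] at this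
  have hsum : ∑ u ∈ s, y u = x := by
    rw [Finset.sum_image (fun a _ b _ h => sub_left_injective h)]
    have hyw : ∀ v, y (v - w) = algebraMap R (FractionRing R) (DirectSum.decompose 𝒜 r v) /
        algebraMap R (FractionRing R) c := fun v => by
      simp only [y]
      rw [sub_add_cancel]
    rw [Finset.sum_congr rfl fun v _ => hyw v, ← Finset.sum_div, ← map_sum,
      DirectSum.sum_support_decompose, ← hr,
      mul_div_cancel_left₀ _ hc']
  refine ⟨s, y, hy, ?_, hsum⟩
  let N : Submodule K (FractionRing R) :=
    (Subalgebra.restrictScalars K (integralClosure R (FractionRing R))).toSubmodule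
  exact mem_of_sum_mem_of_stable N (fun t z hz => isIntegral_torusFrac 𝒜 t hz) s id
    Function.injective_id.injOn y hy
    (by rw [hsum]; exact hx)

end GradedFractions

/-- If the degree zero part is the base field, all graded pieces are finite-dimensional. -/
theorem finiteDimensional_of_zero_eq {K R : Type*} [Field K] [CommRing R] [Algebra K R]
    {m : ℕ} (𝒜 : (Fin m → ℤ) → Submodule K R) [GradedAlgebra 𝒜] [IsNoetherianRing R]
    (h0 : 𝒜 0 = Submodule.span K {(1 : R)}) (u : Fin m → ℤ) : FiniteDimensional K (𝒜 u) := by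
  obtain ⟨t, htu, ht⟩ := (Submodule.fg_span_iff_fg_span_finset_subset (𝒜 u : Set R)).1
    (IsNoetherian.noetherian (Submodule.span R (𝒜 u : Set R)))
  suffices h : 𝒜 u ≤ Submodule.span K (t : Set R) by
    have := FiniteDimensional.span_finset K t
    exact Submodule.finiteDimensional_of_le h
  intro a ha
  have hmem : a ∈ Submodule.span R (t : Set R) := ht ▸ Submodule.subset_span ha
  obtain ⟨f, -, hf⟩ := Submodule.mem_span_finset.1 hmem
  have h1 : a = ∑ b ∈ t, (DirectSum.decompose 𝒜 (f b) 0 : R) * b := by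
    conv_lhs => rw [← DirectSum.decompose_of_mem_same 𝒜 ha, ← hf]
    rw [DirectSum.decompose_sum, DirectSum.sum_apply, AddSubmonoidClass.coe_finsetSum]
    refine Finset.sum_congr rfl fun b hb => ?_
    have := DirectSum.coe_decompose_mul_add_of_right_mem 𝒜 (i := 0) (a := f b) (htu hb)
    rwa [zero_add] at this
  rw [h1]
  refine Submodule.sum_mem _ fun b hb => ?_
  obtain ⟨k, hk⟩ := Submodule.mem_span_singleton.1
    (h0.le (SetLike.coe_mem (DirectSum.decompose 𝒜 (f b) 0)))
  rw [← hk, smul_mul_assoc, one_mul]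
  exact Submodule.smul_mem _ _ (Submodule.subset_span hb)

end AlmostToric

namespace AlmostToric

open scoped IntermediateField.algebraAdjoinAdjoin

/-- Specialising along a line: finitely many rational functions generate an algebra that maps to
the rational functions in one variable, keeping a given nonconstant element nonconstant. -/
theorem exists_algHom_ratFunc_of_finset {K σ : Type*} [Field K] [Infinite K]
    (T : Finset (FractionRing (MvPolynomial σ K))) (z : FractionRing (MvPolynomial σ K))
    (hzT : z ∈ T) (hz : ∀ c : K, z ≠ algebraMap K _ c) :
    ∃ Θ : Algebra.adjoin K (T : Set (FractionRing (MvPolynomial σ K))) →ₐ[K] RatFunc K,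
      ∀ c : K, Θ ⟨z, Algebra.subset_adjoin hzT⟩ ≠ algebraMap K _ c := by
  let P := MvPolynomial σ K
  let M := FractionRing P
  obtain ⟨⟨q, hq⟩, hqT⟩ := IsLocalization.exist_integer_multiples_of_finset (nonZeroDivisors P) T
  have hq0 : q ≠ 0 := nonZeroDivisors.ne_zero hq
  have hinj : Function.Injective (algebraMap P M) := IsFractionRing.injective P M
  obtain ⟨p, hp⟩ := hqT z hzT
  replace hp : algebraMap P M p = algebraMap P M q * z := by
    rw [hp]; exact Algebra.smul_def q z
  obtain ⟨α, hα⟩ : ∃ α : σ → K, MvPolynomial.eval α q ≠ 0 := by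
    by_contra! h
    exact hq0 (MvPolynomial.funext fun x => by simp [h x])
  let c := MvPolynomial.eval α p / MvPolynomial.eval α q
  obtain ⟨β, hβ⟩ : ∃ β : σ → K, MvPolynomial.eval β (p - MvPolynomial.C c * q) ≠ 0 := by
    by_contra! h
    have h0 : p - MvPolynomial.C c * q = 0 := MvPolynomial.funext fun x => by rw [h x, map_zero]
    refine hz c (mul_left_cancel₀ ((map_ne_zero_iff _ hinj).2 hq0) ?_)
    rw [← hp, sub_eq_zero.1 h0, map_mul, mul_comm, IsScalarTower.algebraMap_apply K P M]
    rfl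
  let lam : P →ₐ[K] Polynomial K := MvPolynomial.aeval fun i =>
    Polynomial.C (α i) + Polynomial.X * Polynomial.C (β i - α i)
  have heval : ∀ (t : K) (f : P), (lam f).eval t =
      MvPolynomial.eval (fun i => α i + t * (β i - α i)) f := by
    intro t f
    induction f using MvPolynomial.induction_on with
    | C a => rw [MvPolynomial.aeval_C]; simp
    | add f g hf hg => rw [map_add, Polynomial.eval_add, hf, hg, map_add]
    | mul_X f i hf => rw [map_mul, Polynomial.eval_mul, hf, map_mul, MvPolynomial.aeval_X]; simp
  have hlamq : lam q ≠ 0 := by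
    intro h
    have := heval 0 q
    rw [h] at this
    simp only [Polynomial.eval_zero, zero_mul, add_zero] at this
    exact hα this.symm
  let μ : P →ₐ[K] RatFunc K := (IsScalarTower.toAlgHom K (Polynomial K) (RatFunc K)).comp lam
  have hμ : ∀ f, μ f = algebraMap (Polynomial K) (RatFunc K) (lam f) := fun f => rfl
  have hinj' := IsFractionRing.injective (Polynomial K) (RatFunc K)
  have hμq : μ q ≠ 0 := (map_ne_zero_iff _ hinj').2 hlamq
  let A := Localization.Away q
  let i : A →ₐ[K] M := IsLocalization.liftAlgHom (M := Submonoid.powers q)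
    (f := IsScalarTower.toAlgHom K P M) (by
      rintro ⟨_, n, rfl⟩
      exact (((map_ne_zero_iff _ hinj).2 (pow_ne_zero n hq0)).isUnit))
  let j : A →ₐ[K] RatFunc K := IsLocalization.liftAlgHom (M := Submonoid.powers q) (f := μ) (by
      rintro ⟨_, n, rfl⟩
      simp only [map_pow]
      exact (pow_ne_zero n hμq).isUnit)
  have hi : ∀ f, i (algebraMap P A f) = algebraMap P M f := fun f =>
    IsLocalization.lift_eq _ f
  have hj : ∀ f, j (algebraMap P A f) = μ f := fun f => IsLocalization.lift_eq _ f
  have hii : Function.Injective i := by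
    refine (IsLocalization.lift_injective_iff _).2 fun x y => ?_
    rw [(IsLocalization.injective A (powers_le_nonZeroDivisors_of_noZeroDivisors hq0)).eq_iff]
    exact hinj.eq_iff.symm
  have hrange : Algebra.adjoin K (T : Set M) ≤ i.range := by
    refine Algebra.adjoin_le fun x hx => ?_
    obtain ⟨a, ha⟩ := hqT x hx
    replace ha : algebraMap P M a = algebraMap P M q * x := by
      rw [ha]; exact Algebra.smul_def q x
    refine ⟨IsLocalization.mk' A a ⟨q, Submonoid.mem_powers q⟩, ?_⟩
    refine mul_left_cancel₀ ((map_ne_zero_iff _ hinj).2 hq0) ?_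
    rw [← ha, ← hi q, ← hi a]
    change i _ * i _ = _
    rw [← map_mul, IsLocalization.mk'_spec'_mk]
  let e := AlgEquiv.ofInjective i hii
  let Θ : Algebra.adjoin K (T : Set M) →ₐ[K] RatFunc K :=
    (j.comp e.symm.toAlgHom).comp (Subalgebra.inclusion hrange)
  refine ⟨Θ, fun d hd => ?_⟩
  have hΘ : Θ ⟨z, Algebra.subset_adjoin hzT⟩ * μ q = μ p := by
    let z' : i.range := ⟨z, hrange (Algebra.subset_adjoin hzT)⟩
    have h1 : e.symm z' * algebraMap P A q = algebraMap P A p := by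
      apply hii
      rw [map_mul, hi, hi, hp, mul_comm]
      congr 1
      exact congrArg Subtype.val (e.apply_symm_apply z')
    rw [← hj q, ← hj p, ← h1, map_mul]
    rfl
  rw [hd, IsScalarTower.algebraMap_apply K (Polynomial K) (RatFunc K), hμ, hμ, ← map_mul] at hΘ
  replace hΘ := hinj' hΘ
  have h0 := heval 0 p
  have h1 := heval 1 p
  rw [← hΘ, Polynomial.eval_mul, heval] at h0 h1
  simp only [zero_mul, add_zero, Polynomial.algebraMap_eq, Polynomial.eval_C, one_mul,
    add_sub_cancel] at h0 h1
  have hc : c = d := by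
    simp only [c]; rw [← h0, mul_div_cancel_right₀ _ hα]
  apply hβ
  rw [map_sub, map_mul, ← h1, hc, MvPolynomial.eval_C, sub_self]

/-- A finitely generated subfield of transcendence degree one of a purely transcendental extension
of an algebraically closed field is a field of rational functions. -/
theorem nonempty_ratFunc_algEquiv_adjoin {K L σ : Type*} [Field K] [IsAlgClosed K] [Field L]
    [Algebra K L] (ψ : L →ₐ[K] FractionRing (MvPolynomial σ K)) (T : Finset L)
    (hT : Algebra.trdeg K (IntermediateField.adjoin K (T : Set L)) = 1) :
    Nonempty (RatFunc K ≃ₐ[K] IntermediateField.adjoin K (T : Set L)) := by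
  classical
  have hK : Infinite K := IsAlgClosed.instInfinite
  let M := FractionRing (MvPolynomial σ K)
  obtain ⟨z, hzT, hz⟩ : ∃ z ∈ T, ∀ c : K, z ≠ algebraMap K L c := by
    by_contra! h
    have : Algebra.IsAlgebraic K (IntermediateField.adjoin K (T : Set L)) :=
      IntermediateField.isAlgebraic_adjoin fun x hx => by
        obtain ⟨c, rfl⟩ := h x hx
        exact isIntegral_algebraMap
    rw [trdeg_eq_zero] at hT
    exact zero_ne_one hT
  let A := Algebra.adjoin K (T : Set L)
  let F := IntermediateField.adjoin K (T : Set L)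
  obtain ⟨Θ, hΘ⟩ := exists_algHom_ratFunc_of_finset (T.image ψ) (ψ z)
    (Finset.mem_image_of_mem ψ hzT) (fun c hc => hz c (ψ.injective (hc.trans (ψ.commutes c).symm)))
  have hA : ∀ x : A, ψ x ∈ Algebra.adjoin K ((T.image ψ : Finset M) : Set M) := by
    intro x
    rw [Finset.coe_image, ← AlgHom.map_adjoin]
    exact ⟨x, x.2, rfl⟩
  let Ψ : A →ₐ[K] RatFunc K := Θ.comp ((ψ.comp A.val).codRestrict _ hA)
  let zA : A := ⟨z, Algebra.subset_adjoin hzT⟩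
  have hΨz : ∀ c : K, Ψ zA ≠ algebraMap K _ c := hΘ
  have hΨt : Transcendental K (Ψ zA) := RatFunc.transcendental_of_ne_C _ fun ⟨c, hc⟩ =>
    hΨz c (by rw [hc, RatFunc.algebraMap_eq_C])
  have hzt : Transcendental K zA := fun h => hΨt (h.algHom Ψ)
  have htr : Algebra.trdeg K A ≤ 1 := hT ▸ trdeg_le_of_injective
    (Subalgebra.inclusion (IntermediateField.algebra_adjoin_le_adjoin K (T : Set L)))
    (Subalgebra.inclusion_injective _)
  have hbasis : IsTranscendenceBasis K fun _ : Unit => zA :=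
    AlgebraicIndependent.isTranscendenceBasis_of_lift_trdeg_le_of_finite
      (algebraicIndependent_unique_type_iff.2 hzt) (by simpa using htr)
  have halg := (isTranscendenceBasis_iff_algebraicIndependent_isAlgebraic.1 hbasis).2
  have hΨinj : Function.Injective Ψ := by
    rw [injective_iff_map_eq_zero]
    intro x hx
    by_contra hx0
    have hcomap := Ideal.comap_ne_bot_of_algebraic_mem (I := RingHom.ker Ψ) hx0 hx
      (halg.isAlgebraic x)
    obtain ⟨⟨s, hs⟩, hsmem, hs0⟩ := Submodule.exists_mem_ne_zero_of_ne_bot hcomap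
    rw [Set.range_const, Algebra.adjoin_singleton_eq_range_aeval] at hs
    obtain ⟨p, rfl⟩ := hs
    have h1 : Ψ (Polynomial.aeval zA p) = 0 := hsmem
    rw [← Polynomial.aeval_algHom_apply] at h1
    have hp : p = 0 := by
      by_contra hp
      exact hΨt ⟨p, hp, h1⟩
    apply hs0
    rw [Subtype.ext_iff]
    simp [hp]
  let Φ : F →ₐ[K] RatFunc K := IsFractionRing.liftAlgHom hΨinj
  have hne : Φ.fieldRange ≠ ⊥ := by
    intro h
    have h1 : Ψ zA ∈ Φ.fieldRange := ⟨algebraMap A F zA,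
      IsFractionRing.lift_algebraMap (g := Ψ.toRingHom) hΨinj zA⟩
    rw [h] at h1
    obtain ⟨c, hc⟩ := IntermediateField.mem_bot.1 h1
    exact hΨz c hc.symm
  exact ⟨(RatFunc.Luroth.algEquiv hne).trans (AlgEquiv.ofInjectiveField Φ).symm⟩

end AlmostToric

namespace AlmostToric

section Generators

variable {K R : Type*} [Field K] [CommRing R] [Algebra K R] {m : ℕ}
variable (𝒜 : (Fin m → ℤ) → Submodule K R) [GradedAlgebra 𝒜]

theorem prod_pow_mem_graded {k : ℕ} {g : Fin k → R} {d : Fin k → Fin m → ℤ}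
    (hg : ∀ i, g i ∈ 𝒜 (d i)) (n : Fin k → ℕ) : ∏ i, g i ^ n i ∈ 𝒜 (∑ i, n i • d i) := by
  have : ∀ s : Finset (Fin k), ∏ i ∈ s, g i ^ n i ∈ 𝒜 (∑ i ∈ s, n i • d i) := by
    intro s
    induction s using Finset.cons_induction with
    | empty => simpa using SetLike.GradedOne.one_mem
    | cons i s hi ih =>
      rw [Finset.prod_cons, Finset.sum_cons]
      exact SetLike.GradedMul.mul_mem (SetLike.pow_mem_graded _ (hg i)) ih
  exact this _

/-- A finitely generated graded algebra has finitely many homogeneous generators, whose monomials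
of a given degree span the corresponding graded piece. -/
theorem exists_homogeneous_generators (hfg : Algebra.FiniteType K R) :
    ∃ (k : ℕ) (g : Fin k → R) (d : Fin k → Fin m → ℤ), (∀ i, g i ∈ 𝒜 (d i)) ∧ (∀ i, g i ≠ 0) ∧
      ∀ u, 𝒜 u ≤ Submodule.span K {r | ∃ n : Fin k → ℕ, ∑ i, n i • d i = u ∧
        ∏ i, g i ^ n i = r} := by
  classical
  obtain ⟨S, hS⟩ := hfg.out
  let T : Finset R := S.biUnion fun s =>
    (DFinsupp.support (DirectSum.decompose 𝒜 s)).image fun u => (DirectSum.decompose 𝒜 s u : R)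
  have hT : Algebra.adjoin K (T : Set R) = ⊤ := by
    rw [← top_le_iff, ← hS]
    refine Algebra.adjoin_le fun s hs => ?_
    rw [SetLike.mem_coe, ← DirectSum.sum_support_decompose 𝒜 s]
    refine Subalgebra.sum_mem _ fun u hu => Algebra.subset_adjoin ?_
    exact Finset.mem_biUnion.2 ⟨s, hs, Finset.mem_image_of_mem _ hu⟩
  have hTd : ∀ t : T, ∃ u, (t : R) ∈ 𝒜 u ∧ (t : R) ≠ 0 := by
    rintro ⟨t, ht⟩
    obtain ⟨s, -, hts⟩ := Finset.mem_biUnion.1 ht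
    obtain ⟨u, hu, rfl⟩ := Finset.mem_image.1 hts
    exact ⟨u, SetLike.coe_mem _, by simpa using hu⟩
  choose d' hd' hne using hTd
  let g : Fin T.card → R := fun i => (T.equivFin.symm i : R)
  let d : Fin T.card → Fin m → ℤ := fun i => d' (T.equivFin.symm i)
  have hg : ∀ i, g i ∈ 𝒜 (d i) := fun i => hd' _
  have hrange : Set.range g = T := by
    ext x
    constructor
    · rintro ⟨i, rfl⟩; exact (T.equivFin.symm i).2
    · intro hx; exact ⟨T.equivFin ⟨x, hx⟩, by simp [g]⟩
  refine ⟨T.card, g, d, hg, fun i => hne _, fun u r hr => ?_⟩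
  have hr' : r ∈ Algebra.adjoin K (Set.range g) := by rw [hrange, hT]; trivial
  rw [Algebra.adjoin_range_eq_range_aeval] at hr'
  obtain ⟨p, rfl⟩ := hr'
  rw [← DirectSum.decompose_of_mem_same 𝒜 hr]
  clear hr
  induction p using MvPolynomial.induction_on' with
  | add p q hp hq =>
    rw [map_add, DirectSum.decompose_add, DirectSum.add_apply, Submodule.coe_add]
    exact Submodule.add_mem _ hp hq
  | monomial n c =>
    have hmon : MvPolynomial.aeval g (MvPolynomial.monomial n c) = c • ∏ i, g i ^ n i := by
      rw [MvPolynomial.aeval_monomial, Algebra.smul_def,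
        Finsupp.prod_fintype _ _ fun i => pow_zero (g i)]
    have hmem : c • ∏ i, g i ^ n i ∈ 𝒜 (∑ i, n i • d i) :=
      Submodule.smul_mem _ _ (prod_pow_mem_graded 𝒜 hg _)
    change ((DirectSum.decompose 𝒜 (MvPolynomial.aeval g _) u : 𝒜 u) : R) ∈ _
    rw [hmon]
    by_cases hu : ∑ i, n i • d i = u
    · subst hu
      rw [DirectSum.decompose_of_mem_same 𝒜 hmem]
      exact Submodule.smul_mem _ _ (Submodule.subset_span ⟨n, rfl, rfl⟩)
    · rw [DirectSum.decompose_of_mem_ne 𝒜 hmem hu]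
      exact Submodule.zero_mem _

end Generators

section Coordinates

variable {K R : Type*} [Field K] [CommRing R] [IsDomain R] [Algebra K R] {m : ℕ}
variable (𝒜 : (Fin m → ℤ) → Submodule K R) [GradedAlgebra 𝒜]

/-- Coordinates on a graded domain of complexity one: a multiplicative section of the degree on
homogeneous fractions and an identification of the fractions of degree zero with the field of
rational functions. -/
structure Coordinates where
  /-- The chosen homogeneous fraction of a given degree. -/
  χ : (Fin m → ℤ) → FractionRing R
  χ_mem : ∀ u, χ u ∈ homFrac 𝒜 u
  χ_ne_zero : ∀ u, χ u ≠ 0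
  χ_zero : χ 0 = 1
  χ_add : ∀ u v, χ (u + v) = χ u * χ v
  /-- The embedding of the field of rational functions. -/
  ι : RatFunc K →ₐ[K] FractionRing R
  mem_homFrac_zero_iff : ∀ x, x ∈ homFrac 𝒜 0 ↔ ∃ f, ι f = x

/-- If the weights generate `ℤᵐ`, then there are nonzero homogeneous fractions of all degrees,
chosen multiplicatively. -/
theorem exists_multiplicative_section
    (hw : AddSubgroup.closure {u : Fin m → ℤ | 𝒜 u ≠ ⊥} = ⊤) :
    ∃ χ : (Fin m → ℤ) → FractionRing R, (∀ u, χ u ∈ homFrac 𝒜 u) ∧ (∀ u, χ u ≠ 0) ∧ χ 0 = 1 ∧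
      ∀ u v, χ (u + v) = χ u * χ v := by
  have hinj : Function.Injective (algebraMap R (FractionRing R)) := IsFractionRing.injective R _
  have hex : ∀ u : Fin m → ℤ, ∃ x ∈ homFrac 𝒜 u, x ≠ 0 := by
    intro u
    have hu : u ∈ AddSubgroup.closure {u : Fin m → ℤ | 𝒜 u ≠ ⊥} := hw ▸ AddSubgroup.mem_top u
    induction hu using AddSubgroup.closure_induction with
    | mem u hu =>
      obtain ⟨a, ha, ha0⟩ := Submodule.exists_mem_ne_zero_of_ne_bot hu
      exact ⟨_, algebraMap_mem_homFrac ha, (map_ne_zero_iff _ hinj).2 ha0⟩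
    | zero => exact ⟨1, one_mem_homFrac, one_ne_zero⟩
    | add u v _ _ hu hv =>
      obtain ⟨x, hx, hx0⟩ := hu
      obtain ⟨y, hy, hy0⟩ := hv
      exact ⟨x * y, homFrac_mul hx hy, mul_ne_zero hx0 hy0⟩
    | neg u _ hu =>
      obtain ⟨x, hx, hx0⟩ := hu
      exact ⟨x⁻¹, homFrac_inv hx, inv_ne_zero hx0⟩
  choose x hx hx0 using fun i : Fin m => hex (Pi.single i 1)
  refine ⟨fun u => ∏ i, x i ^ u i, fun u => ?_, fun u => ?_, by simp, fun u v => ?_⟩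
  · have := homFrac_prod Finset.univ (fun i => u i • (Pi.single i 1 : Fin m → ℤ))
      (fun i => x i ^ u i) (fun i _ => homFrac_zpow (hx i) (u i))
    convert this
    funext j
    simp [Finset.sum_apply, Pi.single_apply]
  · exact Finset.prod_ne_zero_iff.2 fun i _ => zpow_ne_zero _ (hx0 i)
  · simp only [Pi.add_apply, ← Finset.prod_mul_distrib]
    exact Finset.prod_congr rfl fun i _ => zpow_add₀ (hx0 i) _ _

/-- The field of homogeneous fractions of degree zero. -/
def homFracZero : IntermediateField K (FractionRing R) where
  carrier := homFrac 𝒜 0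
  mul_mem' hx hy := by simpa using homFrac_mul hx hy
  one_mem' := one_mem_homFrac
  add_mem' hx hy := Submodule.add_mem _ hx hy
  zero_mem' := Submodule.zero_mem _
  algebraMap_mem' c := algebraMap_field_mem_homFrac c
  inv_mem' x hx := by simpa using homFrac_inv hx

theorem mem_homFracZero {x : FractionRing R} : x ∈ homFracZero 𝒜 ↔ x ∈ homFrac 𝒜 0 := Iff.rfl

/-- Homogeneous fractions whose degrees form the standard basis are a transcendence basis over the
homogeneous fractions of degree zero. -/
theorem isTranscendenceBasis_homFracZero [CharZero K] {x : Fin m → FractionRing R}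
    (hx : ∀ i, x i ∈ homFrac 𝒜 (Pi.single i 1)) (hx0 : ∀ i, x i ≠ 0) :
    IsTranscendenceBasis (homFracZero 𝒜) x := by
  have hdeg : ∀ u : Fin m → ℤ, ∏ i, x i ^ u i ∈ homFrac 𝒜 u := by
    intro u
    have := homFrac_prod Finset.univ (fun i => u i • (Pi.single i 1 : Fin m → ℤ))
      (fun i => x i ^ u i) (fun i _ => homFrac_zpow (hx i) (u i))
    convert this
    funext j
    simp [Finset.sum_apply, Pi.single_apply]
  have hprod : ∀ u : Fin m → ℤ, ∏ i, x i ^ u i ≠ 0 := fun u =>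
    Finset.prod_ne_zero_iff.2 fun i _ => zpow_ne_zero _ (hx0 i)
  rw [isTranscendenceBasis_iff_algebraicIndependent_isAlgebraic]
  constructor
  · rw [algebraicIndependent_iff]
    intro p hp
    rw [MvPolynomial.aeval_def, MvPolynomial.eval₂_eq'] at hp
    have h := mem_of_sum_mem_of_stable (𝒜 := 𝒜) (⊥ : Submodule K (FractionRing R))
      (fun t y hy => by rw [(Submodule.mem_bot K).1 hy, map_zero]; exact Submodule.zero_mem _)
      p.support (fun s i => (s i : ℤ)) (fun s _ s' _ h => Finsupp.ext fun i => by
        simpa using congrFun h i) _ (fun s _ => ?_) ((Submodule.mem_bot K).2 hp)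
    · refine MvPolynomial.ext _ _ fun s => ?_
      by_contra hs
      rw [MvPolynomial.coeff_zero] at hs
      have hs' := (Submodule.mem_bot K).1 (h s (MvPolynomial.mem_support_iff.2 hs))
      rcases mul_eq_zero.1 hs' with h1 | h1
      · exact hs (by simpa using h1)
      · exact hprod (fun i => (s i : ℤ)) (by simpa using h1)
    · have h1 := homFrac_mul (MvPolynomial.coeff s p).2 (hdeg fun i => (s i : ℤ))
      simpa using h1
  · let B := Algebra.adjoin (homFracZero 𝒜) (Set.range x)
    have hxB : ∀ i, IsAlgebraic B (x i) := fun i =>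
      isAlgebraic_algebraMap (⟨x i, Algebra.subset_adjoin ⟨i, rfl⟩⟩ : B)
    have hFB : ∀ y ∈ homFrac 𝒜 0, IsAlgebraic B y := fun y hy =>
      isAlgebraic_algebraMap (⟨y, Subalgebra.algebraMap_mem _ (⟨y, hy⟩ : homFracZero 𝒜)⟩ : B)
    let E := Subalgebra.algebraicClosure B (FractionRing R)
    have hzpow : ∀ i (n : ℤ), x i ^ n ∈ E := by
      intro i n
      cases n with
      | ofNat n => simpa using E.pow_mem (hxB i) n
      | negSucc n => rw [zpow_negSucc]; exact IsAlgebraic.inv (E.pow_mem (hxB i) (n + 1))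
    have hhom : ∀ u, ∀ y ∈ homFrac 𝒜 u, y ∈ E := by
      intro u y hy
      have h0 := homFrac_div hy (hdeg u)
      rw [sub_self] at h0
      rw [← div_mul_cancel₀ y (hprod u)]
      exact E.mul_mem (hFB _ h0) (E.prod_mem fun i _ => hzpow i (u i))
    have hR : ∀ r : R, algebraMap R (FractionRing R) r ∈ E := by
      classical
      intro r
      rw [← DirectSum.sum_support_decompose 𝒜 r, map_sum]
      exact E.sum_mem fun u _ => hhom u _ (algebraMap_mem_homFrac (SetLike.coe_mem _))
    refine ⟨fun y => ?_⟩
    obtain ⟨a, b, -, rfl⟩ := IsFractionRing.div_surjective (A := R) y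
    rw [div_eq_mul_inv]
    exact E.mul_mem (hR a) (IsAlgebraic.inv (hR b))

theorem homFracZero_eq_adjoin {k : ℕ} {g : Fin k → R} {d : Fin k → Fin m → ℤ}
    (hg : ∀ i, g i ∈ 𝒜 (d i))
    (hspan : ∀ u, 𝒜 u ≤ Submodule.span K {r | ∃ n : Fin k → ℕ, ∑ i, n i • d i = u ∧
      ∏ i, g i ^ n i = r})
    {χ : (Fin m → ℤ) → FractionRing R} (hχ : ∀ u, χ u ∈ homFrac 𝒜 u) (hχ0 : ∀ u, χ u ≠ 0)
    (hχz : χ 0 = 1) (hχadd : ∀ u v, χ (u + v) = χ u * χ v) :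
    homFracZero 𝒜 = IntermediateField.adjoin K
      (Set.range fun i => algebraMap R (FractionRing R) (g i) / χ (d i)) := by
  set E := IntermediateField.adjoin K
    (Set.range fun i => algebraMap R (FractionRing R) (g i) / χ (d i)) with hE
  have hχpow : ∀ (n : ℕ) u, χ (n • u) = χ u ^ n := by
    intro n u
    induction n with
    | zero => rw [zero_smul, pow_zero, hχz]
    | succ n ih => rw [succ_nsmul, hχadd, ih, pow_succ]
  have hχsum : ∀ n : Fin k → ℕ, χ (∑ i, n i • d i) = ∏ i, χ (d i) ^ n i := by
    intro n
    have : ∀ s : Finset (Fin k), χ (∑ i ∈ s, n i • d i) = ∏ i ∈ s, χ (d i) ^ n i := by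
      intro s
      induction s using Finset.cons_induction with
      | empty => simpa using hχz
      | cons i s hi ih => rw [Finset.prod_cons, Finset.sum_cons, hχadd, ih, hχpow]
    exact this _
  have hmem : ∀ u, ∀ a ∈ 𝒜 u, algebraMap R (FractionRing R) a / χ u ∈ E := by
    intro u a ha
    replace ha := hspan u ha
    induction ha using Submodule.span_induction with
    | mem a h =>
      obtain ⟨n, hn, rfl⟩ := h
      rw [← hn, hχsum, map_prod, ← Finset.prod_div_distrib]
      refine prod_mem fun i _ => ?_
      rw [map_pow, ← div_pow]
      exact pow_mem (IntermediateField.subset_adjoin K _ (Set.mem_range_self i)) _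
    | zero => simp
    | add a b _ _ ha hb => rw [map_add, add_div]; exact add_mem ha hb
    | smul c a _ ha =>
      rw [Algebra.smul_def, map_mul, mul_div_assoc, ← IsScalarTower.algebraMap_apply]
      exact mul_mem (E.algebraMap_mem c) ha
  apply le_antisymm
  · rintro x ⟨w, a, ha, b, hb, hb0, hab⟩
    have hb' : algebraMap R (FractionRing R) b ≠ 0 :=
      (map_ne_zero_iff _ (IsFractionRing.injective R _)).2 hb0
    rw [zero_add] at ha
    have : x = (algebraMap R (FractionRing R) a / χ w) / (algebraMap R (FractionRing R) b / χ w) := by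
      rw [div_div_div_cancel_right₀ (hχ0 w), ← hab, mul_div_cancel_right₀ _ hb']
    rw [this]
    exact div_mem (hmem w a ha) (hmem w b hb)
  · rw [hE, IntermediateField.adjoin_le_iff]
    rintro _ ⟨i, rfl⟩
    rw [SetLike.mem_coe, mem_homFracZero, ← sub_self (d i)]
    exact homFrac_div (algebraMap_mem_homFrac (hg i)) (hχ (d i))

universe v

/-- An affine graded domain with generating weights that is rational of complexity one admits
coordinates. -/
theorem nonempty_coordinates {K R : Type v} [Field K] [IsAlgClosed K] [CharZero K] [CommRing R]
    [IsDomain R] [Algebra K R] (𝒜 : (Fin m → ℤ) → Submodule K R) [GradedAlgebra 𝒜]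
    (hfg : Algebra.FiniteType K R)
    (hw : AddSubgroup.closure {u : Fin m → ℤ | 𝒜 u ≠ ⊥} = ⊤)
    (e : FractionRing R ≃ₐ[K] FractionRing (MvPolynomial (Fin (m + 1)) K)) :
    Nonempty (Coordinates 𝒜) := by
  classical
  obtain ⟨k, g, d, hg, -, hspan⟩ := exists_homogeneous_generators 𝒜 hfg
  obtain ⟨χ, hχ, hχ0, hχz, hχadd⟩ := exists_multiplicative_section 𝒜 hw
  have hF := homFracZero_eq_adjoin 𝒜 hg hspan hχ hχ0 hχz hχadd
  have hbasis := isTranscendenceBasis_homFracZero 𝒜 (x := fun i => χ (Pi.single i 1))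
    (fun i => hχ _) (fun i => hχ0 _)
  have htr : Algebra.trdeg (homFracZero 𝒜) (FractionRing R) = m := by
    rw [← Cardinal.lift_inj.{v, 0}, ← hbasis.lift_cardinalMk_eq_trdeg]
    simp
  have halg : Algebra.IsAlgebraic (MvPolynomial (Fin (m + 1)) K)
      (FractionRing (MvPolynomial (Fin (m + 1)) K)) := IsLocalization.isAlgebraic _ (nonZeroDivisors _)
  have htr' : Algebra.trdeg K (FractionRing R) = m + 1 := by
    rw [e.trdeg_eq, ← trdeg_add_eq K (MvPolynomial (Fin (m + 1)) K),
      MvPolynomial.trdeg_of_isDomain, trdeg_eq_zero]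
    simp
  have hone : Algebra.trdeg K (homFracZero 𝒜) = 1 := by
    have h := trdeg_add_eq K (homFracZero 𝒜) (A := FractionRing R)
    rw [htr, htr', add_comm] at h
    exact Cardinal.eq_of_add_eq_add_left h Cardinal.natCast_lt_aleph0
  let T : Finset (FractionRing R) := Finset.univ.image
    fun i => algebraMap R (FractionRing R) (g i) / χ (d i)
  have hT : homFracZero 𝒜 = IntermediateField.adjoin K (T : Set (FractionRing R)) := by
    rw [hF, Finset.coe_image, Finset.coe_univ, Set.image_univ]
  rw [hT] at hone
  obtain ⟨φ⟩ := nonempty_ratFunc_algEquiv_adjoin e.toAlgHom T hone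
  refine ⟨⟨χ, hχ, hχ0, hχz, hχadd, (IntermediateField.val _).comp φ.toAlgHom, fun x => ?_⟩⟩
  rw [← mem_homFracZero, hT]
  constructor
  · intro hx
    exact ⟨φ.symm ⟨x, hx⟩, by simp⟩
  · rintro ⟨f, rfl⟩
    exact (φ f).2

end Coordinates

end AlmostToric

namespace AlmostToric

/-- Every nonzero element of a span is dominated at a point by one of the spanning elements. -/
theorem exists_ord_le_of_mem_span {K : Type*} [Field K] (Q : Option K) {S : Set (RatFunc K)}
    {f : RatFunc K} (hf : f ∈ Submodule.span K S) (hf0 : f ≠ 0) :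
    ∃ g ∈ S, g ≠ 0 ∧ ord Q g ≤ ord Q f := by
  induction hf using Submodule.span_induction with
  | mem f h => exact ⟨f, h, hf0, le_rfl⟩
  | zero => exact absurd rfl hf0
  | add f g _ _ hf hg =>
    by_cases h1 : f = 0
    · subst h1; rw [zero_add] at hf0 ⊢; exact hg hf0
    by_cases h2 : g = 0
    · subst h2; rw [add_zero] at hf0 ⊢; exact hf hf0
    rcases min_le_iff.1 (min_ord_le_ord_add Q h1 h2 hf0) with h | h
    · obtain ⟨a, ha, ha0, hle⟩ := hf h1
      exact ⟨a, ha, ha0, hle.trans h⟩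
    · obtain ⟨a, ha, ha0, hle⟩ := hg h2
      exact ⟨a, ha, ha0, hle.trans h⟩
  | smul c f _ hf =>
    have hc : c ≠ 0 := by rintro rfl; simp at hf0
    have h0 : f ≠ 0 := by rintro rfl; simp at hf0
    obtain ⟨a, ha, ha0, hle⟩ := hf h0
    refine ⟨a, ha, ha0, hle.trans ?_⟩
    rw [Algebra.smul_def, ord_mul Q (by simpa using hc) h0, ord_algebraMap, zero_add]

namespace Coordinates

variable {K R : Type*} [Field K] [CommRing R] [IsDomain R] [Algebra K R] {m : ℕ}
variable {𝒜 : (Fin m → ℤ) → Submodule K R} [GradedAlgebra 𝒜] (C : Coordinates 𝒜)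

theorem mem_homFrac_iff {u : Fin m → ℤ} {x : FractionRing R} :
    x ∈ homFrac 𝒜 u ↔ ∃ f, C.ι f * C.χ u = x := by
  constructor
  · intro hx
    have h := homFrac_div hx (C.χ_mem u)
    rw [sub_self, C.mem_homFrac_zero_iff] at h
    obtain ⟨f, hf⟩ := h
    exact ⟨f, by rw [hf, div_mul_cancel₀ _ (C.χ_ne_zero u)]⟩
  · rintro ⟨f, rfl⟩
    have h := homFrac_mul ((C.mem_homFrac_zero_iff _).2 ⟨f, rfl⟩) (C.χ_mem u)
    rwa [zero_add] at h

/-- The rational functions representing the homogeneous elements of degree `u`. -/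
def sections (u : Fin m → ℤ) : Submodule K (RatFunc K) where
  carrier := {f | ∃ r : R, algebraMap R (FractionRing R) r = C.ι f * C.χ u}
  zero_mem' := ⟨0, by simp⟩
  add_mem' := by
    rintro f g ⟨r, hr⟩ ⟨s, hs⟩
    exact ⟨r + s, by rw [map_add, hr, hs, map_add, add_mul]⟩
  smul_mem' := by
    rintro c f ⟨r, hr⟩
    refine ⟨c • r, ?_⟩
    rw [map_smul C.ι, smul_mul_assoc, ← hr]
    exact map_smul (IsScalarTower.toAlgHom K R (FractionRing R)) c r

theorem mem_of_algebraMap_eq {u : Fin m → ℤ} {f : RatFunc K} {r : R}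
    (h : algebraMap R (FractionRing R) r = C.ι f * C.χ u) : r ∈ 𝒜 u :=
  mem_of_algebraMap_mem_homFrac (h ▸ C.mem_homFrac_iff.2 ⟨f, rfl⟩)

theorem ne_zero_of_algebraMap_eq {u : Fin m → ℤ} {f : RatFunc K} {r : R}
    (h : algebraMap R (FractionRing R) r = C.ι f * C.χ u) : f ≠ 0 ↔ r ≠ 0 := by
  rw [← map_ne_zero_iff _ (IsFractionRing.injective R (FractionRing R)), h, mul_ne_zero_iff,
    map_ne_zero C.ι, and_iff_left (C.χ_ne_zero u)]

theorem exists_of_mem {u : Fin m → ℤ} {r : R} (hr : r ∈ 𝒜 u) :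
    ∃ f ∈ C.sections u, algebraMap R (FractionRing R) r = C.ι f * C.χ u := by
  obtain ⟨f, hf⟩ := C.mem_homFrac_iff.1 (algebraMap_mem_homFrac hr)
  exact ⟨f, ⟨r, hf.symm⟩, hf.symm⟩

theorem mul_mem_sections {u v : Fin m → ℤ} {f g : RatFunc K} (hf : f ∈ C.sections u)
    (hg : g ∈ C.sections v) : f * g ∈ C.sections (u + v) := by
  obtain ⟨r, hr⟩ := hf
  obtain ⟨s, hs⟩ := hg
  refine ⟨r * s, ?_⟩
  rw [map_mul, hr, hs, map_mul, C.χ_add]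
  ring

theorem one_mem_sections : 1 ∈ C.sections 0 := ⟨1, by simp [C.χ_zero]⟩

theorem pow_mem_sections {u : Fin m → ℤ} {f : RatFunc K} (hf : f ∈ C.sections u) (n : ℕ) :
    f ^ n ∈ C.sections (n • u) := by
  induction n with
  | zero => rw [pow_zero, zero_smul]; exact C.one_mem_sections
  | succ n ih => rw [pow_succ, succ_nsmul]; exact C.mul_mem_sections ih hf

theorem prod_mem_sections {ι : Type*} (s : Finset ι) {u : ι → Fin m → ℤ} {f : ι → RatFunc K}
    (hf : ∀ i ∈ s, f i ∈ C.sections (u i)) : ∏ i ∈ s, f i ∈ C.sections (∑ i ∈ s, u i) := by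
  induction s using Finset.cons_induction with
  | empty => simpa using C.one_mem_sections
  | cons i s hi ih =>
    rw [Finset.prod_cons, Finset.sum_cons]
    exact C.mul_mem_sections (hf i (Finset.mem_cons_self _ _))
      (ih fun j hj => hf j (Finset.mem_cons_of_mem hj))

theorem χ_nsmul (n : ℕ) (u : Fin m → ℤ) : C.χ (n • u) = C.χ u ^ n := by
  induction n with
  | zero => rw [zero_smul, pow_zero, C.χ_zero]
  | succ n ih => rw [succ_nsmul, C.χ_add, ih, pow_succ]

theorem χ_sum {ι : Type*} (s : Finset ι) (u : ι → Fin m → ℤ) :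
    C.χ (∑ i ∈ s, u i) = ∏ i ∈ s, C.χ (u i) := by
  induction s using Finset.cons_induction with
  | empty => simpa using C.χ_zero
  | cons i s hi ih => rw [Finset.sum_cons, Finset.prod_cons, C.χ_add, ih]

theorem ι_mul_χ_injective (u : Fin m → ℤ) : Function.Injective fun f => C.ι f * C.χ u :=
  fun _ _ h => RingHom.injective C.ι.toRingHom (mul_right_cancel₀ (C.χ_ne_zero u) h)

theorem exists_section_generators (hfg : Algebra.FiniteType K R) :
    ∃ (k : ℕ) (g : Fin k → RatFunc K) (d : Fin k → Fin m → ℤ), (∀ i, g i ∈ C.sections (d i)) ∧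
      (∀ i, g i ≠ 0) ∧ ∀ u, ∀ f ∈ C.sections u, f ≠ 0 → ∀ Q, ∃ n : Fin k → ℕ,
        ∑ i, n i • d i = u ∧ ∑ i, (n i : ℤ) * ord Q (g i) ≤ ord Q f := by
  obtain ⟨k, r, d, hr, hr0, hspan⟩ := exists_homogeneous_generators 𝒜 hfg
  choose g hg hgr using fun i => C.exists_of_mem (hr i)
  have hg0 : ∀ i, g i ≠ 0 := fun i => (C.ne_zero_of_algebraMap_eq (hgr i)).2 (hr0 i)
  refine ⟨k, g, d, hg, hg0, fun u f hf hf0 Q => ?_⟩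
  have hmon : f ∈ Submodule.span K {h | ∃ n : Fin k → ℕ, ∑ i, n i • d i = u ∧
      ∏ i, g i ^ n i = h} := by
    obtain ⟨s, hs⟩ := hf
    obtain ⟨f', hf', h⟩ : ∃ f' ∈ Submodule.span K {h | ∃ n : Fin k → ℕ, ∑ i, n i • d i = u ∧
        ∏ i, g i ^ n i = h}, algebraMap R (FractionRing R) s = C.ι f' * C.χ u := by
      have hsu := hspan u (C.mem_of_algebraMap_eq hs)
      clear hs
      induction hsu using Submodule.span_induction with
      | mem s h =>
        obtain ⟨n, hn, rfl⟩ := h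
        refine ⟨_, Submodule.subset_span ⟨n, hn, rfl⟩, ?_⟩
        rw [← hn, C.χ_sum, map_prod, map_prod, ← Finset.prod_mul_distrib]
        refine Finset.prod_congr rfl fun i _ => ?_
        rw [map_pow, hgr i, mul_pow, C.χ_nsmul, map_pow]
      | zero => exact ⟨0, Submodule.zero_mem _, by simp⟩
      | add a b _ _ ha hb =>
        obtain ⟨f₁, h₁, e₁⟩ := ha
        obtain ⟨f₂, h₂, e₂⟩ := hb
        exact ⟨f₁ + f₂, Submodule.add_mem _ h₁ h₂, by rw [map_add, e₁, e₂, map_add, add_mul]⟩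
      | smul c a _ ha =>
        obtain ⟨f₁, h₁, e₁⟩ := ha
        refine ⟨c • f₁, Submodule.smul_mem _ c h₁, ?_⟩
        rw [map_smul C.ι, smul_mul_assoc, ← e₁]
        exact map_smul (IsScalarTower.toAlgHom K R (FractionRing R)) c a
    rwa [C.ι_mul_χ_injective u (hs.symm.trans h)]
  obtain ⟨_, ⟨n, hn, rfl⟩, -, hle⟩ := exists_ord_le_of_mem_span Q hmon hf0
  refine ⟨n, hn, ?_⟩
  rw [ord_prod _ _ _ fun i _ => pow_ne_zero _ (hg0 i)] at hle
  simpa only [ord_pow Q (hg0 _)] using hle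

/-- A homogeneous fraction that is locally dominated by homogeneous elements of the same degree is
integral. -/
theorem isIntegral_of_forall_exists_ord_le [IsAlgClosed K] {u : Fin m → ℤ} {f : RatFunc K}
    (hf : f ≠ 0) (h : ∀ Q, ∃ g ∈ C.sections u, g ≠ 0 ∧ ord Q g ≤ ord Q f) :
    IsIntegral R (C.ι f * C.χ u) := by
  let s : Set (FractionRing R) := Set.range (algebraMap R (FractionRing R))
  have hmem : C.ι f * C.χ u ∈ (integralClosure (Subring.closure s) (FractionRing R)).toSubring := by
    rw [← iInf_valuationSubring_superset, Subring.mem_iInf]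
    rintro ⟨O, hO⟩
    obtain ⟨P, hP⟩ := exists_point_of_valuationSubring (O.comap C.ι.toRingHom) (fun c => by
      rw [ValuationSubring.mem_comap]
      change C.ι _ ∈ O
      rw [C.ι.commutes, IsScalarTower.algebraMap_apply K R]
      exact hO ⟨_, rfl⟩)
    obtain ⟨g, ⟨r, hr⟩, hg0, hle⟩ := h P
    have h1 := hP (f / g) (div_ne_zero hf hg0) (by rw [ord_div P hf hg0]; omega)
    have h2 : algebraMap R (FractionRing R) r ∈ O := hO ⟨r, rfl⟩
    have h3 : C.ι f * C.χ u = C.ι (f / g) * algebraMap R (FractionRing R) r := by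
      rw [hr, ← mul_assoc, ← map_mul, div_mul_cancel₀ _ hg0]
    change C.ι f * C.χ u ∈ O
    rw [h3]
    exact O.mul_mem _ _ h1 h2
  have hcl : Subring.closure s = (algebraMap R (FractionRing R)).range :=
    (congrArg Subring.closure (RingHom.coe_range _).symm).trans (Subring.closure_eq _)
  rw [hcl] at hmem
  let _ : Algebra R (algebraMap R (FractionRing R)).range :=
    (algebraMap R (FractionRing R)).rangeRestrict.toAlgebra
  have : IsScalarTower R (algebraMap R (FractionRing R)).range (FractionRing R) :=
    IsScalarTower.of_algebraMap_eq fun _ => rfl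
  have : Algebra.IsIntegral R (algebraMap R (FractionRing R)).range :=
    ⟨RingHom.isIntegral_of_surjective _ (RingHom.rangeRestrict_surjective _)⟩
  exact isIntegral_trans _ hmem

end Coordinates

end AlmostToric

namespace AlmostToric.Coordinates

variable {K R : Type*} [Field K] [CommRing R] [IsDomain R] [Algebra K R] {m : ℕ}
variable {𝒜 : (Fin m → ℤ) → Submodule K R} [GradedAlgebra 𝒜] (C : Coordinates 𝒜)

/-- The monoid of pairs of an order of vanishing at `P` and a degree that are attained by
homogeneous elements. -/
def valueMonoid (P : Option K) : AddSubmonoid (ℤ × (Fin m → ℤ)) where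
  carrier := {x | ∃ f ∈ C.sections x.2, f ≠ 0 ∧ ord P f = x.1}
  zero_mem' := ⟨1, C.one_mem_sections, one_ne_zero, ord_one P⟩
  add_mem' := by
    rintro x y ⟨f, hf, hf0, hfx⟩ ⟨g, hg, hg0, hgy⟩
    exact ⟨f * g, C.mul_mem_sections hf hg, mul_ne_zero hf0 hg0, by
      rw [ord_mul P hf0 hg0, hfx, hgy, Prod.fst_add]⟩

theorem mem_valueMonoid {P : Option K} {x : ℤ × (Fin m → ℤ)} :
    x ∈ C.valueMonoid P ↔ ∃ f ∈ C.sections x.2, f ≠ 0 ∧ ord P f = x.1 := Iff.rfl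

/-- The linear map sending a vector of multiplicities to the corresponding combination. -/
def weightedSum {k : ℕ} {A : Type*} [AddCommGroup A] (d : Fin k → A) : (Fin k → ℕ) →+ A where
  toFun n := ∑ i, n i • d i
  map_zero' := by simp
  map_add' n n' := by simp [add_smul, Finset.sum_add_distrib]

theorem weightedSum_apply {k : ℕ} {A : Type*} [AddCommGroup A] (d : Fin k → A) (n : Fin k → ℕ) :
    weightedSum d n = ∑ i, n i • d i := rfl

theorem ord_prod_pow (Q : Option K) {k : ℕ} {g : Fin k → RatFunc K} (hg : ∀ i, g i ≠ 0)
    (n : Fin k → ℕ) : ord Q (∏ i, g i ^ n i) = weightedSum (fun i => ord Q (g i)) n := by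
  rw [ord_prod _ _ _ fun i _ => pow_ne_zero _ (hg i), weightedSum_apply]
  simp only [ord_pow Q (hg _), nsmul_eq_mul]

/-- If the homogeneous integral fractions of degree divisible by `l` are regular, then the value
monoid of every point is finitely generated. -/
theorem valueMonoid_fg [IsAlgClosed K] (hfg : Algebra.FiniteType K R) {l : ℕ} (hl : 1 ≤ l)
    (h : ∀ u f, IsIntegral R (C.ι f * C.χ (l • u)) → f ∈ C.sections (l • u)) (P : Option K) :
    (C.valueMonoid P).FG := by
  classical
  obtain ⟨k, g, d, hg, hg0, hdom⟩ := C.exists_section_generators hfg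
  choose B hB using fun i => exists_finset_ord_eq_zero (g i)
  obtain ⟨Q₀, hQ₀⟩ : ∃ Q₀ : Option K, Q₀ ≠ P := exists_ne P
  let T : Finset (Option K) := insert P (insert Q₀ (Finset.univ.biUnion B))
  have hPT : P ∈ T := Finset.mem_insert_self _ _
  have hQ₀T : Q₀ ∈ T := Finset.mem_insert_of_mem (Finset.mem_insert_self _ _)
  let val (Q : Option K) : (Fin k → ℕ) →+ ℤ := weightedSum fun i => ord Q (g i)
  have hval : ∀ Q ∉ T, ∀ n, val Q n = 0 := by
    intro Q hQ n
    change weightedSum _ n = 0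
    rw [weightedSum_apply]
    refine Finset.sum_eq_zero fun i _ => ?_
    rw [hB i Q fun hQi => hQ (Finset.mem_insert_of_mem (Finset.mem_insert_of_mem
      (Finset.mem_biUnion.2 ⟨i, Finset.mem_univ i, hQi⟩))), smul_zero]
  let proj (Q : T) : (T → Fin k → ℕ) × ℕ × ℕ →+ (Fin k → ℕ) :=
    (Pi.evalAddMonoidHom _ Q).comp (AddMonoidHom.fst _ _)
  let fstCoef : (T → Fin k → ℕ) × ℕ × ℕ →+ ℤ :=
    (Nat.castAddMonoidHom ℤ).comp ((AddMonoidHom.fst _ _).comp (AddMonoidHom.snd _ _))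
  let sndCoef : (T → Fin k → ℕ) × ℕ × ℕ →+ ℤ :=
    (Nat.castAddMonoidHom ℤ).comp ((AddMonoidHom.snd _ _).comp (AddMonoidHom.snd _ _))
  let φ₁ : (T → Fin k → ℕ) × ℕ × ℕ →+ (T → Fin m → ℤ) × ℤ :=
    (AddMonoidHom.pi fun Q => (weightedSum d).comp (proj Q)).prod
      (fstCoef + sndCoef + ∑ Q : T, (val Q).comp (proj Q))
  let φ₂ : (T → Fin k → ℕ) × ℕ × ℕ →+ (T → Fin m → ℤ) × ℤ :=
    (AddMonoidHom.pi fun _ => (weightedSum d).comp (proj ⟨P, hPT⟩)).prod 0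
  let ψ : (T → Fin k → ℕ) × ℕ × ℕ →+ ℤ × (Fin m → ℤ) :=
    (fstCoef + (val P).comp (proj ⟨P, hPT⟩)).prod ((weightedSum d).comp (proj ⟨P, hPT⟩))
  have hmem : ∀ x, x ∈ (φ₁.eqLocusM φ₂).map ψ ↔ ∃ (n : T → Fin k → ℕ) (c s : ℕ),
      (∀ Q, weightedSum d (n Q) = weightedSum d (n ⟨P, hPT⟩)) ∧
      ((c : ℤ) + s + ∑ Q : T, val Q (n Q) = 0) ∧
      ((c : ℤ) + val P (n ⟨P, hPT⟩), weightedSum d (n ⟨P, hPT⟩)) = x := by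
    intro x
    rw [AddSubmonoid.mem_map]
    constructor
    · rintro ⟨⟨n, c, s⟩, he, rfl⟩
      have he' : φ₁ (n, c, s) = φ₂ (n, c, s) := he
      rw [Prod.ext_iff] at he'
      refine ⟨n, c, s, fun Q => congrFun he'.1 Q, ?_, rfl⟩
      have h2 := he'.2
      simpa [φ₁, φ₂, fstCoef, sndCoef, proj, AddMonoidHom.finsetSum_apply] using h2
    · rintro ⟨n, c, s, h1, h2, rfl⟩
      refine ⟨(n, c, s), ?_, rfl⟩
      change φ₁ (n, c, s) = φ₂ (n, c, s)
      refine Prod.ext (funext h1) ?_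
      simpa [φ₁, φ₂, fstCoef, sndCoef, proj, AddMonoidHom.finsetSum_apply] using h2
  have hM : ((φ₁.eqLocusM φ₂).map ψ).FG := (AddSubmonoid.fg_eqLocusM φ₁ φ₂).map ψ
  refine fg_of_nsmul_mem hM ?_ hl ?_
  · rintro ⟨a, u⟩ ⟨f, hf, hf0, hfa⟩
    choose n hn hnle using hdom u f hf hf0
    have hle : ∀ Q, val Q (n Q) ≤ ord Q f := fun Q => by
      simpa [val, weightedSum_apply] using hnle Q
    obtain ⟨s₀, hs₀⟩ := exists_finset_ord_eq_zero f
    have hsum : ∑ Q ∈ T, ord Q f ≤ 0 := by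
      rw [← sum_ord_eq_zero f (T ∪ s₀) fun Q hQ => hs₀ Q fun h => hQ (Finset.mem_union_right _ h)]
      refine Finset.sum_le_sum_of_subset_of_nonneg Finset.subset_union_left fun Q _ hQ => ?_
      rw [← hval Q hQ (n Q)]
      exact hle Q
    have hsum' : ord P f - val P (n P) + ∑ Q ∈ T, val Q (n Q) ≤ 0 := by
      refine le_trans ?_ hsum
      rw [← Finset.add_sum_erase T _ hPT, ← Finset.add_sum_erase T (fun Q => ord Q f) hPT]
      have := Finset.sum_le_sum fun Q (_ : Q ∈ T.erase P) => hle Q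
      omega
    obtain ⟨c, hc⟩ := Int.eq_ofNat_of_zero_le (sub_nonneg.2 (hle P))
    obtain ⟨s, hs⟩ := Int.eq_ofNat_of_zero_le (neg_nonneg.2 hsum')
    refine (hmem _).2 ⟨fun Q => n Q, c, s, fun Q => ?_, ?_, ?_⟩
    · rw [weightedSum_apply, weightedSum_apply, hn, hn]
    · rw [Finset.sum_coe_sort T fun Q => val Q (n Q)]
      omega
    · refine Prod.ext ?_ (hn P)
      change (c : ℤ) + val P (n P) = a
      change ord P f = a at hfa
      omega
  · rintro x hx
    obtain ⟨n, c, s, hdeg, hsum, rfl⟩ := (hmem x).1 hx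
    let n' (Q : Option K) : Fin k → ℕ := if hQ : Q ∈ T then n ⟨Q, hQ⟩ else n ⟨P, hPT⟩
    have hn' : ∀ Q : T, n' Q = n Q := fun Q => dif_pos Q.2
    have hn'P : n' P = n ⟨P, hPT⟩ := hn' ⟨P, hPT⟩
    have hdeg' : ∀ Q, weightedSum d (n' Q) = weightedSum d (n ⟨P, hPT⟩) := by
      intro Q
      by_cases hQ : Q ∈ T
      · rw [hn' ⟨Q, hQ⟩, hdeg]
      · simp only [n', dif_neg hQ]
    have hsum' : (c : ℤ) + s + ∑ Q ∈ T, val Q (n' Q) = 0 := by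
      rw [← Finset.sum_coe_sort T fun Q => val Q (n' Q)]
      simpa only [hn'] using hsum
    obtain ⟨f, hf0, hf⟩ := exists_ord_eq T (fun Q => l * (val Q (n' Q) +
      ((if Q = P then (c : ℤ) else 0) + if Q = Q₀ then (s : ℤ) else 0))) (by
        rw [← Finset.mul_sum, Finset.sum_add_distrib, Finset.sum_add_distrib,
          Finset.sum_ite_eq' T P, Finset.sum_ite_eq' T Q₀, if_pos hPT, if_pos hQ₀T,
          show ∑ Q ∈ T, val Q (n' Q) + ((c : ℤ) + s) = 0 by omega, mul_zero])
    refine (C.mem_valueMonoid).2 ⟨f, h _ _ (C.isIntegral_of_forall_exists_ord_le hf0 fun Q => ?_),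
      hf0, ?_⟩
    · refine ⟨∏ i, g i ^ (l • n' Q) i, ?_, Finset.prod_ne_zero_iff.2 fun i _ =>
        pow_ne_zero _ (hg0 i), ?_⟩
      · have := C.prod_mem_sections Finset.univ fun i _ => C.pow_mem_sections (hg i) ((l • n' Q) i)
        rw [← weightedSum_apply, map_nsmul, hdeg'] at this
        exact this
      · rw [ord_prod_pow Q hg0, map_nsmul, hf Q, nsmul_eq_mul]
        change (l : ℤ) * val Q (n' Q) ≤ _
        split_ifs with hQ h1 h2 h2
        · exact mul_le_mul_of_nonneg_left (by omega) (by positivity)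
        · exact mul_le_mul_of_nonneg_left (by omega) (by positivity)
        · exact mul_le_mul_of_nonneg_left (by omega) (by positivity)
        · exact mul_le_mul_of_nonneg_left (by omega) (by positivity)
        · rw [hval Q hQ, mul_zero]
    · rw [hf P, if_pos hPT, if_pos rfl, if_neg (Ne.symm hQ₀), hn'P, add_zero]
      change _ = l • ((c : ℤ) + val P (n ⟨P, hPT⟩))
      rw [nsmul_eq_mul, add_comm]

end AlmostToric.Coordinates

namespace AlmostToric

section Extension

variable {R Γ : Type*} [CommRing R] [IsDomain R] [AddCommGroup Γ]

/-- A valuation-like function on a domain extends to the field of fractions. -/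
theorem exists_valuation_extension {le : Γ → Γ → Prop}
    (hle : ∀ a b c, le a b → le (c + a) (c + b)) {ν : R → Γ}
    (hmul : ∀ f g : R, f ≠ 0 → g ≠ 0 → ν (f * g) = ν f + ν g)
    (hadd : ∀ f g : R, f ≠ 0 → g ≠ 0 → f + g ≠ 0 →
      le (ν f) (ν (f + g)) ∨ le (ν g) (ν (f + g))) :
    ∃ v : FractionRing R → Γ, (∀ r, r ≠ 0 → v (algebraMap R (FractionRing R) r) = ν r) ∧
      (∀ x y, x ≠ 0 → y ≠ 0 → v (x * y) = v x + v y) ∧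
      ∀ x y, x ≠ 0 → y ≠ 0 → x + y ≠ 0 → le (v x) (v (x + y)) ∨ le (v y) (v (x + y)) := by
  have hinj := IsFractionRing.injective R (FractionRing R)
  have hfrac : ∀ x : FractionRing R, ∃ a b : R, b ≠ 0 ∧
      algebraMap R (FractionRing R) a / algebraMap R (FractionRing R) b = x := fun x => by
    obtain ⟨a, b, hb, h⟩ := IsFractionRing.div_surjective R x
    exact ⟨a, b, nonZeroDivisors.ne_zero hb, h⟩
  choose num den hden hfr using hfrac
  have hne : ∀ {r : R}, r ≠ 0 → algebraMap R (FractionRing R) r ≠ 0 := fun h =>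
    (map_ne_zero_iff _ hinj).2 h
  have key : ∀ a b : R, a ≠ 0 → b ≠ 0 → ∀ x, algebraMap R (FractionRing R) a /
      algebraMap R (FractionRing R) b = x → ν (num x) - ν (den x) = ν a - ν b := by
    intro a b ha hb x hx
    have hx0 : x ≠ 0 := hx ▸ div_ne_zero (hne ha) (hne hb)
    have hnum : num x ≠ 0 := fun h => hx0 (by rw [← hfr x, h, map_zero, zero_div])
    have h := hfr x
    rw [← hx, div_eq_div_iff (hne (hx ▸ hden _)) (hne hb), ← map_mul, ← map_mul] at h
    rw [hx] at h
    have h' := congrArg ν (hinj h)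
    rw [hmul _ _ hnum hb, hmul _ _ ha (hden x)] at h'
    rw [sub_eq_sub_iff_add_eq_add, h']
  have hrep : ∀ x : FractionRing R, x ≠ 0 → ∃ a b : R, a ≠ 0 ∧ b ≠ 0 ∧
      algebraMap R (FractionRing R) a / algebraMap R (FractionRing R) b = x := fun x hx =>
    ⟨num x, den x, fun h => hx (by rw [← hfr x, h, map_zero, zero_div]), hden x, hfr x⟩
  have hν1 : ν 1 = 0 := by
    have := hmul 1 1 one_ne_zero one_ne_zero
    rwa [mul_one, left_eq_add] at this
  refine ⟨fun x => ν (num x) - ν (den x), fun r hr => ?_, fun x y hx hy => ?_,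
    fun x y hx hy hxy => ?_⟩
  · change ν (num _) - ν (den _) = _
    rw [key r 1 hr one_ne_zero _ (by rw [map_one, div_one]), hν1, sub_zero]
  · obtain ⟨a, b, ha, hb, rfl⟩ := hrep x hx
    obtain ⟨c, d, hc, hd, rfl⟩ := hrep y hy
    change ν (num _) - ν (den _) = ν (num _) - ν (den _) + (ν (num _) - ν (den _))
    rw [key _ _ ha hb _ rfl, key _ _ hc hd _ rfl,
      key (a * c) (b * d) (mul_ne_zero ha hc) (mul_ne_zero hb hd) _ (by
        rw [map_mul, map_mul, mul_div_mul_comm]), hmul a c ha hc, hmul b d hb hd]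
    abel
  · obtain ⟨a, b, ha, hb, rfl⟩ := hrep x hx
    obtain ⟨c, d, hc, hd, rfl⟩ := hrep y hy
    have e : algebraMap R (FractionRing R) (a * d + c * b) / algebraMap R (FractionRing R) (b * d)
        = algebraMap R (FractionRing R) a / algebraMap R (FractionRing R) b +
          algebraMap R (FractionRing R) c / algebraMap R (FractionRing R) d := by
      rw [div_add_div _ _ (hne hb) (hne hd), ← map_mul, ← map_mul, ← map_mul, ← map_add,
        mul_comm b c]
    have hs : a * d + c * b ≠ 0 := fun h => hxy (by rw [← e, h, map_zero, zero_div])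
    change le (ν (num _) - ν (den _)) (ν (num _) - ν (den _)) ∨
      le (ν (num _) - ν (den _)) (ν (num _) - ν (den _))
    rw [key _ _ hs (mul_ne_zero hb hd) _ e,
      key (a * d) (b * d) (mul_ne_zero ha hd) (mul_ne_zero hb hd) _ (by
        rw [map_mul, map_mul, mul_div_mul_right _ _ (hne hd)]),
      key (c * b) (b * d) (mul_ne_zero hc hb) (mul_ne_zero hb hd) _ (by
        rw [map_mul, map_mul, mul_comm, mul_div_mul_left _ _ (hne hb)])]
    refine (hadd _ _ (mul_ne_zero ha hd) (mul_ne_zero hc hb) hs).imp (fun h => ?_) fun h => ?_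
    · simpa only [neg_add_eq_sub] using hle _ _ (-ν (b * d)) h
    · simpa only [neg_add_eq_sub] using hle _ _ (-ν (b * d)) h

end Extension

/-- A valuation on the rational function field over an algebraically closed field that is trivial
on constants is a multiple of the order of vanishing at a point. -/
theorem exists_point_of_valuation {K Γ : Type*} [Field K] [IsAlgClosed K] [AddCommGroup Γ]
    {le : Γ → Γ → Prop} [IsLinearOrder Γ le] (hle : ∀ a b c, le a b → le (c + a) (c + b))
    {v : RatFunc K → Γ} (hmul : ∀ x y, x ≠ 0 → y ≠ 0 → v (x * y) = v x + v y)
    (hadd : ∀ x y, x ≠ 0 → y ≠ 0 → x + y ≠ 0 → le (v x) (v (x + y)) ∨ le (v y) (v (x + y)))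
    (hconst : ∀ c : K, c ≠ 0 → v (algebraMap K (RatFunc K) c) = 0) :
    ∃ (P : Option K) (e : Γ), ∀ f, f ≠ 0 → v f = ord P f • e := by
  classical
  have hrefl : ∀ a, le a a := fun a => refl_of le a
  have h1 : v 1 = 0 := by simpa using hconst 1 one_ne_zero
  have hinv : ∀ x, x ≠ 0 → v x⁻¹ = - v x := fun x hx => by
    rw [← add_eq_zero_iff_eq_neg, ← hmul _ _ (inv_ne_zero hx) hx, inv_mul_cancel₀ hx, h1]
  have hneg : ∀ x, v (-x) = v x := fun x => by
    by_cases hx : x = 0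
    · rw [hx, neg_zero]
    · have := hconst (-1) (by simp)
      rw [neg_eq_neg_one_mul, hmul _ _ (by simp) hx]
      rw [map_neg, map_one] at this
      rw [this, zero_add]
  have hzero_add : ∀ a b, le 0 a → le 0 b → le 0 (a + b) := fun a b ha hb =>
    trans_of le ha (by simpa using hle 0 b a hb)
  let O : ValuationSubring (RatFunc K) :=
    { carrier := {x | x ≠ 0 → le 0 (v x)}
      mul_mem' := fun {x y} hx hy hxy => by
        rw [hmul x y (left_ne_zero_of_mul hxy) (right_ne_zero_of_mul hxy)]
        exact hzero_add _ _ (hx (left_ne_zero_of_mul hxy)) (hy (right_ne_zero_of_mul hxy))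
      one_mem' := fun _ => h1 ▸ hrefl 0
      zero_mem' := fun h => absurd rfl h
      add_mem' := fun {x y} hx hy hxy => by
        by_cases hx0 : x = 0
        · subst hx0; rw [zero_add] at hxy ⊢; exact hy hxy
        by_cases hy0 : y = 0
        · subst hy0; rw [add_zero] at hxy ⊢; exact hx hxy
        exact (hadd x y hx0 hy0 hxy).elim (fun h => trans_of le (hx hx0) h)
          fun h => trans_of le (hy hy0) h
      neg_mem' := fun {x} hx hx0 => by
        rw [hneg]
        exact hx (neg_ne_zero.1 hx0)
      mem_or_inv_mem' := fun x => by
        by_cases hx : x = 0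
        · exact Or.inl fun h => absurd hx h
        · refine (total_of le 0 (v x)).imp (fun h _ => h) fun h _ => ?_
          rw [hinv x hx]
          simpa using hle _ _ (-v x) h }
  obtain ⟨P, hP⟩ := exists_point_of_valuationSubring O fun c hc => by
    rw [hconst c ((map_ne_zero _).1 hc)]
    exact hrefl 0
  have hunit : ∀ f, f ≠ 0 → ord P f = 0 → v f = 0 := fun f hf h => by
    have hpos : le 0 (v f) := hP f hf h.ge hf
    have hneg : le 0 (v f⁻¹) := hP f⁻¹ (inv_ne_zero hf) (by rw [ord_inv P hf, h, neg_zero])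
      (inv_ne_zero hf)
    rw [hinv f hf] at hneg
    exact antisymm_of le (by simpa using hle _ _ (v f) hneg) hpos
  obtain ⟨Q, hQ⟩ : ∃ Q : Option K, Q ≠ P := exists_ne P
  obtain ⟨π, hπ0, hπ⟩ := exists_ord_eq {P, Q} (fun S => if S = P then 1 else -1) (by
    rw [Finset.sum_pair hQ.symm, if_pos rfl, if_neg hQ, add_neg_cancel])
  have hπP : ord P π = 1 := by rw [hπ]; simp
  let V : (RatFunc K)ˣ →* Multiplicative Γ :=
    { toFun := fun x => Multiplicative.ofAdd (v x)
      map_one' := by rw [Units.val_one, h1]; rfl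
      map_mul' := fun x y => by rw [Units.val_mul, hmul _ _ x.ne_zero y.ne_zero]; rfl }
  have hpow : ∀ n : ℤ, v (π ^ n) = n • v π := fun n => by
    have := congrArg Multiplicative.toAdd (map_zpow V (Units.mk0 π hπ0) n)
    simpa [V] using this
  refine ⟨P, v π, fun f hf => ?_⟩
  have hf' : f = f / π ^ ord P f * π ^ ord P f := (div_mul_cancel₀ _ (zpow_ne_zero _ hπ0)).symm
  have hq : f / π ^ ord P f ≠ 0 := div_ne_zero hf (zpow_ne_zero _ hπ0)
  rw [hf', hmul _ _ hq (zpow_ne_zero _ hπ0), hunit _ hq, zero_add, hpow, ← hf']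
  rw [ord_div P hf (zpow_ne_zero _ hπ0), ord_zpow P hπ0, hπP, mul_one, sub_self]

namespace Coordinates

variable {K R : Type*} [Field K] [CommRing R] [IsDomain R] [Algebra K R] {m : ℕ}
variable {𝒜 : (Fin m → ℤ) → Submodule K R} [GradedAlgebra 𝒜] (C : Coordinates 𝒜)

/-- The value semigroup of a homogeneous valuation is an image of the value monoid of a point. -/
theorem fg_of_forall_valueMonoid_fg [IsAlgClosed K] {Γ : Type*} [AddCommGroup Γ]
    (hFG : ∀ P, (C.valueMonoid P).FG) {le : Γ → Γ → Prop} [IsLinearOrder Γ le]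
    (hle : ∀ a b c, le a b → le (c + a) (c + b)) {ν : R → Γ}
    (hmul : ∀ f g : R, f ≠ 0 → g ≠ 0 → ν (f * g) = ν f + ν g)
    (hadd : ∀ f g : R, f ≠ 0 → g ≠ 0 → f + g ≠ 0 →
      le (ν f) (ν (f + g)) ∨ le (ν g) (ν (f + g)))
    (hconst : ∀ c : K, c ≠ 0 → ν (algebraMap K R c) = 0)
    (hhom : ∀ f : R, f ≠ 0 → ∃ u, ((DirectSum.decompose 𝒜 f u : 𝒜 u) : R) ≠ 0 ∧
      ν f = ν ((DirectSum.decompose 𝒜 f u : 𝒜 u) : R)) :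
    (AddSubmonoid.closure (ν '' {f : R | f ≠ 0})).FG := by
  obtain ⟨v, hvν, hvmul, hvadd⟩ := exists_valuation_extension hle hmul hadd
  have hι : ∀ {f}, f ≠ 0 → C.ι f ≠ 0 := fun h => (map_ne_zero C.ι).2 h
  obtain ⟨P, e, hP⟩ := exists_point_of_valuation (v := fun f => v (C.ι f)) hle
    (fun x y hx hy => by rw [map_mul, hvmul _ _ (hι hx) (hι hy)])
    (fun x y hx hy hxy => by
      rw [map_add]
      exact hvadd _ _ (hι hx) (hι hy) (by rw [← map_add]; exact hι hxy))
    (fun c hc => by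
      rw [C.ι.commutes, IsScalarTower.algebraMap_apply K R, hvν _ (by simpa using hc),
        hconst c hc])
  let w : (Fin m → ℤ) →+ Γ := AddMonoidHom.mk' (fun u => v (C.χ u)) fun a b => by
    rw [C.χ_add, hvmul _ _ (C.χ_ne_zero a) (C.χ_ne_zero b)]
  let Φ : ℤ × (Fin m → ℤ) →+ Γ := AddMonoidHom.coprod (zmultiplesHom Γ e) w
  have hΦ : ∀ (u : Fin m → ℤ) (f : RatFunc K) (r : R), r ≠ 0 →
      algebraMap R (FractionRing R) r = C.ι f * C.χ u → ν r = Φ (ord P f, u) := by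
    intro u f r hr h
    have hf := (C.ne_zero_of_algebraMap_eq h).2 hr
    rw [← hvν r hr, h, hvmul _ _ (hι hf) (C.χ_ne_zero u)]
    change v (C.ι f) + v (C.χ u) = ord P f • e + v (C.χ u)
    rw [← hP f hf]
  convert (hFG P).map Φ
  refine le_antisymm (AddSubmonoid.closure_le.2 ?_) ?_
  · rintro _ ⟨f, hf, rfl⟩
    obtain ⟨u, hu, hν⟩ := hhom f hf
    obtain ⟨g, hg, hgr⟩ := C.exists_of_mem (DirectSum.decompose 𝒜 f u).2
    exact ⟨(ord P g, u), ⟨g, hg, (C.ne_zero_of_algebraMap_eq hgr).2 hu, rfl⟩, by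
      rw [hν, hΦ u g _ hu hgr]⟩
  · rintro _ ⟨⟨a, u⟩, ⟨f, ⟨r, hr⟩, hf0, hfa⟩, rfl⟩
    have hr0 := (C.ne_zero_of_algebraMap_eq hr).1 hf0
    refine AddSubmonoid.subset_closure ⟨r, hr0, ?_⟩
    rw [hΦ u f r hr0 hr, hfa]

end Coordinates

end AlmostToric

namespace AlmostToric

variable {K R : Type*} [Field K] [CommRing R] [Algebra K R] {m : ℕ}

/-- An integral fraction that can be written with numerator and denominator in an integrally
closed subalgebra `A`, over which the ring is integral, lies in `A`. -/
theorem exists_mem_of_isIntegrallyClosed [IsDomain R] (A : Subalgebra K R) [IsIntegrallyClosed A]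
    [Algebra.IsIntegral A R] {x : FractionRing R} (hx : IsIntegral R x) {p q : R} (hp : p ∈ A)
    (hq : q ∈ A) (hq0 : q ≠ 0)
    (hpq : x * algebraMap R (FractionRing R) q = algebraMap R (FractionRing R) p) :
    ∃ r ∈ A, algebraMap R (FractionRing R) r = x := by
  have hinj : Function.Injective (algebraMap A (FractionRing R)) := by
    rw [IsScalarTower.algebraMap_eq A R (FractionRing R)]
    exact (IsFractionRing.injective R (FractionRing R)).comp Subtype.val_injective
  let φ : FractionRing A →ₐ[A] FractionRing R :=
    IsFractionRing.liftAlgHom (g := Algebra.ofId A _) hinj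
  have hq' : (⟨q, hq⟩ : A) ≠ 0 := fun h => hq0 (congrArg Subtype.val h)
  let y : FractionRing A :=
    algebraMap A (FractionRing A) ⟨p, hp⟩ / algebraMap A (FractionRing A) ⟨q, hq⟩
  have hy : φ y = x := by
    have hq'' : algebraMap R (FractionRing R) q ≠ 0 :=
      (map_ne_zero_iff _ (IsFractionRing.injective R (FractionRing R))).2 hq0
    rw [map_div₀, φ.commutes, φ.commutes]
    exact (div_eq_iff hq'').2 hpq.symm
  have hyi : IsIntegral A y := by
    rw [← isIntegral_algHom_iff φ (RingHom.injective φ.toRingHom), hy]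
    exact isIntegral_trans x hx
  obtain ⟨r, hr⟩ := IsIntegrallyClosed.algebraMap_eq_of_integral hyi
  refine ⟨r, r.2, ?_⟩
  rw [← hy, ← hr, φ.commutes]
  rfl

variable (𝒜 : (Fin m → ℤ) → Submodule K R)

/-- The Veronese subalgebra generated by the pieces whose degree is divisible by `l`. -/
def veronese (l : ℕ) : Subalgebra K R :=
  Algebra.adjoin K (⋃ u : Fin m → ℤ, (𝒜 (fun i => (l : ℤ) * u i) : Set R))

variable {𝒜}

theorem mem_veronese_of_mem {l : ℕ} {u : Fin m → ℤ} {r : R} (hr : r ∈ 𝒜 (l • u)) :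
    r ∈ veronese 𝒜 l := by
  have h : (fun i => (l : ℤ) * u i) = l • u := funext fun i => by simp
  exact Algebra.subset_adjoin (Set.mem_iUnion.2 ⟨u, by rw [h]; exact hr⟩)

variable [GradedAlgebra 𝒜]

theorem isIntegral_veronese {l : ℕ} (hl : 1 ≤ l) : Algebra.IsIntegral (veronese 𝒜 l) R := by
  classical
  refine ⟨fun r => ?_⟩
  rw [← DirectSum.sum_support_decompose 𝒜 r]
  refine IsIntegral.sum _ fun u _ => ?_
  refine IsIntegral.of_pow hl ?_
  exact isIntegral_algebraMap (x := (⟨_, mem_veronese_of_mem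
    (SetLike.pow_mem_graded l (DirectSum.decompose 𝒜 r u).2)⟩ : veronese 𝒜 l))

theorem exists_mem_of_isIntegrallyClosed_veronese [IsDomain R] {l : ℕ} (hl : 1 ≤ l)
    [IsIntegrallyClosed (veronese 𝒜 l)] {u : Fin m → ℤ} {x : FractionRing R}
    (hx : x ∈ homFrac 𝒜 (l • u)) (hxi : IsIntegral R x) :
    ∃ r : R, algebraMap R (FractionRing R) r = x := by
  have := isIntegral_veronese (𝒜 := 𝒜) hl
  obtain ⟨w, a, ha, b, hb, hb0, hab⟩ := hx
  have hmem : a * b ^ (l - 1) ∈ 𝒜 (l • (u + w)) := by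
    have h := SetLike.mul_mem_graded ha (SetLike.pow_mem_graded (l - 1) hb)
    rwa [add_assoc, ← succ_nsmul', Nat.sub_add_cancel hl, ← smul_add] at h
  obtain ⟨r, -, hr⟩ := exists_mem_of_isIntegrallyClosed (veronese 𝒜 l) hxi
    (mem_veronese_of_mem hmem) (mem_veronese_of_mem (SetLike.pow_mem_graded l hb))
    (pow_ne_zero _ hb0) (by
      rw [map_mul, ← hab, map_pow, map_pow, mul_assoc, ← pow_succ', Nat.sub_add_cancel hl])
  exact ⟨r, hr⟩

end AlmostToric

namespace AlmostToric.Coordinates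

variable {K R : Type*} [Field K] [CommRing R] [IsDomain R] [Algebra K R] {m : ℕ}
variable {𝒜 : (Fin m → ℤ) → Submodule K R} [GradedAlgebra 𝒜] (C : Coordinates 𝒜)

/-- The homogeneous component of `f` of degree `u` is nonzero, is represented by `g`, and has the
lexicographically smallest degree. -/
structure IsLeading (f : R) (u : Fin m → ℤ) (g : RatFunc K) : Prop where
  ne_zero : g ≠ 0
  algebraMap_eq : algebraMap R (FractionRing R) (DirectSum.decompose 𝒜 f u : R) = C.ι g * C.χ u
  le : ∀ w, (DirectSum.decompose 𝒜 f w : R) ≠ 0 → toLex u ≤ toLex w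

variable {C}

theorem IsLeading.component_ne_zero {f : R} {u : Fin m → ℤ} {g : RatFunc K}
    (h : C.IsLeading f u g) : (DirectSum.decompose 𝒜 f u : R) ≠ 0 :=
  (C.ne_zero_of_algebraMap_eq h.algebraMap_eq).1 h.ne_zero

theorem IsLeading.unique {f : R} {u v : Fin m → ℤ} {g h : RatFunc K}
    (hu : C.IsLeading f u g) (hv : C.IsLeading f v h) : u = v ∧ g = h := by
  obtain rfl : u = v := toLex.injective
    (le_antisymm (hu.le v hv.component_ne_zero) (hv.le u hu.component_ne_zero))
  exact ⟨rfl, C.ι_mul_χ_injective u (hu.algebraMap_eq.symm.trans hv.algebraMap_eq)⟩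

theorem isLeading_of_mem {u : Fin m → ℤ} {r : R} {g : RatFunc K} (hg : g ≠ 0)
    (h : algebraMap R (FractionRing R) r = C.ι g * C.χ u) : C.IsLeading r u g := by
  have hr := C.mem_of_algebraMap_eq h
  refine ⟨hg, by rw [DirectSum.decompose_of_mem_same 𝒜 hr, h], fun w hw => ?_⟩
  by_cases hwu : u = w
  · rw [hwu]
  · exact absurd (DirectSum.decompose_of_mem_ne 𝒜 hr hwu) hw

theorem IsLeading.mul {f f' : R} {u u' : Fin m → ℤ} {g g' : RatFunc K}
    (h : C.IsLeading f u g) (h' : C.IsLeading f' u' g') :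
    C.IsLeading (f * f') (u + u') (g * g') := by
  classical
  refine ⟨mul_ne_zero h.ne_zero h'.ne_zero, ?_, fun w hw => ?_⟩
  · rw [DirectSum.decompose_mul, DirectSum.coe_mul_apply, Finset.sum_eq_single (u, u')]
    · rw [map_mul, h.algebraMap_eq, h'.algebraMap_eq, map_mul, C.χ_add]
      ring
    · rintro ⟨i, j⟩ hij hne
      rw [Finset.mem_filter, Finset.mem_product, DFinsupp.mem_support_iff,
        DFinsupp.mem_support_iff] at hij
      obtain ⟨⟨hi, hj⟩, hsum⟩ := hij
      have hi' := h.le i fun h0 => hi (Subtype.ext h0)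
      have hj' := h'.le j fun h0 => hj (Subtype.ext h0)
      have hsum' : toLex u + toLex u' = toLex i + toLex j := congrArg toLex hsum.symm
      obtain ⟨e₁, e₂⟩ := (add_eq_add_iff_eq_and_eq hi' hj').1 hsum'
      exact absurd (Prod.ext (toLex.injective e₁.symm) (toLex.injective e₂.symm)) hne
    · intro hn
      rw [Finset.mem_filter, Finset.mem_product, DFinsupp.mem_support_iff,
        DFinsupp.mem_support_iff] at hn
      exact absurd ⟨⟨fun h0 => h.component_ne_zero (congrArg Subtype.val h0),
        fun h0 => h'.component_ne_zero (congrArg Subtype.val h0)⟩, rfl⟩ hn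
  · rw [DirectSum.decompose_mul, DirectSum.coe_mul_apply] at hw
    obtain ⟨⟨i, j⟩, hij, -⟩ := Finset.exists_ne_zero_of_sum_ne_zero hw
    rw [Finset.mem_filter, Finset.mem_product, DFinsupp.mem_support_iff,
      DFinsupp.mem_support_iff] at hij
    obtain ⟨⟨hi, hj⟩, hsum⟩ := hij
    have hi' := h.le i fun h0 => hi (Subtype.ext h0)
    have hj' := h'.le j fun h0 => hj (Subtype.ext h0)
    rw [← hsum]
    exact add_le_add hi' hj'

variable (C)

theorem exists_isLeading {f : R} (hf : f ≠ 0) :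
    ∃ p : (Fin m → ℤ) × RatFunc K, C.IsLeading f p.1 p.2 := by
  classical
  have hne : (DirectSum.decompose 𝒜 f).support.Nonempty := by
    rw [Finset.nonempty_iff_ne_empty]
    intro h
    apply hf
    rw [← DirectSum.sum_support_decompose 𝒜 f, h, Finset.sum_empty]
  obtain ⟨u, hu, hmin⟩ := Finset.exists_min_image _ toLex hne
  obtain ⟨g, -, hg⟩ := C.exists_of_mem (DirectSum.decompose 𝒜 f u).2
  rw [DFinsupp.mem_support_iff] at hu
  refine ⟨(u, g), (C.ne_zero_of_algebraMap_eq hg).2 fun h0 => hu (Subtype.ext h0), hg,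
    fun w hw => hmin w ?_⟩
  rw [DFinsupp.mem_support_iff]
  exact fun h0 => hw (congrArg Subtype.val h0)

/-- The pair of the order at `P` and the degree of the lowest homogeneous component. -/
noncomputable def leadingValue (P : Option K) (f : R) : ℤ × (Fin m → ℤ) :=
  open Classical in
  if hf : f ≠ 0 then (ord P (C.exists_isLeading hf).choose.2, (C.exists_isLeading hf).choose.1)
  else 0

variable {C}

theorem IsLeading.leadingValue_eq {f : R} {u : Fin m → ℤ} {g : RatFunc K}
    (h : C.IsLeading f u g) (P : Option K) : C.leadingValue P f = (ord P g, u) := by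
  have hf : f ≠ 0 := by
    rintro rfl
    exact h.component_ne_zero (by simp)
  obtain ⟨h1, h2⟩ := h.unique (C.exists_isLeading hf).choose_spec
  rw [leadingValue, dif_pos hf, ← h1, ← h2]

variable (C)

/-- The order on pairs comparing degrees lexicographically first. -/
def lexEmb (x : ℤ × (Fin m → ℤ)) : Lex (Fin m → ℤ) ×ₗ ℤ := toLex (toLex x.2, x.1)

theorem lexEmb_le_iff {x y : ℤ × (Fin m → ℤ)} :
    lexEmb x ≤ lexEmb y ↔ toLex x.2 < toLex y.2 ∨ x.2 = y.2 ∧ x.1 ≤ y.1 := by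
  rw [lexEmb, lexEmb, Prod.Lex.toLex_le_toLex]
  rfl

theorem lexEmb_leadingValue_add (P : Option K) {f f' : R} (hf : f ≠ 0) (hf' : f' ≠ 0)
    (hadd : f + f' ≠ 0) :
    lexEmb (C.leadingValue P f) ≤ lexEmb (C.leadingValue P (f + f')) ∨
      lexEmb (C.leadingValue P f') ≤ lexEmb (C.leadingValue P (f + f')) := by
  obtain ⟨⟨u, g⟩, h⟩ := C.exists_isLeading hf
  obtain ⟨⟨u', g'⟩, h'⟩ := C.exists_isLeading hf'
  obtain ⟨⟨w, k⟩, hk⟩ := C.exists_isLeading hadd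
  dsimp only at h h' hk
  rw [h.leadingValue_eq, h'.leadingValue_eq, hk.leadingValue_eq, lexEmb_le_iff, lexEmb_le_iff]
  dsimp only
  by_cases hu : toLex u < toLex w
  · exact Or.inl (Or.inl hu)
  by_cases hu' : toLex u' < toLex w
  · exact Or.inr (Or.inl hu')
  have hcomp : (DirectSum.decompose 𝒜 (f + f') w : R) =
      DirectSum.decompose 𝒜 f w + DirectSum.decompose 𝒜 f' w := by
    rw [DirectSum.decompose_add]; rfl
  have hne := hk.component_ne_zero
  have hw := hk.algebraMap_eq
  rw [hcomp, map_add] at hw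
  have e₁ : (DirectSum.decompose 𝒜 f w : R) ≠ 0 → u = w := fun h0 =>
    toLex.injective ((h.le w h0).eq_of_not_lt hu)
  have e₂ : (DirectSum.decompose 𝒜 f' w : R) ≠ 0 → u' = w := fun h0 =>
    toLex.injective ((h'.le w h0).eq_of_not_lt hu')
  by_cases h1 : (DirectSum.decompose 𝒜 f w : R) = 0
  · have h2 : (DirectSum.decompose 𝒜 f' w : R) ≠ 0 := fun h2 => hne (by rw [hcomp, h1, h2, add_zero])
    obtain rfl := e₂ h2
    rw [h1, map_zero, zero_add, h'.algebraMap_eq] at hw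
    exact Or.inr (Or.inr ⟨rfl, by rw [C.ι_mul_χ_injective _ hw]⟩)
  obtain rfl := e₁ h1
  by_cases h2 : (DirectSum.decompose 𝒜 f' u : R) = 0
  · rw [h2, map_zero, add_zero, h.algebraMap_eq] at hw
    exact Or.inl (Or.inr ⟨rfl, by rw [C.ι_mul_χ_injective _ hw]⟩)
  obtain rfl := e₂ h2
  rw [h.algebraMap_eq, h'.algebraMap_eq, ← add_mul, ← map_add] at hw
  obtain rfl : g + g' = k := C.ι_mul_χ_injective _ hw
  exact (min_le_iff.1 (min_ord_le_ord_add P h.ne_zero h'.ne_zero hk.ne_zero)).imp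
    (fun hle => Or.inr ⟨rfl, hle⟩) fun hle => Or.inr ⟨rfl, hle⟩

theorem leadingValue_mul (P : Option K) {f f' : R} (hf : f ≠ 0) (hf' : f' ≠ 0) :
    C.leadingValue P (f * f') = C.leadingValue P f + C.leadingValue P f' := by
  obtain ⟨⟨u, g⟩, h⟩ := C.exists_isLeading hf
  obtain ⟨⟨u', g'⟩, h'⟩ := C.exists_isLeading hf'
  rw [h.leadingValue_eq, h'.leadingValue_eq, (h.mul h').leadingValue_eq,
    ord_mul P h.ne_zero h'.ne_zero, Prod.mk_add_mk]

theorem leadingValue_algebraMap (P : Option K) {c : K} (hc : c ≠ 0) :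
    C.leadingValue P (algebraMap K R c) = 0 := by
  have h : C.IsLeading (algebraMap K R c) 0 (algebraMap K (RatFunc K) c) :=
    isLeading_of_mem (by simpa using hc) (by
      rw [← IsScalarTower.algebraMap_apply, C.ι.commutes, C.χ_zero, mul_one])
  rw [h.leadingValue_eq, ord_algebraMap]
  rfl

theorem leadingValue_homogeneous (P : Option K) {f : R} (hf : f ≠ 0) :
    (∃ u, (DirectSum.decompose 𝒜 f u : R) ≠ 0 ∧
      C.leadingValue P f = C.leadingValue P (DirectSum.decompose 𝒜 f u : R)) ∧
    ∀ u, (DirectSum.decompose 𝒜 f u : R) ≠ 0 →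
      lexEmb (C.leadingValue P f) ≤ lexEmb (C.leadingValue P (DirectSum.decompose 𝒜 f u : R)) := by
  obtain ⟨⟨u, g⟩, h⟩ := C.exists_isLeading hf
  refine ⟨⟨u, h.component_ne_zero, ?_⟩, fun w hw => ?_⟩
  · rw [h.leadingValue_eq, (isLeading_of_mem h.ne_zero h.algebraMap_eq).leadingValue_eq]
  · obtain ⟨k, -, hk⟩ := C.exists_of_mem (DirectSum.decompose 𝒜 f w).2
    have hkl := isLeading_of_mem ((C.ne_zero_of_algebraMap_eq hk).2 hw) hk
    rw [h.leadingValue_eq, hkl.leadingValue_eq, lexEmb_le_iff]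
    rcases (h.le w hw).lt_or_eq with hlt | heq
    · exact Or.inl hlt
    · obtain rfl : u = w := toLex.injective heq
      exact Or.inr ⟨rfl, by rw [C.ι_mul_χ_injective _ (h.algebraMap_eq.symm.trans hk)]⟩

theorem image_leadingValue (P : Option K) :
    C.leadingValue P '' {f | f ≠ 0} = C.valueMonoid P := by
  ext x
  constructor
  · rintro ⟨f, hf, rfl⟩
    obtain ⟨⟨u, g⟩, h⟩ := C.exists_isLeading hf
    rw [h.leadingValue_eq]
    exact ⟨g, ⟨_, h.algebraMap_eq⟩, h.ne_zero, rfl⟩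
  · rintro ⟨f, ⟨r, hr⟩, hf, hfx⟩
    refine ⟨r, (C.ne_zero_of_algebraMap_eq hr).1 hf, ?_⟩
    rw [(isLeading_of_mem hf hr).leadingValue_eq, hfx]

/-- The value monoid of a point generates the full group. -/
theorem closure_valueMonoid
    (hw : AddSubgroup.closure {u : Fin m → ℤ | 𝒜 u ≠ ⊥} = ⊤) (P : Option K) :
    AddSubgroup.closure (C.valueMonoid P : Set (ℤ × (Fin m → ℤ))) = ⊤ := by
  classical
  set H := AddSubgroup.closure (C.valueMonoid P : Set (ℤ × (Fin m → ℤ)))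
  obtain ⟨Q, hQ⟩ : ∃ Q : Option K, Q ≠ P := exists_ne P
  obtain ⟨π, hπ0, hπ⟩ := exists_ord_eq {P, Q} (fun S => if S = P then 1 else -1) (by
    rw [Finset.sum_pair hQ.symm, if_pos rfl, if_neg hQ, add_neg_cancel])
  have hπP : ord P π = 1 := by rw [hπ]; simp
  have h1 : ((1 : ℤ), (0 : Fin m → ℤ)) ∈ H := by
    obtain ⟨w, a, ha, b, hb, hb0, hab⟩ := (C.mem_homFrac_zero_iff (C.ι π)).2 ⟨π, rfl⟩
    rw [zero_add] at ha
    obtain ⟨g, hg, hgb⟩ := C.exists_of_mem hb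
    have hg0 := (C.ne_zero_of_algebraMap_eq hgb).2 hb0
    have hπg : π * g ∈ C.sections w := ⟨a, by rw [← hab, hgb, map_mul, mul_assoc]⟩
    have hmem₁ : (ord P (π * g), w) ∈ H :=
      AddSubgroup.subset_closure ⟨_, hπg, mul_ne_zero hπ0 hg0, rfl⟩
    have hmem₂ : (ord P g, w) ∈ H := AddSubgroup.subset_closure ⟨_, hg, hg0, rfl⟩
    have h := H.sub_mem hmem₁ hmem₂
    rwa [ord_mul P hπ0 hg0, hπP, Prod.mk_sub_mk, add_sub_cancel_right, sub_self] at h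
  have hfst : ∀ a : ℤ, (a, (0 : Fin m → ℤ)) ∈ H := fun a => by
    simpa using H.zsmul_mem h1 a
  have hsnd : ∀ u : Fin m → ℤ, ((0 : ℤ), u) ∈ H := by
    have hle : AddSubgroup.closure {u : Fin m → ℤ | 𝒜 u ≠ ⊥} ≤
        H.comap (AddMonoidHom.inr ℤ (Fin m → ℤ)) := by
      rw [AddSubgroup.closure_le]
      intro u hu
      obtain ⟨r, hr, hr0⟩ := Submodule.exists_mem_ne_zero_of_ne_bot hu
      obtain ⟨g, hg, hgr⟩ := C.exists_of_mem hr
      have hmem : (ord P g, u) ∈ H :=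
        AddSubgroup.subset_closure ⟨g, hg, (C.ne_zero_of_algebraMap_eq hgr).2 hr0, rfl⟩
      have h := H.sub_mem hmem (hfst (ord P g))
      rwa [Prod.mk_sub_mk, sub_self, sub_zero] at h
    rw [hw] at hle
    exact fun u => hle (AddSubgroup.mem_top u)
  refine (AddSubgroup.eq_top_iff' _).2 fun x => ?_
  simpa using H.add_mem (hfst x.1) (hsnd x.2)

/-- If all homogeneous valuations of full rank have finitely generated value semigroups, then so do
the value monoids of points. -/
theorem valueMonoid_fg_of_forall_valuation {Γ : Type*} [AddCommGroup Γ]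
    (E : Γ ≃+ ℤ × (Fin m → ℤ))
    (hw : AddSubgroup.closure {u : Fin m → ℤ | 𝒜 u ≠ ⊥} = ⊤)
    (h : ∀ le : Γ → Γ → Prop, IsLinearOrder _ le → (∀ a b c, le a b → le (c + a) (c + b)) →
      ∀ ν : R → Γ, (∀ f g : R, f ≠ 0 → g ≠ 0 → ν (f * g) = ν f + ν g) →
        (∀ f g : R, f ≠ 0 → g ≠ 0 → f + g ≠ 0 →
          le (ν f) (ν (f + g)) ∨ le (ν g) (ν (f + g))) →
        (∀ c : K, c ≠ 0 → ν (algebraMap K R c) = 0) →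
        (∀ f : R, f ≠ 0 →
          (∃ u, ((DirectSum.decompose 𝒜 f u : 𝒜 u) : R) ≠ 0 ∧
            ν f = ν ((DirectSum.decompose 𝒜 f u : 𝒜 u) : R)) ∧
          ∀ u, ((DirectSum.decompose 𝒜 f u : 𝒜 u) : R) ≠ 0 →
            le (ν f) (ν ((DirectSum.decompose 𝒜 f u : 𝒜 u) : R))) →
        AddSubgroup.closure (ν '' {f : R | f ≠ 0}) = ⊤ →
        (AddSubmonoid.closure (ν '' {f : R | f ≠ 0})).FG) (P : Option K) :
    (C.valueMonoid P).FG := by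
  have hinj : Function.Injective (lexEmb (m := m)) := fun x y hxy =>
    Prod.ext (congrArg (fun z => (ofLex z).2) hxy)
      (congrArg (fun z : Lex (Fin m → ℤ) ×ₗ ℤ => ofLex (ofLex z).1) hxy)
  have hadd : ∀ x y : ℤ × (Fin m → ℤ), lexEmb (x + y) = lexEmb x + lexEmb y := fun _ _ => rfl
  have himg : (fun f => E.symm (C.leadingValue P f)) '' {f : R | f ≠ 0} =
      E.symm '' (C.valueMonoid P : Set (ℤ × (Fin m → ℤ))) := by
    rw [← C.image_leadingValue P, Set.image_image]
  have hFG := h (fun a b => lexEmb (E a) ≤ lexEmb (E b))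
    { refl := fun a => le_rfl
      trans := fun a b c => le_trans
      antisymm := fun a b hab hba => E.injective (hinj (le_antisymm hab hba))
      total := fun a b => le_total _ _ }
    (fun a b c hab => by
      rw [map_add, map_add, hadd, hadd]
      exact add_le_add_right hab _)
    (fun f => E.symm (C.leadingValue P f))
    (fun f g hf hg => by rw [C.leadingValue_mul P hf hg, map_add])
    (fun f g hf hg hfg => by
      simpa only [E.apply_symm_apply] using C.lexEmb_leadingValue_add P hf hg hfg)
    (fun c hc => by rw [C.leadingValue_algebraMap P hc, map_zero])
    (fun f hf => by
      simpa only [E.apply_symm_apply, E.symm.injective.eq_iff] using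
        C.leadingValue_homogeneous P hf)
    (by
      rw [himg]
      have := congrArg (AddSubgroup.map E.symm.toAddMonoidHom) (C.closure_valueMonoid hw P)
      rw [AddMonoidHom.map_closure, AddSubgroup.map_top_of_surjective _ E.symm.surjective] at this
      exact this)
  rw [himg] at hFG
  have := hFG.map E.toAddMonoidHom
  rw [AddMonoidHom.map_mclosure, ← Set.image_comp] at this
  have hid : (E.toAddMonoidHom ∘ E.symm : ℤ × (Fin m → ℤ) → _) = id := funext E.apply_symm_apply
  rwa [hid, Set.image_id, AddSubmonoid.closure_eq] at this

end AlmostToric.Coordinates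

namespace AlmostToric.Coordinates

variable {K R : Type*} [Field K] [CommRing R] [IsDomain R] [Algebra K R] {m : ℕ}
variable {𝒜 : (Fin m → ℤ) → Submodule K R} [GradedAlgebra 𝒜] (C : Coordinates 𝒜)

/-- The rational functions representing the integral homogeneous fractions of degree `u`. -/
def integralSections (u : Fin m → ℤ) : Submodule K (RatFunc K) where
  carrier := {f | IsIntegral R (C.ι f * C.χ u)}
  zero_mem' := by
    change IsIntegral R (C.ι 0 * C.χ u)
    rw [map_zero, zero_mul]
    exact isIntegral_zero
  add_mem' := fun {f g} hf hg => by
    change IsIntegral R (C.ι (f + g) * C.χ u)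
    rw [map_add, add_mul]
    exact IsIntegral.add hf hg
  smul_mem' := fun c f hf => by
    change IsIntegral R (C.ι (c • f) * C.χ u)
    rw [map_smul C.ι, smul_mul_assoc, Algebra.smul_def, IsScalarTower.algebraMap_apply K R]
    exact isIntegral_algebraMap.mul hf

theorem mem_integralSections {u : Fin m → ℤ} {f : RatFunc K} :
    f ∈ C.integralSections u ↔ IsIntegral R (C.ι f * C.χ u) := Iff.rfl

theorem sections_le_integralSections (u : Fin m → ℤ) : C.sections u ≤ C.integralSections u := by
  rintro f ⟨r, hr⟩
  rw [mem_integralSections, ← hr]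
  exact isIntegral_algebraMap

theorem pow_mem_integralSections {u : Fin m → ℤ} {f : RatFunc K} (hf : f ∈ C.integralSections u)
    (n : ℕ) : f ^ n ∈ C.integralSections (n • u) := by
  rw [mem_integralSections, map_pow, C.χ_nsmul, ← mul_pow]
  exact IsIntegral.pow hf n

/-- A submodule mapped into a finite-dimensional one by an injective linear map is
finite-dimensional. -/
theorem finiteDimensional_of_map_le {V W : Type*} [AddCommGroup V] [Module K V] [AddCommGroup W]
    [Module K W] {φ : V →ₗ[K] W} (hφ : Function.Injective φ) {S : Submodule K V}
    {T : Submodule K W} [FiniteDimensional K T] (h : S.map φ ≤ T) : FiniteDimensional K S :=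
  have := Submodule.finiteDimensional_of_le h
  (Submodule.equivMapOfInjective φ hφ S).symm.finiteDimensional

theorem finiteDimensional_sections [IsNoetherianRing R]
    (h0 : 𝒜 0 = Submodule.span K {(1 : R)}) (u : Fin m → ℤ) :
    FiniteDimensional K (C.sections u) := by
  have := finiteDimensional_of_zero_eq 𝒜 h0 u
  refine finiteDimensional_of_map_le (φ := (LinearMap.mulRight K (C.χ u)).comp C.ι.toLinearMap)
    (C.ι_mul_χ_injective u)
    (T := (𝒜 u).map (IsScalarTower.toAlgHom K R (FractionRing R)).toLinearMap) ?_
  rintro _ ⟨f, ⟨r, hr⟩, rfl⟩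
  exact ⟨r, C.mem_of_algebraMap_eq hr, hr⟩

/-- Some nonzero section multiplies all integral sections into sections. -/
theorem exists_conductor_section [CharZero K] [Algebra.FiniteType K R] :
    ∃ w, ∃ c ∈ C.sections w, c ≠ 0 ∧ ∀ u, ∀ f ∈ C.integralSections u,
      c * f ∈ C.sections (w + u) := by
  obtain ⟨w, c, hcw, hc0, hc⟩ := exists_homogeneous_conductor 𝒜
  obtain ⟨γ, hγ, hγc⟩ := C.exists_of_mem hcw
  refine ⟨w, γ, hγ, (C.ne_zero_of_algebraMap_eq hγc).2 hc0, fun u f hf => ?_⟩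
  obtain ⟨r, hr⟩ := hc _ hf
  refine ⟨r, ?_⟩
  rw [← hr, hγc, map_mul, C.χ_add]
  ring

theorem finiteDimensional_integralSections [CharZero K] [Algebra.FiniteType K R]
    (h0 : 𝒜 0 = Submodule.span K {(1 : R)}) (u : Fin m → ℤ) :
    FiniteDimensional K (C.integralSections u) := by
  have : IsNoetherianRing R := Algebra.FiniteType.isNoetherianRing K R
  obtain ⟨w, c, -, hc0, hc⟩ := C.exists_conductor_section
  have := C.finiteDimensional_sections h0 (w + u)
  refine finiteDimensional_of_map_le (φ := LinearMap.mulLeft K c)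
    (mul_right_injective₀ hc0) (T := C.sections (w + u)) ?_
  rintro _ ⟨f, hf, rfl⟩
  exact hc u f hf

theorem ord_eq_zero_of_mem_sections_zero (h0 : 𝒜 0 = Submodule.span K {(1 : R)})
    {f : RatFunc K} (hf : f ∈ C.sections 0) (P : Option K) : ord P f = 0 := by
  obtain ⟨r, hr⟩ := hf
  have hmem := C.mem_of_algebraMap_eq hr
  rw [h0, Submodule.mem_span_singleton] at hmem
  obtain ⟨c, rfl⟩ := hmem
  have h : algebraMap K (RatFunc K) c = f := C.ι_mul_χ_injective 0 (by
    change C.ι _ * C.χ 0 = C.ι f * C.χ 0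
    rw [← hr, C.ι.commutes, C.χ_zero, mul_one, ← Algebra.algebraMap_eq_smul_one,
      ← IsScalarTower.algebraMap_apply])
  rw [← h, ord_algebraMap]

/-- A very general point, at which the orders of vanishing of sections and of integral sections
are governed by dimensions. -/
theorem exists_general_point [CharZero K] [Uncountable K] [Algebra.FiniteType K R]
    (h0 : 𝒜 0 = Submodule.span K {(1 : R)}) :
    ∃ a : K, ∀ u, (∀ f ∈ C.sections u, f ≠ 0 →
      ord (some a) f < Module.finrank K (C.sections u)) ∧
      ∀ d < Module.finrank K (C.integralSections u), ∃ f ∈ C.integralSections u, f ≠ 0 ∧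
        (d : ℤ) ≤ ord (some a) f := by
  have : IsNoetherianRing R := Algebra.FiniteType.isNoetherianRing K R
  have hfin := C.finiteDimensional_sections h0
  have hfin' := C.finiteDimensional_integralSections h0
  choose B hB using fun u => exists_finset_forall_ord_lt (C.sections u)
  choose B' hB' using fun u => exists_finset_forall_ord_lt (C.integralSections u)
  have hcount : (⋃ u, ((B u : Set K) ∪ B' u)).Countable :=
    Set.countable_iUnion fun u => ((B u).countable_toSet).union (B' u).countable_toSet
  obtain ⟨a, ha⟩ : ∃ a, a ∉ ⋃ u, ((B u : Set K) ∪ B' u) := by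
    by_contra! h
    exact Set.not_countable_univ (α := K) (hcount.mono fun a _ => h a)
  rw [Set.mem_iUnion] at ha
  push Not at ha
  exact ⟨a, fun u => ⟨(hB u a fun h => ha u (Or.inl h)).1, (hB' u a fun h => ha u (Or.inr h)).2⟩⟩

/-- If the value monoids of all points are finitely generated, then the integral homogeneous
fractions of degrees in a suitable multiple of the lattice are regular. -/
theorem exists_integralSections_le [CharZero K] [Uncountable K] [Algebra.FiniteType K R]
    (h0 : 𝒜 0 = Submodule.span K {(1 : R)}) (hFG : ∀ P, (C.valueMonoid P).FG) :
    ∃ N : ℕ, 1 ≤ N ∧ ∀ v, C.integralSections (N • v) ≤ C.sections (N • v) := by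
  have : IsNoetherianRing R := Algebra.FiniteType.isNoetherianRing K R
  have hfin := C.finiteDimensional_integralSections h0
  obtain ⟨p, hp⟩ := C.exists_general_point h0
  obtain ⟨k, g, hg, hmem⟩ := exists_range_eq_of_fg (hFG (some p))
  have hsum : ∀ n : Fin k → ℕ, ∑ i, n i • g i =
      (∑ i, (n i : ℤ) * (g i).1, ∑ i, n i • (g i).2) := fun n => by
    refine Prod.ext ?_ ?_
    · rw [Prod.fst_sum]; simp
    · rw [Prod.snd_sum]; simp
  obtain ⟨N, hN, hopt⟩ := exists_uniform_integral_optimum (fun i => (g i).1) (fun i => (g i).2)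
    (fun n hn => by
      obtain ⟨f, hf, -, hfx⟩ := (hmem _).2 ⟨n, rfl⟩
      rw [hsum] at hf hfx
      rw [hn] at hf
      exact (hfx.symm.trans (C.ord_eq_zero_of_mem_sections_zero h0 hf _)).le)
  refine ⟨N, hN, fun v => ?_⟩
  suffices hle : Module.finrank K (C.integralSections (N • v)) ≤
      Module.finrank K (C.sections (N • v)) from
    (Submodule.eq_of_le_of_finrank_le (C.sections_le_integralSections _) hle).ge
  by_cases hd : Module.finrank K (C.integralSections (N • v)) = 0
  · rw [hd]; exact Nat.zero_le _
  obtain ⟨f, hf, hf0, hford⟩ := (hp (N • v)).2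
    (Module.finrank K (C.integralSections (N • v)) - 1) (by omega)
  obtain ⟨w, c, -, hc0, hc⟩ := C.exists_conductor_section
  obtain ⟨j, hj, hjmem⟩ := exists_pos_nsmul_mem (hFG (some p)) (x := (ord (some p) f, N • v))
    (y := (ord (some p) c, w)) fun j => ⟨c * f ^ j, hc _ _ (C.pow_mem_integralSections hf j),
      mul_ne_zero hc0 (pow_ne_zero _ hf0), by
        rw [ord_mul _ hc0 (pow_ne_zero _ hf0), ord_pow _ hf0]; simp⟩
  obtain ⟨n, hn⟩ := (hmem _).1 hjmem
  rw [hsum, Prod.smul_mk, Prod.mk.injEq] at hn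
  obtain ⟨n', hn', hle⟩ := hopt v j n hj hn.2
  rw [hn.1, nsmul_eq_mul] at hle
  have hle' := le_of_mul_le_mul_left hle (by exact_mod_cast hj)
  obtain ⟨f', hf', hf0', hfx'⟩ := (hmem _).2 ⟨n', rfl⟩
  rw [hsum] at hf' hfx'
  rw [hn'] at hf'
  have hlt := (hp (N • v)).1 f' hf' hf0'
  rw [show ord (some p) f' = _ from hfx'] at hlt
  dsimp only at hlt
  omega

end AlmostToric.Coordinates

namespace AlmostToric

variable {K R : Type*} [Field K] [CommRing R] [Algebra K R] {m : ℕ}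
variable {𝒜 : (Fin m → ℤ) → Submodule K R} [GradedAlgebra 𝒜]

/-- The degrees occurring in elements of the Veronese subalgebra are divisible by `l`. -/
theorem exists_eq_nsmul_of_mem_veronese {l : ℕ} {r : R} (hr : r ∈ veronese 𝒜 l) {w : Fin m → ℤ}
    (hw : (DirectSum.decompose 𝒜 r w : R) ≠ 0) : ∃ v, w = l • v := by
  classical
  induction hr using Algebra.adjoin_induction generalizing w with
  | mem r h =>
    obtain ⟨u, hu⟩ := Set.mem_iUnion.1 h
    by_cases huw : (fun i => (l : ℤ) * u i) = w
    · exact ⟨u, by rw [← huw]; ext i; simp⟩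
    · exact absurd (DirectSum.decompose_of_mem_ne 𝒜 hu huw) hw
  | algebraMap c =>
    by_cases h0 : 0 = w
    · exact ⟨0, by rw [← h0, smul_zero]⟩
    · exact absurd (DirectSum.decompose_of_mem_ne 𝒜 (SetLike.algebraMap_mem_graded 𝒜 c) h0) hw
  | add a b _ _ ha hb =>
    by_cases h : (DirectSum.decompose 𝒜 a w : R) = 0
    · refine hb fun h' => hw ?_
      rw [DirectSum.decompose_add]
      change (DirectSum.decompose 𝒜 a w : R) + DirectSum.decompose 𝒜 b w = 0
      rw [h, h', add_zero]
    · exact ha h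
  | mul a b _ _ ha hb =>
    rw [DirectSum.decompose_mul, DirectSum.coe_mul_apply] at hw
    obtain ⟨⟨i, j⟩, hij, hne⟩ := Finset.exists_ne_zero_of_sum_ne_zero hw
    obtain ⟨v, rfl⟩ := ha (left_ne_zero_of_mul hne)
    obtain ⟨v', rfl⟩ := hb (right_ne_zero_of_mul hne)
    exact ⟨v + v', by rw [← (Finset.mem_filter.1 hij).2, smul_add]⟩

theorem torusHom_mem_veronese [IsDomain R] {l : ℕ} {r : R} (hr : r ∈ veronese 𝒜 l)
    (t : Fin m → Kˣ) : torusHom 𝒜 t r ∈ veronese 𝒜 l := by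
  suffices h : veronese 𝒜 l ≤ (veronese 𝒜 l).comap (torusHom 𝒜 t) from h hr
  refine Algebra.adjoin_le fun r hr => ?_
  obtain ⟨u, hu⟩ := Set.mem_iUnion.1 hr
  change torusHom 𝒜 t r ∈ veronese 𝒜 l
  rw [torusHom_apply 𝒜 t hu]
  exact Subalgebra.smul_mem _ (Algebra.subset_adjoin hr) _

variable [IsDomain R]

variable (𝒜) in
/-- The fractions of elements of the Veronese subalgebra. -/
def veroneseFrac (l : ℕ) : Submodule K (FractionRing R) where
  carrier := {x | ∃ p ∈ veronese 𝒜 l, ∃ q ∈ veronese 𝒜 l, q ≠ 0 ∧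
    x * algebraMap R (FractionRing R) q = algebraMap R (FractionRing R) p}
  zero_mem' := ⟨0, zero_mem _, 1, one_mem _, one_ne_zero, by simp⟩
  add_mem' := by
    rintro x y ⟨p, hp, q, hq, hq0, h⟩ ⟨p', hp', q', hq', hq0', h'⟩
    refine ⟨p * q' + p' * q, add_mem (mul_mem hp hq') (mul_mem hp' hq), q * q', mul_mem hq hq',
      mul_ne_zero hq0 hq0', ?_⟩
    rw [map_add, map_mul, map_mul, map_mul, ← h, ← h']
    ring
  smul_mem' := by
    rintro c x ⟨p, hp, q, hq, hq0, h⟩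
    refine ⟨c • p, Subalgebra.smul_mem _ hp c, q, hq, hq0, ?_⟩
    rw [smul_mul_assoc, h]
    exact (map_smul (IsScalarTower.toAlgHom K R (FractionRing R)) c p).symm

theorem torusFrac_mem_veroneseFrac {l : ℕ} {x : FractionRing R} (hx : x ∈ veroneseFrac 𝒜 l)
    (t : Fin m → Kˣ) : torusFrac 𝒜 t x ∈ veroneseFrac 𝒜 l := by
  obtain ⟨p, hp, q, hq, hq0, h⟩ := hx
  refine ⟨torusHom 𝒜 t p, torusHom_mem_veronese hp t, torusHom 𝒜 t q, torusHom_mem_veronese hq t,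
    (map_ne_zero_iff _ (torusHom_injective 𝒜 t)).2 hq0, ?_⟩
  rw [← torusFrac_algebraMap, ← torusFrac_algebraMap, ← map_mul, h]

theorem exists_eq_nsmul_of_mem_veroneseFrac {l : ℕ} {x : FractionRing R}
    (hx : x ∈ veroneseFrac 𝒜 l) (hx0 : x ≠ 0) {u : Fin m → ℤ} (hu : x ∈ homFrac 𝒜 u) :
    ∃ v, u = l • v := by
  classical
  obtain ⟨p, hp, q, hq, hq0, h⟩ := hx
  obtain ⟨w, a, ha, b, hb, hb0, hab⟩ := hu
  have hinj := IsFractionRing.injective R (FractionRing R)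
  have ha0 : a ≠ 0 := by
    rintro rfl
    rw [map_zero] at hab
    exact hx0 ((mul_eq_zero.1 hab).resolve_right ((map_ne_zero_iff _ hinj).2 hb0))
  have haq : a * q = b * p := hinj (by rw [map_mul, map_mul, ← hab, ← h]; ring)
  obtain ⟨z, hz⟩ : ∃ z, (DirectSum.decompose 𝒜 q z : R) ≠ 0 := by
    by_contra! hall
    apply hq0
    rw [← DirectSum.sum_support_decompose 𝒜 q]
    exact Finset.sum_eq_zero fun z _ => hall z
  have hcomp : a * (DirectSum.decompose 𝒜 q z : R) = b * DirectSum.decompose 𝒜 p (u + z) := by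
    have h1 := DirectSum.coe_decompose_mul_add_of_left_mem 𝒜 (j := z) (b := q) ha
    rw [haq, show u + w + z = w + (u + z) by abel,
      DirectSum.coe_decompose_mul_add_of_left_mem 𝒜 hb] at h1
    exact h1.symm
  have hpz : (DirectSum.decompose 𝒜 p (u + z) : R) ≠ 0 := fun h0 => by
    rw [h0, mul_zero] at hcomp
    exact mul_ne_zero ha0 hz hcomp
  obtain ⟨v, hv⟩ := exists_eq_nsmul_of_mem_veronese hq hz
  obtain ⟨v', hv'⟩ := exists_eq_nsmul_of_mem_veronese hp hpz
  exact ⟨v' - v, by rw [smul_sub, ← hv, ← hv', add_sub_cancel_right]⟩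

/-- If the integral homogeneous fractions of degrees divisible by `l` are regular, then the
Veronese subalgebra is integrally closed. -/
theorem isIntegrallyClosed_veronese [CharZero K] [Algebra.FiniteType K R] {l : ℕ}
    (h : ∀ v, ∀ x ∈ homFrac 𝒜 (l • v), IsIntegral R x →
      ∃ r : R, algebraMap R (FractionRing R) r = x) :
    IsIntegrallyClosed (veronese 𝒜 l) := by
  classical
  have hinj : Function.Injective (algebraMap (veronese 𝒜 l) (FractionRing R)) := by
    rw [IsScalarTower.algebraMap_eq (veronese 𝒜 l) R (FractionRing R)]
    exact (IsFractionRing.injective R (FractionRing R)).comp Subtype.val_injective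
  let φ : FractionRing (veronese 𝒜 l) →ₐ[veronese 𝒜 l] FractionRing R :=
    IsFractionRing.liftAlgHom (g := Algebra.ofId (veronese 𝒜 l) _) hinj
  have hφ : Function.Injective φ := RingHom.injective φ.toRingHom
  rw [isIntegrallyClosed_iff (FractionRing (veronese 𝒜 l))]
  intro x hx
  have hφx : IsIntegral R (φ x) := (hx.map φ).tower_top
  have hfrac : φ x ∈ veroneseFrac 𝒜 l := by
    obtain ⟨p, q, hq, rfl⟩ := IsFractionRing.div_surjective (veronese 𝒜 l) x
    have hq0 : (q : R) ≠ 0 := fun h0 => nonZeroDivisors.ne_zero hq (Subtype.ext h0)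
    refine ⟨p, p.2, q, q.2, hq0, ?_⟩
    rw [map_div₀, φ.commutes, φ.commutes]
    exact div_mul_cancel₀ _ ((map_ne_zero_iff _ (IsFractionRing.injective R (FractionRing R))).2 hq0)
  obtain ⟨s, y, hy, hyi, hsum⟩ := exists_homogeneous_decomposition_of_isIntegral 𝒜 hφx
  have hmem := mem_of_sum_mem_of_stable (veroneseFrac 𝒜 l)
    (fun t x hx => torusFrac_mem_veroneseFrac hx t) s id Function.injective_id.injOn y hy
    (hsum ▸ hfrac)
  have hreg : ∀ u ∈ s, ∃ r ∈ veronese 𝒜 l, algebraMap R (FractionRing R) r = y u := by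
    intro u hu
    by_cases hy0 : y u = 0
    · exact ⟨0, zero_mem _, by rw [map_zero, hy0]⟩
    obtain ⟨v, rfl⟩ := exists_eq_nsmul_of_mem_veroneseFrac (hmem u hu) hy0 (hy u hu)
    obtain ⟨r, hr⟩ := h v _ (hy _ hu) (hyi _ hu)
    exact ⟨r, mem_veronese_of_mem (mem_of_algebraMap_mem_homFrac (hr ▸ hy _ hu)), hr⟩
  choose! r hr hry using hreg
  refine ⟨⟨∑ u ∈ s, r u, sum_mem hr⟩, hφ ?_⟩
  rw [φ.commutes, ← hsum]
  change algebraMap R (FractionRing R) (∑ u ∈ s, r u) = _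
  rw [map_sum]
  exact Finset.sum_congr rfl hry

end AlmostToric

noncomputable section

variable {K R : Type} [Field K] [IsAlgClosed K] [CharZero K] [Uncountable K]
variable [CommRing R] [IsDomain R] [Algebra K R]
variable {m : ℕ}

/-- **Theorem 6.6 / Theorem 1.2.** Let `K` be an uncountable algebraically closed field of
characteristic `0` and `R` a finitely generated `ℤᵐ`-graded domain over `K` with `R₀ = K`,
whose weights generate `ℤᵐ` and which is rational of complexity one (`Spec R` is an affine
almost toric variety). Then `R` is homogeneously Khovanskii-finite (every homogeneous
valuation of full rank has finitely generated value semigroup) if and only if there exists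
`λ ≥ 1` such that the Veronese subalgebra `R(λ·ℤᵐ)` is normal, i.e. integrally closed in its
field of fractions. -/
theorem almostToric_homogeneously_khovanskiiFinite_iff_veronese_normal
    (𝒜 : (Fin m → ℤ) → Submodule K R) [GradedAlgebra 𝒜]
    (hfg : Algebra.FiniteType K R)
    (h0 : 𝒜 0 = Submodule.span K {(1 : R)})
    -- the weights of the grading generate `ℤᵐ` as a group (the torus acts faithfully)
    (hweights : AddSubgroup.closure {u : Fin m → ℤ | 𝒜 u ≠ ⊥} =
      (⊤ : AddSubgroup (Fin m → ℤ)))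
    -- `R` is rational of complexity one (`Spec R` is almost toric)
    (hrat : Nonempty (FractionRing R ≃ₐ[K] FractionRing (MvPolynomial (Fin (m + 1)) K))) :
    -- `R` is homogeneously Khovanskii-finite ...
    (∀ le : (Fin (m + 1) → ℤ) → (Fin (m + 1) → ℤ) → Prop,
      IsLinearOrder _ le →
      (∀ a b c, le a b → le (c + a) (c + b)) →
      ∀ ν : R → (Fin (m + 1) → ℤ),
        (∀ f g : R, f ≠ 0 → g ≠ 0 → ν (f * g) = ν f + ν g) →
        (∀ f g : R, f ≠ 0 → g ≠ 0 → f + g ≠ 0 →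
          le (ν f) (ν (f + g)) ∨ le (ν g) (ν (f + g))) →
        (∀ c : K, c ≠ 0 → ν (algebraMap K R c) = 0) →
        (∀ f : R, f ≠ 0 →
          (∃ u, ((DirectSum.decompose 𝒜 f u : 𝒜 u) : R) ≠ 0 ∧
            ν f = ν ((DirectSum.decompose 𝒜 f u : 𝒜 u) : R)) ∧
          ∀ u, ((DirectSum.decompose 𝒜 f u : 𝒜 u) : R) ≠ 0 →
            le (ν f) (ν ((DirectSum.decompose 𝒜 f u : 𝒜 u) : R))) →
        -- full rank
        AddSubgroup.closure (ν '' {f : R | f ≠ 0}) = (⊤ : AddSubgroup (Fin (m + 1) → ℤ)) →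
        (AddSubmonoid.closure (ν '' {f : R | f ≠ 0})).FG) ↔
    -- ... iff some Veronese subring `R(λ·ℤᵐ)` is normal
    (∃ lam : ℕ, 1 ≤ lam ∧
      IsIntegrallyClosed
        ↥(Algebra.adjoin K
            (⋃ u : Fin m → ℤ, (𝒜 (fun i => (lam : ℤ) * u i) : Set R)))) := by
  have ⟨C⟩ := AlmostToric.nonempty_coordinates 𝒜 hfg hweights hrat.some
  have := hfg
  constructor
  · intro h
    have hFG := C.valueMonoid_fg_of_forall_valuation
      (Fin.consLinearEquiv ℤ fun _ : Fin (m + 1) => ℤ).symm.toAddEquiv hweights h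
    obtain ⟨N, hN, hle⟩ := C.exists_integralSections_le h0 hFG
    refine ⟨N, hN, AlmostToric.isIntegrallyClosed_veronese (l := N) fun v x hx hxi => ?_⟩
    obtain ⟨f, rfl⟩ := C.mem_homFrac_iff.1 hx
    exact hle v hxi
  · rintro ⟨l, hl, hclosed⟩ le hle htrans ν hmul hadd hconst hhom -
    have : IsIntegrallyClosed (AlmostToric.veronese 𝒜 l) := hclosed
    exact C.fg_of_forall_valueMonoid_fg
      (C.valueMonoid_fg hfg hl fun u f hf => AlmostToric.exists_mem_of_isIntegrallyClosed_veronese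
        hl (C.mem_homFrac_iff.2 ⟨f, rfl⟩) hf)
      htrans hmul hadd hconst fun f hf => (hhom f hf).1

end
end

section
/- Let K be an algebraically closed field of characteristic 0, let L be the K-span of {t, t², 1 + t⁴} in the univariate polynomial ring K[t], and for k ∈ ℕ let L^k denote the k-th power of L under submodule multiplication (L^0 = K·1). Let S := {(k, e) ∈ ℕ × ℕ : there exists f ∈ L^k with f ≠ 0 and natDegree f = e}, which is an additive submonoid of ℕ × ℕ. Then S equals the additive submonoid generated by the set {(1,1), (1,2), (1,4)} ∪ {(k, 2) : k ≥ 3}, and S is not finitely generated. (Example 2.4 of the paper: the value semigroup of the homogeneous valuation f(t)x^a ↦ (a, deg f) on K[tx, t²x, (1+t⁴)x] is minimally generated by an infinite set.) -/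
open Polynomial

noncomputable section

variable (K : Type) [Field K] [IsAlgClosed K] [CharZero K]

/-- The span of `{t, t², 1 + t⁴}` in `K[t]`. -/
def Lquartic : Submodule K (Polynomial K) :=
  Submodule.span K ({X, X ^ 2, 1 + X ^ 4} : Set (Polynomial K))

/-- The set of pairs `(k, e)` such that some nonzero `f ∈ L^k` has degree `e`; this is the
value semigroup of the valuation `f(t)·xᵃ ↦ (a, deg f)` on `K[tx, t²x, (1 + t⁴)x]`. -/
def quarticSemigroupSet : Set (ℕ × ℕ) :=
  {p | ∃ f ∈ (Lquartic K) ^ p.1, f ≠ 0 ∧ f.natDegree = p.2}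

/-- The polynomials of degree at most `4(k+1)` satisfying the linear conditions imposed by the
singular point of the curve `(t : t² : 1 + t⁴)`, at which `t = 0` and `t = ∞` meet. -/
def quarticConditions (F : Type) [Field F] (k : ℕ) : Submodule F F[X] where
  carrier := {f | (∀ n, 4 * k + 4 < n → f.coeff n = 0) ∧ f.coeff 0 = f.coeff (4 * k + 4) ∧
    f.coeff (4 * k + 3) = 0 ∧ f.coeff 1 = f.coeff (4 * k + 1)}
  zero_mem' := by simp
  add_mem' := by
    rintro f g ⟨a, b, c, d⟩ ⟨a', b', c', d'⟩
    refine ⟨fun n hn => ?_, ?_, ?_, ?_⟩ <;> rw [coeff_add]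
    · rw [a n hn, a' n hn, add_zero]
    · rw [b, b', coeff_add]
    · rw [c, c', add_zero]
    · rw [d, d', coeff_add]
  smul_mem' := by
    rintro r f ⟨a, b, c, d⟩
    refine ⟨fun n hn => ?_, ?_, ?_, ?_⟩ <;> rw [coeff_smul]
    · rw [a n hn, smul_zero]
    · rw [b, coeff_smul]
    · rw [c, smul_zero]
    · rw [d, coeff_smul]

theorem Lquartic_le_quarticConditions (F : Type) [Field F] :
    Lquartic F ≤ quarticConditions F 0 := by
  rw [Lquartic, Submodule.span_le]
  rintro x (rfl | rfl | rfl)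
  · refine ⟨fun n hn => coeff_X_of_ne_one (by omega), ?_, ?_, rfl⟩ <;> simp [coeff_X]
  · refine ⟨fun n hn => ?_, ?_, ?_, rfl⟩ <;> simp [coeff_X_pow]
    omega
  · refine ⟨fun n hn => ?_, ?_, ?_, rfl⟩
    · rw [coeff_add, coeff_one, coeff_X_pow, if_neg (by omega), if_neg (by omega), add_zero]
    · simp [coeff_X_pow, coeff_one]
    · simp [coeff_X_pow, coeff_one]

theorem quarticConditions_mul_Lquartic_le (F : Type) [Field F] (k : ℕ) :
    quarticConditions F k * Lquartic F ≤ quarticConditions F (k + 1) := by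
  rw [Submodule.mul_le]
  rintro g ⟨a, b, c, d⟩ l hl
  suffices h : Lquartic F ≤ (quarticConditions F (k + 1)).comap (LinearMap.mulLeft F g) from h hl
  rw [Lquartic, Submodule.span_le]
  rintro x (rfl | rfl | rfl)
  · change g * X ∈ quarticConditions F (k + 1)
    refine ⟨fun n hn => ?_, ?_, ?_, ?_⟩
    · obtain ⟨m, rfl⟩ : ∃ m, n = m + 1 := ⟨n - 1, by omega⟩
      rw [coeff_mul_X, a _ (by omega)]
    · rw [coeff_mul_X, a _ (by omega), mul_coeff_zero, coeff_X_zero, mul_zero]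
    · rw [coeff_mul_X, a _ (by omega)]
    · exact ((coeff_mul_X g 0).trans b).trans (coeff_mul_X g (4 * k + 4)).symm
  · change g * X ^ 2 ∈ quarticConditions F (k + 1)
    refine ⟨fun n hn => ?_, ?_, ?_, ?_⟩
    · obtain ⟨m, rfl⟩ : ∃ m, n = m + 2 := ⟨n - 2, by omega⟩
      rw [coeff_mul_X_pow, a _ (by omega)]
    · rw [show 4 * (k + 1) + 4 = (4 * k + 6) + 2 by ring, coeff_mul_X_pow, a _ (by omega)]
      simp
    · rw [show 4 * (k + 1) + 3 = (4 * k + 5) + 2 by ring, coeff_mul_X_pow, a _ (by omega)]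
    · rw [show 4 * (k + 1) + 1 = (4 * k + 3) + 2 by ring, coeff_mul_X_pow, c]
      simp [coeff_mul_X_pow']
  · change g * (1 + X ^ 4) ∈ quarticConditions F (k + 1)
    rw [mul_add, mul_one]
    refine ⟨fun n hn => ?_, ?_, ?_, ?_⟩ <;> rw [coeff_add]
    · obtain ⟨m, rfl⟩ : ∃ m, n = m + 4 := ⟨n - 4, by omega⟩
      rw [coeff_mul_X_pow, a _ (by omega), a _ (by omega), add_zero]
    · rw [coeff_add, coeff_mul_X_pow, a (4 * (k + 1) + 4) (by omega), b]
      simp [mul_add]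
    · rw [show 4 * (k + 1) + 3 = (4 * k + 3) + 4 by ring, coeff_mul_X_pow, c,
        a _ (by omega), add_zero]
    · rw [show 4 * (k + 1) + 1 = (4 * k + 1) + 4 by ring, coeff_add, coeff_mul_X_pow, ← d,
        a (4 * k + 1 + 4) (by omega)]
      simp [coeff_mul_X_pow']

theorem Lquartic_pow_le_quarticConditions (F : Type) [Field F] (k : ℕ) :
    Lquartic F ^ (k + 1) ≤ quarticConditions F k := by
  induction k with
  | zero => simpa using Lquartic_le_quarticConditions F
  | succ k ih =>
    rw [pow_succ]
    exact (mul_le_mul_left ih _).trans (quarticConditions_mul_Lquartic_le F k)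

theorem degree_conditions_of_mem_quarticSemigroupSet {F : Type} [Field F] {k e : ℕ}
    (h : (k + 1, e) ∈ quarticSemigroupSet F) :
    e ≤ 4 * k + 4 ∧ e ≠ 4 * k + 3 ∧ e ≠ 0 ∧ (e = 1 → k = 0) := by
  obtain ⟨f, hf, hne, hdeg : f.natDegree = e⟩ := h
  obtain ⟨a, b, c, d⟩ := Lquartic_pow_le_quarticConditions F k hf
  have hlead : f.coeff e ≠ 0 := by
    rw [← hdeg]
    exact leadingCoeff_ne_zero.mpr hne
  refine ⟨not_lt.mp fun h => hlead (a e h), ?_, ?_, ?_⟩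
  · rintro rfl
    exact hlead c
  · rintro rfl
    rw [b] at hlead
    exact absurd (le_natDegree_of_ne_zero hlead) (by omega)
  · rintro rfl
    rw [d] at hlead
    have := le_natDegree_of_ne_zero hlead
    omega

theorem eq_zero_of_zero_mem_quarticSemigroupSet {F : Type} [Field F] {e : ℕ}
    (h : (0, e) ∈ quarticSemigroupSet F) : e = 0 := by
  obtain ⟨f, hf, -, hdeg : f.natDegree = e⟩ := h
  rw [pow_zero, Submodule.mem_one] at hf
  obtain ⟨c, rfl⟩ := hf
  rw [← hdeg, algebraMap_eq, natDegree_C]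

theorem X_mem_Lquartic (F : Type) [Field F] : X ∈ Lquartic F :=
  Submodule.subset_span (by simp)

theorem X_sq_mem_Lquartic (F : Type) [Field F] : X ^ 2 ∈ Lquartic F :=
  Submodule.subset_span (by simp)

theorem one_add_X_pow_four_mem_Lquartic (F : Type) [Field F] : 1 + X ^ 4 ∈ Lquartic F :=
  Submodule.subset_span (by simp)

theorem X_pow_mem_Lquartic_pow (F : Type) [Field F] (k : ℕ) :
    X ^ 2 ∈ Lquartic F ^ (k + 2) ∧ X ^ 3 ∈ Lquartic F ^ (k + 2) ∧
      X ^ 4 ∈ Lquartic F ^ (k + 2) := by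
  have h1 := X_mem_Lquartic F
  have h2 := X_sq_mem_Lquartic F
  induction k with
  | zero =>
    rw [zero_add, pow_two (Lquartic F)]
    refine ⟨?_, ?_, ?_⟩
    · simpa [← pow_two] using Submodule.mul_mem_mul h1 h1
    · simpa [← pow_succ] using Submodule.mul_mem_mul h2 h1
    · simpa [← pow_add] using Submodule.mul_mem_mul h2 h2
  | succ k ih =>
    obtain ⟨m2, m3, m4⟩ := ih
    rw [show k + 1 + 2 = (k + 2) + 1 by ring, pow_succ (Lquartic F)]
    refine ⟨?_, ?_, ?_⟩
    · have h := sub_mem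
        (Submodule.mul_mem_mul m2 (one_add_X_pow_four_mem_Lquartic F))
        (Submodule.mul_mem_mul m4 h2)
      convert h using 1
      ring
    · simpa [← pow_succ] using Submodule.mul_mem_mul m2 h1
    · simpa [← pow_succ] using Submodule.mul_mem_mul m3 h1

/-- The value semigroup as an additive submonoid of `ℕ × ℕ`. -/
def quarticSemigroup (F : Type) [Field F] : AddSubmonoid (ℕ × ℕ) where
  carrier := quarticSemigroupSet F
  zero_mem' := ⟨1, by simp [Submodule.one_le.mp le_rfl], one_ne_zero, natDegree_one⟩
  add_mem' := by
    rintro p q ⟨f, hf, hf0, hfd⟩ ⟨g, hg, hg0, hgd⟩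
    refine ⟨f * g, ?_, mul_ne_zero hf0 hg0, ?_⟩
    · rw [Prod.fst_add, pow_add]
      exact Submodule.mul_mem_mul hf hg
    · rw [natDegree_mul hf0 hg0, hfd, hgd, Prod.snd_add]

/-- The generating set `{(1,1), (1,2), (1,4)} ∪ {(k,2) : k ≥ 3}`. -/
def quarticGenerators : Set (ℕ × ℕ) :=
  ({((1 : ℕ), (1 : ℕ)), (1, 2), (1, 4)} : Set (ℕ × ℕ)) ∪ {p | ∃ k : ℕ, 3 ≤ k ∧ p = (k, 2)}

theorem mk_two_mem_quarticSemigroupSet (F : Type) [Field F] {k : ℕ} (hk : 3 ≤ k) :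
    (k, 2) ∈ quarticSemigroupSet F := by
  obtain ⟨m, rfl⟩ : ∃ m, k = m + 2 := ⟨k - 2, by omega⟩
  exact ⟨X ^ 2, (X_pow_mem_Lquartic_pow F m).1, pow_ne_zero _ X_ne_zero, natDegree_X_pow 2⟩

theorem quarticGenerators_subset_quarticSemigroupSet (F : Type) [Field F] :
    quarticGenerators ⊆ quarticSemigroupSet F := by
  have hdeg : (1 + X ^ 4 : F[X]).natDegree = 4 := by
    compute_degree!
  rintro p ((rfl | rfl | rfl) | ⟨k, hk, rfl⟩)
  · exact ⟨X, by simpa using X_mem_Lquartic F, X_ne_zero, natDegree_X⟩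
  · exact ⟨X ^ 2, by simpa using X_sq_mem_Lquartic F, pow_ne_zero _ X_ne_zero, natDegree_X_pow 2⟩
  · exact ⟨1 + X ^ 4, by simpa using one_add_X_pow_four_mem_Lquartic F,
      ne_zero_of_natDegree_gt (n := 0) (by omega), hdeg⟩
  · exact mk_two_mem_quarticSemigroupSet F hk

theorem mem_closure_quarticGenerators {k e : ℕ} (hle : e ≤ 4 * k + 4) (hne : e ≠ 4 * k + 3)
    (h0 : e ≠ 0) (h1 : e = 1 → k = 0) :
    (k + 1, e) ∈ AddSubmonoid.closure quarticGenerators := by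
  have g1 : (1, 1) ∈ AddSubmonoid.closure quarticGenerators :=
    AddSubmonoid.subset_closure (by simp [quarticGenerators])
  have g2 : (1, 2) ∈ AddSubmonoid.closure quarticGenerators :=
    AddSubmonoid.subset_closure (by simp [quarticGenerators])
  have g4 : (1, 4) ∈ AddSubmonoid.closure quarticGenerators :=
    AddSubmonoid.subset_closure (by simp [quarticGenerators])
  induction k generalizing e with
  | zero =>
    obtain rfl | rfl | rfl : e = 1 ∨ e = 2 ∨ e = 4 := by omega
    exacts [g1, g2, g4]
  | succ k ih =>
    have step : ∀ d, (1, d) ∈ AddSubmonoid.closure quarticGenerators →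
        d + 2 ≤ e → e ≤ 4 * k + 4 + d → e ≠ 4 * k + 3 + d →
        (k + 1 + 1, e) ∈ AddSubmonoid.closure quarticGenerators := by
      intro d hd hde hle hne
      have := add_mem (ih (e := e - d) (by omega) (by omega) (by omega) (by omega)) hd
      rwa [Prod.mk_add_mk, Nat.sub_add_cancel (by omega)] at this
    by_cases he2 : e = 2
    · subst he2
      rcases Nat.eq_zero_or_pos k with rfl | hk
      · exact add_mem g1 g1
      · exact AddSubmonoid.subset_closure (Or.inr ⟨k + 1 + 1, by omega, rfl⟩)
    · by_cases hsmall : e ≤ 4 * k + 5 ∧ e ≠ 4 * k + 4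
      · exact step 1 g1 (by omega) (by omega) (by omega)
      · by_cases hmid : e = 4 * k + 4
        · exact step 2 g2 (by omega) (by omega) (by omega)
        · exact step 4 g4 (by omega) (by omega) (by omega)

theorem closure_quarticGenerators (F : Type) [Field F] :
    AddSubmonoid.closure quarticGenerators = quarticSemigroup F := by
  refine le_antisymm
    (AddSubmonoid.closure_le.mpr (quarticGenerators_subset_quarticSemigroupSet F)) ?_
  rintro ⟨_ | k, e⟩ h
  · rw [eq_zero_of_zero_mem_quarticSemigroupSet h]
    exact zero_mem _
  · obtain ⟨hle, hne, h0, h1⟩ := degree_conditions_of_mem_quarticSemigroupSet h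
    exact mem_closure_quarticGenerators hle hne h0 h1

theorem not_fg_quarticSemigroup (F : Type) [Field F] : ¬ (quarticSemigroup F).FG := by
  rintro ⟨T, hT⟩
  let M := T.sup Prod.fst
  have hslope : ∀ p ∈ quarticSemigroup F, p.1 ≤ M * p.2 := by
    intro p hp
    rw [← hT] at hp
    induction hp using AddSubmonoid.closure_induction with
    | mem p hp =>
      have hpS : p ∈ quarticSemigroupSet F :=
        (hT ▸ AddSubmonoid.subset_closure hp : p ∈ quarticSemigroup F)
      have hpM : p.1 ≤ M := Finset.le_sup (f := Prod.fst) hp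
      obtain ⟨_ | k, e⟩ := p
      · exact Nat.zero_le _
      · have he := (degree_conditions_of_mem_quarticSemigroupSet hpS).2.2.1
        exact hpM.trans (Nat.le_mul_of_pos_right M (Nat.pos_of_ne_zero he))
    | zero => simp
    | add p q _ _ hp hq =>
      rw [Prod.fst_add, Prod.snd_add, mul_add]
      exact add_le_add hp hq
  have := hslope _ (mk_two_mem_quarticSemigroupSet F (k := 2 * M + 3) (by omega))
  simp only at this
  omega

/-- **Example 2.4.** The value semigroup of the homogeneous valuation
`f(t)·xᵃ ↦ (a, deg f)` on `K[tx, t²x, (1 + t⁴)x]` is the set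
`S = {(k, e) : ∃ f ∈ L^k, f ≠ 0, deg f = e}`; it is an additive submonoid of `ℕ × ℕ`,
it is generated by the infinite set `{(1,1), (1,2), (1,4)} ∪ {(k,2) : k ≥ 3}`,
and it is not finitely generated. -/
theorem quartic_value_semigroup :
    ((AddSubmonoid.closure (quarticSemigroupSet K) : AddSubmonoid (ℕ × ℕ)) : Set (ℕ × ℕ)) =
        quarticSemigroupSet K ∧
    AddSubmonoid.closure (quarticSemigroupSet K) =
      AddSubmonoid.closure
        (({((1 : ℕ), (1 : ℕ)), (1, 2), (1, 4)} : Set (ℕ × ℕ)) ∪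
          {p | ∃ k : ℕ, 3 ≤ k ∧ p = (k, 2)}) ∧
    ¬ (AddSubmonoid.closure (quarticSemigroupSet K)).FG := by
  have hS : AddSubmonoid.closure (quarticSemigroupSet K) = quarticSemigroup K :=
    AddSubmonoid.closure_eq (quarticSemigroup K)
  rw [hS]
  exact ⟨rfl, (closure_quarticGenerators K).symm, not_fg_quarticSemigroup K⟩

end
end
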